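/- Let p be a prime, F a field of characteristic p, G a finite metacyclic p-group, and H a finite group. If the group algebras F[G] and F[H] are isomorphic as F-algebras, then the groups G and H are isomorphic. -/

import Mathlib

/-- A group is *metacyclic* if it has a cyclic normal subgroup with cyclic quotient. -/
def IsMetacyclic (G : Type*) [Group G] : Prop :=
  ∃ N : Subgroup G, ∃ h : N.Normal, IsCyclic N ∧ (haveI := h; IsCyclic (G ⧸ N))

open Polynomial in
theorem trace_derivative_pow {F A : Type*} [Field F] [Ring A] [Algebra F A]
    (T : A[X] →+ F[X]) (hT : ∀ P Q, T (P * Q) = T (Q * P)) (Q : A[X]) (n m : ℕ) :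
    T (derivative (Q ^ (n + 1)) * Q ^ m) = (n + 1) • T (Q ^ (n + m) * derivative Q) := by
  induction n generalizing m with
  | zero => simp [hT (derivative Q)]
  | succ n ih =>
    rw [pow_succ Q (n + 1), derivative_mul, add_mul, map_add, mul_assoc, ← pow_succ', ih,
      mul_assoc, hT (Q ^ (n + 1)), mul_assoc, ← pow_add, hT (derivative Q)]
    rw [show n + (m + 1) = n + 1 + m by ring, show m + (n + 1) = n + 1 + m by ring, ← succ_nsmul]

open Polynomial in
/-- A trace form composed with the `p`-power map is additive in characteristic `p`. -/
theorem trace_add_pow_char {p : ℕ} [Fact p.Prime] {F A : Type*} [Field F] [CharP F p] [Ring A]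
    [Algebra F A] (τ : A →ₗ[F] F) (hτ : ∀ x y, τ (x * y) = τ (y * x)) (x y : A) :
    τ ((x + y) ^ p) = τ (x ^ p) + τ (y ^ p) := by
  have hp : p.Prime := Fact.out
  let T : A[X] →+ F[X] :=
    { toFun := fun P => ∑ i ∈ Finset.range (P.natDegree + 1), monomial i (τ (P.coeff i))
      map_zero' := by simp
      map_add' := by
        intro P Q
        ext i
        have key : ∀ P : A[X], (∑ i ∈ Finset.range (P.natDegree + 1),
            monomial i (τ (P.coeff i))).coeff i = τ (P.coeff i) := by
          intro P
          simp only [finsetSum_coeff, coeff_monomial, Finset.sum_ite_eq', Finset.mem_range]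
          split_ifs with h
          · rfl
          · rw [coeff_eq_zero_of_natDegree_lt (by omega), map_zero]
        rw [coeff_add, key, key, key, coeff_add, map_add] }
  have hTc : ∀ P i, (T P).coeff i = τ (P.coeff i) := by
    intro P i
    change (∑ i ∈ Finset.range (P.natDegree + 1), monomial i (τ (P.coeff i))).coeff i = _
    simp only [finsetSum_coeff, coeff_monomial, Finset.sum_ite_eq', Finset.mem_range]
    split_ifs with h
    · rfl
    · rw [coeff_eq_zero_of_natDegree_lt (by omega), map_zero]
  have hT : ∀ P Q, T (P * Q) = T (Q * P) := by
    intro P Q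
    ext i
    rw [hTc, hTc, coeff_mul, coeff_mul, map_sum, map_sum,
      ← Finset.Nat.sum_antidiagonal_swap]
    exact Finset.sum_congr rfl fun a _ => by simp [hτ]
  set Q : A[X] := C x + X * C y with hQ
  have hder : derivative (T (Q ^ p)) = 0 := by
    obtain ⟨q, hq⟩ : ∃ q, p = q + 1 := ⟨p - 1, by have := hp.pos; omega⟩
    have h1 := trace_derivative_pow T hT Q q 0
    have h2 : derivative (T (Q ^ p)) = T (derivative (Q ^ p)) := by
      ext i
      rw [coeff_derivative, hTc, hTc, coeff_derivative]
      rw [← Nat.cast_add_one, ← Nat.cast_add_one, ← nsmul_eq_mul', ← nsmul_eq_mul', map_nsmul]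
    rw [h2, hq]
    simp only [pow_zero, mul_one] at h1
    rw [h1, ← hq, nsmul_eq_mul]
    ext i
    simp
  have hdeg : Q.natDegree ≤ 1 := by
    rw [hQ]
    refine (natDegree_add_le _ _).trans (max_le (by simp) ?_)
    refine natDegree_mul_le.trans ?_
    simpa using natDegree_X_le (R := A)
  have hdegp : (Q ^ p).natDegree ≤ p := by
    refine natDegree_pow_le.trans ?_
    calc p * Q.natDegree ≤ p * 1 := Nat.mul_le_mul_left _ hdeg
      _ = p := mul_one _
  have hc0 : (Q ^ p).coeff 0 = x ^ p := by
    have := map_pow (constantCoeff (R := A)) Q p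
    simpa [hQ] using this
  have hcp : (Q ^ p).coeff p = y ^ p := by
    have := coeff_pow_of_natDegree_le (m := p) hdeg
    rw [mul_one] at this
    rw [this]; simp [hQ]
  have hev : (x + y) ^ p = ∑ i ∈ Finset.range (p + 1), (Q ^ p).coeff i := by
    let e : A[X] →+* A := eval₂RingHom' (RingHom.id A) 1 (fun a => Commute.one_right _)
    have h1 : e (Q ^ p) = (x + y) ^ p := by
      rw [map_pow]; congr 1; simp [e, hQ, eval₂RingHom']
    rw [← h1]
    change eval₂ (RingHom.id A) 1 (Q ^ p) = _
    rw [eval₂_eq_sum_range' _ (Nat.lt_succ_of_le hdegp)]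
    simp
  rw [hev, map_sum, Finset.sum_range_succ, hcp]
  obtain ⟨q, hq⟩ : ∃ q, p = q + 1 := ⟨p - 1, by have := hp.pos; omega⟩
  have hmid : ∀ i, i < q → τ ((Q ^ p).coeff (i + 1)) = 0 := by
    intro i hi
    have := congrArg (fun P => P.coeff i) hder
    simp only [coeff_derivative, hTc, coeff_zero, mul_eq_zero] at this
    refine this.resolve_right ?_
    have h2 : ((i + 1 : ℕ) : F) ≠ 0 := by
      rw [Ne, CharP.cast_eq_zero_iff F p]
      exact Nat.not_dvd_of_pos_of_lt (by omega) (by omega)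
    exact_mod_cast h2
  congr 1
  conv_lhs => rw [hq, Finset.sum_range_succ']
  rw [← hq, hc0, Finset.sum_eq_zero (fun i hi => hmid i (Finset.mem_range.mp hi)), zero_add]

/-- The linear functional on a group algebra extending a function on the group. -/
noncomputable def evalAt {F G : Type*} [Field F] (f : G → F) : MonoidAlgebra F G →ₗ[F] F :=
  (Finsupp.linearCombination F f) ∘ₗ (MonoidAlgebra.coeffLinearEquiv F).toLinearMap

section evalAt

variable {F G : Type*} [Field F]

@[simp]
theorem evalAt_single (f : G → F) (g : G) (r : F) :
    evalAt f (MonoidAlgebra.single g r) = r * f g := by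
  simp [evalAt, MonoidAlgebra.coeffLinearEquiv]

theorem evalAt_eq_sum [Fintype G] (f : G → F) (x : MonoidAlgebra F G) :
    evalAt f x = ∑ g, x.coeff g * f g := by
  simp only [evalAt, LinearMap.comp_apply]
  change (Finsupp.linearCombination F f) x.coeff = _
  rw [Finsupp.linearCombination_apply, Finsupp.sum_fintype _ _ (by simp)]
  rfl

theorem eq_sum_single [Fintype G] (x : MonoidAlgebra F G) :
    x = ∑ g, MonoidAlgebra.single g (x.coeff g) := by
  conv_lhs => rw [← MonoidAlgebra.sum_coeff_single x, Finsupp.sum_fintype _ _ (by simp)]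

theorem linearMap_eq_evalAt (τ : MonoidAlgebra F G →ₗ[F] F) :
    τ = evalAt fun g => τ (MonoidAlgebra.single g 1) := by
  refine LinearMap.ext fun x => ?_
  induction x using MonoidAlgebra.induction_linear with
  | zero => simp
  | add x y hx hy => rw [map_add, map_add, hx, hy]
  | single g r =>
    rw [evalAt_single, ← smul_eq_mul, ← map_smul, MonoidAlgebra.smul_single, smul_eq_mul, mul_one]

theorem evalAt_zero : evalAt (0 : G → F) = 0 := by
  rw [linearMap_eq_evalAt (0 : MonoidAlgebra F G →ₗ[F] F)]
  rfl

theorem evalAt_add (x y : G → F) : evalAt (x + y) = evalAt x + evalAt y := by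
  rw [linearMap_eq_evalAt (evalAt x + evalAt y)]
  congr 1
  funext g
  simp

theorem evalAt_smul (c : F) (x : G → F) : evalAt (c • x) = c • evalAt x := by
  rw [linearMap_eq_evalAt (c • evalAt x)]
  congr 1
  funext g
  simp

theorem evalAt_mul_comm [Monoid G] {f : G → F} (hf : ∀ g h, f (g * h) = f (h * g))
    (x y : MonoidAlgebra F G) : evalAt f (x * y) = evalAt f (y * x) := by
  induction x using MonoidAlgebra.induction_linear with
  | zero => simp
  | add x x' hx hx' => rw [add_mul, mul_add, map_add, map_add, hx, hx']
  | single g r =>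
    induction y using MonoidAlgebra.induction_linear with
    | zero => simp
    | add y y' hy hy' => rw [add_mul, mul_add, map_add, map_add, hy, hy']
    | single h s => simp [hf g h, mul_comm r s]

theorem evalAt_pow_char [Monoid G] [Fintype G] {p : ℕ} [Fact p.Prime] [CharP F p]
    {f : G → F} (hf : ∀ g h, f (g * h) = f (h * g)) (x : MonoidAlgebra F G) :
    evalAt f (x ^ p) = ∑ g, x.coeff g ^ p * f (g ^ p) := by
  have hp : p ≠ 0 := (Fact.out : p.Prime).ne_zero
  have key : ∀ s : Finset G, evalAt f ((∑ g ∈ s, MonoidAlgebra.single g (x.coeff g)) ^ p) =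
      ∑ g ∈ s, x.coeff g ^ p * f (g ^ p) := by
    intro s
    classical
    induction s using Finset.induction_on with
    | empty => simp [hp]
    | insert a s ha ih =>
      rw [Finset.sum_insert ha, Finset.sum_insert ha,
        trace_add_pow_char (evalAt f) (evalAt_mul_comm hf), ih, MonoidAlgebra.single_pow,
        evalAt_single]
  conv_lhs => rw [eq_sum_single x]
  exact key _

theorem evalAt_pow_char_pow [Monoid G] [Fintype G] {p : ℕ} [Fact p.Prime] [CharP F p]
    (n : ℕ) {f : G → F} (hf : ∀ g h, f (g * h) = f (h * g)) (x : MonoidAlgebra F G) :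
    evalAt f (x ^ p ^ n) = ∑ g, x.coeff g ^ p ^ n * f (g ^ p ^ n) := by
  classical
  have hp : p ≠ 0 := (Fact.out : p.Prime).ne_zero
  have hpow : ∀ (n : ℕ) (g h : G) (f : G → F), (∀ g h, f (g * h) = f (h * g)) →
      f ((g * h) ^ n) = f ((h * g) ^ n) := by
    intro n g h f hf
    cases n with
    | zero => simp
    | succ n =>
      have hs : SemiconjBy g (h * g) (g * h) := (mul_assoc g h g).symm
      rw [pow_succ (g * h), ← mul_assoc, hf, ← (hs.pow_right n).eq, ← mul_assoc, pow_succ']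
  have ind : ∀ (n : ℕ) (f : G → F), (∀ g h, f (g * h) = f (h * g)) →
      (∀ g, f g = 0 ∨ f g = 1) → ∀ x : MonoidAlgebra F G,
      evalAt f (x ^ p ^ n) = ∑ g, x.coeff g ^ p ^ n * f (g ^ p ^ n) := by
    intro n
    induction n with
    | zero => intro f hf _ x; simp [evalAt_eq_sum]
    | succ n ih =>
      intro f hf h01 x
      have hf' : ∀ g h, f ((g * h) ^ p ^ n) = f ((h * g) ^ p ^ n) := fun g h => hpow _ g h f hf
      have e1 := evalAt_pow_char (f := fun g => f (g ^ p ^ n)) hf' x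
      rw [pow_succ', pow_mul, ih f hf h01]
      have hq : ∀ c : G, f c = f c ^ p ^ n := by
        intro c
        rcases h01 c with h | h <;> simp [h, hp]
      calc ∑ g, (x ^ p).coeff g ^ p ^ n * f (g ^ p ^ n)
          = (∑ g, (x ^ p).coeff g * f (g ^ p ^ n)) ^ p ^ n := by
            rw [sum_pow_char_pow]
            exact Finset.sum_congr rfl fun g _ => by rw [mul_pow, ← hq]
        _ = (∑ g, x.coeff g ^ p * f ((g ^ p) ^ p ^ n)) ^ p ^ n := by
            rw [← evalAt_eq_sum (fun g => f (g ^ p ^ n)), e1]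
        _ = _ := by
            rw [sum_pow_char_pow]
            refine Finset.sum_congr rfl fun g _ => ?_
            rw [mul_pow, ← hq, ← pow_mul, ← pow_mul]
  let T : Finset F := Finset.univ.image f
  have hdec : ∀ g, f g = ∑ t ∈ T, t * (if f g = t then 1 else 0) := by
    intro g
    simp [T]
  have hlin : ∀ y : MonoidAlgebra F G,
      evalAt f y = ∑ t ∈ T, t * evalAt (fun g => if f g = t then 1 else 0) y := by
    intro y
    simp only [evalAt_eq_sum, Finset.mul_sum]
    rw [Finset.sum_comm]
    refine Finset.sum_congr rfl fun g _ => ?_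
    conv_lhs => rw [hdec g, Finset.mul_sum]
    exact Finset.sum_congr rfl fun t _ => by ring
  rw [hlin]
  rw [Finset.sum_congr rfl fun t _ => by
    rw [ind n (fun g => if f g = t then 1 else 0) (fun g h => by simp only [hf g h])
      (fun g => by by_cases h : f g = t <;> simp [h]) x]]
  simp only [Finset.mul_sum]
  rw [Finset.sum_comm]
  refine Finset.sum_congr rfl fun g _ => ?_
  conv_rhs => rw [hdec, Finset.mul_sum]
  exact Finset.sum_congr rfl fun t _ => by ring

end evalAt

/-- In characteristic `p`, the sum of an invariant function under the action of a finite `p`-group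
reduces to the sum over the fixed points. -/
theorem sum_eq_sum_fixedPoints {p : ℕ} [Fact p.Prime] {F P X : Type*} [Field F] [CharP F p]
    [Group P] [Finite P] (hP : IsPGroup p P) [MulAction P X] [Fintype X] (φ : X → F)
    (hφ : ∀ (c : P) (x : X), φ (c • x) = φ x) [DecidablePred (· ∈ MulAction.fixedPoints P X)] :
    ∑ x, φ x = ∑ x with x ∈ MulAction.fixedPoints P X, φ x := by
  classical
  have h1 : ∀ s : Finset X, ∑ x ∈ s, φ x =
      ∑ t ∈ Finset.univ.image φ, ((s.filter fun x => φ x = t).card : F) * t := by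
    intro s
    rw [← Finset.sum_fiberwise_of_maps_to (g := φ) (t := Finset.univ.image φ)
      (fun x _ => Finset.mem_image_of_mem _ (Finset.mem_univ x))]
    refine Finset.sum_congr rfl fun t _ => ?_
    rw [Finset.sum_congr rfl (fun x hx => (Finset.mem_filter.mp hx).2)]
    simp
  rw [h1, h1]
  refine Finset.sum_congr rfl fun t _ => ?_
  congr 1
  let S : SubMulAction P X :=
    { carrier := {x | φ x = t}
      smul_mem' := fun c x hx => by simpa [hφ] using hx }
  have h2 := hP.card_modEq_card_fixedPoints S
  rw [← (CharP.natCast_eq_natCast F p)] at h2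
  have c1 : Nat.card S = (Finset.univ.filter fun x => φ x = t).card := by
    rw [← Nat.card_eq_finsetCard]
    exact Nat.card_congr (Equiv.subtypeEquivRight fun x => by
      rw [Finset.mem_filter]; exact ⟨fun h => ⟨Finset.mem_univ _, h⟩, fun h => h.2⟩)
  have c2 : Nat.card (MulAction.fixedPoints P S) =
      ((Finset.univ.filter fun x => x ∈ MulAction.fixedPoints P X).filter fun x => φ x =
          t).card := by
    rw [← Nat.card_eq_finsetCard]
    refine Nat.card_congr
      { toFun := fun x => ⟨x.1.1, ?_⟩
        invFun := fun x => ⟨⟨x.1, ?_⟩, ?_⟩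
        left_inv := fun x => rfl
        right_inv := fun x => rfl }
    · rw [Finset.mem_filter, Finset.mem_filter]
      exact ⟨⟨Finset.mem_univ _, fun c => congrArg Subtype.val (x.2 c)⟩, x.1.2⟩
    · exact (Finset.mem_filter.mp x.2).2
    · intro c
      exact Subtype.ext ((Finset.mem_filter.mp (Finset.mem_filter.mp x.2).1).2 c)
  rw [← c1, ← c2, h2]

theorem sum_eq_sum_center {p : ℕ} [Fact p.Prime] {F G : Type*} [Field F] [CharP F p]
    [Group G] [Fintype G] (hG : IsPGroup p G) (φ : G → F) (hφ : ∀ g h, φ (g * h) = φ (h * g))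
    [DecidablePred (· ∈ Subgroup.center G)] :
    ∑ x, φ x = ∑ x with x ∈ Subgroup.center G, φ x := by
  classical
  have hP : IsPGroup p (ConjAct G) := hG
  have : Finite (ConjAct G) := ‹Fintype G›.finite
  rw [sum_eq_sum_fixedPoints hP φ]
  · refine Finset.sum_congr ?_ fun _ _ => rfl
    ext x
    rw [Finset.mem_filter, Finset.mem_filter, ConjAct.fixedPoints_eq_center]
    rfl
  · intro c x
    rw [ConjAct.smul_def, mul_assoc, hφ, mul_assoc, inv_mul_cancel, mul_one]

section Transport

variable {p : ℕ} [Fact p.Prime] {F : Type*} [Field F] [CharP F p]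
  {G : Type*} [Group G] {H : Type*} [Group H]

theorem Nat.card_eq_of_monoidAlgebra_linearEquiv {F G H : Type*} [Field F] [Finite G] [Finite H]
    (φ : MonoidAlgebra F G ≃ₗ[F] MonoidAlgebra F H) : Nat.card G = Nat.card H := by
  have := Fintype.ofFinite G
  have := Fintype.ofFinite H
  have h := (((MonoidAlgebra.coeffLinearEquiv F).symm.trans φ).trans
    (MonoidAlgebra.coeffLinearEquiv F)).finrank_eq
  rw [Module.finrank_finsupp_self, Module.finrank_finsupp_self] at h
  rwa [Nat.card_eq_fintype_card, Nat.card_eq_fintype_card]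

/-- The function on `G` whose extension to `F[G]` is the composite of `φ` with the extension of the
function `f` on `H`. -/
noncomputable def pullEval (φ : MonoidAlgebra F G →ₐ[F] MonoidAlgebra F H) (f : H → F) (g : G) :
    F :=
  evalAt f (φ (MonoidAlgebra.single g 1))

theorem evalAt_pullEval (φ : MonoidAlgebra F G →ₐ[F] MonoidAlgebra F H) (f : H → F)
    (x : MonoidAlgebra F G) : evalAt (pullEval φ f) x = evalAt f (φ x) :=
  (LinearMap.congr_fun (linearMap_eq_evalAt ((evalAt f) ∘ₗ φ.toLinearMap)) x).symm

theorem pullEval_mul_comm (φ : MonoidAlgebra F G →ₐ[F] MonoidAlgebra F H) {f : H → F}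
    (hf : ∀ g h, f (g * h) = f (h * g)) (g h : G) :
    pullEval φ f (g * h) = pullEval φ f (h * g) := by
  have e : ∀ g h : G, MonoidAlgebra.single (g * h) (1 : F) =
    MonoidAlgebra.single g 1 * MonoidAlgebra.single h 1 := by simp
  simp only [pullEval]
  rw [e, e, map_mul φ, map_mul φ, evalAt_mul_comm hf]

theorem evalAt_map_pow [Fintype G] (φ : MonoidAlgebra F G →ₐ[F] MonoidAlgebra F H) {f : H → F}
    (hf : ∀ g h, f (g * h) = f (h * g)) (n : ℕ) (x : MonoidAlgebra F G) :
    evalAt f (φ x ^ p ^ n) = ∑ g, x.coeff g ^ p ^ n * pullEval φ f (g ^ p ^ n) := by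
  rw [← map_pow, ← evalAt_pullEval, evalAt_pow_char_pow n (pullEval_mul_comm φ hf)]

open Classical in
/-- The indicator function of the conjugacy class of `h`. -/
noncomputable def conjIndicator (F : Type*) [Field F] (h c : H) : F := if IsConj h c then 1 else 0

theorem conjIndicator_mul_comm (h : H) (a b : H) :
    conjIndicator F h (a * b) = conjIndicator F h (b * a) := by
  have e : IsConj (a * b) (b * a) := isConj_iff.mpr ⟨a⁻¹, by group⟩
  unfold conjIndicator
  congr 1
  exact propext ⟨fun k => k.trans e, fun k => k.trans e.symm⟩

@[simp]
theorem conjIndicator_self (h : H) : conjIndicator F h h = 1 := if_pos (IsConj.refl h)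

theorem conjIndicator_of_mem_center {h c : H} (hc : c ∈ Subgroup.center H) (hne : c ≠ h) :
    conjIndicator F h c = 0 := by
  refine if_neg fun k => hne ?_
  obtain ⟨d, hd⟩ := isConj_iff.mp k
  refine mul_left_cancel (a := d) ?_
  rw [Subgroup.mem_center_iff.mp hc d, ← hd, inv_mul_cancel_right]

theorem coeff_mul_comm_of_commute {x : MonoidAlgebra F G}
    (hx : ∀ y, x * y = y * x) (g h : G) : x.coeff (g * h) = x.coeff (h * g) := by
  have e := congrArg (fun y => y.coeff (g * h * g)) (hx (MonoidAlgebra.single g 1))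
  simpa [MonoidAlgebra.coeff_mul_single_apply, MonoidAlgebra.coeff_single_mul_apply, mul_assoc]
    using e

theorem commute_symm_single_of_mem_center (φ : MonoidAlgebra F G ≃ₐ[F] MonoidAlgebra F H) {h : H}
    (hh : h ∈ Subgroup.center H) (y : MonoidAlgebra F G) :
    φ.symm (MonoidAlgebra.single h 1) * y = y * φ.symm (MonoidAlgebra.single h 1) := by
  apply φ.injective
  rw [map_mul, map_mul, AlgEquiv.apply_symm_apply]
  induction φ y using MonoidAlgebra.induction_linear with
  | zero => simp
  | add x x' hx hx' => rw [add_mul, mul_add, hx, hx']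
  | single g r =>
    rw [MonoidAlgebra.single_mul_single, MonoidAlgebra.single_mul_single,
      Subgroup.mem_center_iff.mp hh g, mul_comm]

theorem pow_eq_one_of_algEquiv [Finite G] (φ : MonoidAlgebra F G ≃ₐ[F] MonoidAlgebra F H) {n : ℕ}
    (hG : ∀ g : G, g ^ p ^ n = 1) (h : H) : h ^ p ^ n = 1 := by
  have := Fintype.ofFinite G
  by_contra hne
  have e := evalAt_map_pow (p := p) φ.toAlgHom (conjIndicator_mul_comm (F := F) (h ^ p ^ n)) n
    (φ.symm (MonoidAlgebra.single h 1))
  have h1 : pullEval φ.toAlgHom (conjIndicator F (h ^ p ^ n)) 1 = 0 := by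
    change evalAt _ (φ (MonoidAlgebra.single 1 1)) = 0
    rw [← MonoidAlgebra.one_def, map_one, MonoidAlgebra.one_def, evalAt_single, one_mul]
    exact conjIndicator_of_mem_center (one_mem _) (Ne.symm hne)
  have h2 : φ.toAlgHom (φ.symm (MonoidAlgebra.single h 1)) = MonoidAlgebra.single h 1 :=
    φ.apply_symm_apply _
  rw [h2, MonoidAlgebra.single_pow, evalAt_single] at e
  simp [hG, h1] at e

theorem evalAt_symm_center [Fintype G] (hG : IsPGroup p G)
    (φ : MonoidAlgebra F G ≃ₐ[F] MonoidAlgebra F H) {h : H}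
    (hh : h ∈ Subgroup.center H) {f : H → F} (hf : ∀ g h, f (g * h) = f (h * g)) (n : ℕ)
    [DecidablePred (· ∈ Subgroup.center G)] :
    f (h ^ p ^ n) = ∑ g with g ∈ Subgroup.center G,
      (φ.symm (MonoidAlgebra.single h 1)).coeff g ^ p ^ n * pullEval φ.toAlgHom f (g ^ p ^ n) := by
  have e := evalAt_map_pow (p := p) φ.toAlgHom hf n (φ.symm (MonoidAlgebra.single h 1))
  have h2 : φ.toAlgHom (φ.symm (MonoidAlgebra.single h 1)) = MonoidAlgebra.single h 1 :=
    φ.apply_symm_apply _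
  rw [h2, MonoidAlgebra.single_pow, evalAt_single] at e
  rw [← sum_eq_sum_center hG, ← e]
  · simp
  · intro a b
    rw [coeff_mul_comm_of_commute (commute_symm_single_of_mem_center φ hh)]
    congr 1
    have hs : SemiconjBy a (b * a) (a * b) := (mul_assoc a b a).symm
    rw [← (eq_mul_inv_of_mul_eq ((hs.pow_right _).eq).symm).symm, mul_assoc,
      pullEval_mul_comm _ hf, inv_mul_cancel_right]

theorem center_pow_eq_one_of_algEquiv [Finite G] (hG : IsPGroup p G)
    (φ : MonoidAlgebra F G ≃ₐ[F] MonoidAlgebra F H) {n : ℕ}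
    (hZ : ∀ g ∈ Subgroup.center G, g ^ p ^ n = 1) (h : H) (hh : h ∈ Subgroup.center H) :
    h ^ p ^ n = 1 := by
  classical
  have := Fintype.ofFinite G
  by_contra hne
  have e := evalAt_symm_center (p := p) hG φ hh (conjIndicator_mul_comm (F := F) (h ^ p ^ n)) n
  have h1 : pullEval φ.toAlgHom (conjIndicator F (h ^ p ^ n)) 1 = 0 := by
    change evalAt _ (φ (MonoidAlgebra.single 1 1)) = 0
    rw [← MonoidAlgebra.one_def, map_one, MonoidAlgebra.one_def, evalAt_single, one_mul]
    exact conjIndicator_of_mem_center (one_mem _) (Ne.symm hne)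
  rw [conjIndicator_self, Finset.sum_eq_zero] at e
  · exact one_ne_zero e
  · intro g hg
    rw [hZ g (Finset.mem_filter.mp hg).2, h1, mul_zero]

theorem exists_pow_eq_of_algEquiv [Finite G] [Finite H] (hG : IsPGroup p G)
    (φ : MonoidAlgebra F G ≃ₐ[F] MonoidAlgebra F H)
    (hZ : ∀ g ∈ Subgroup.center G, ∃ c, c ^ p = g) (h : H) (hh : h ∈ Subgroup.center H) :
    ∃ c, c ^ p = h := by
  classical
  have := Fintype.ofFinite G
  have := Fintype.ofFinite H
  by_contra! hne
  have hf := conjIndicator_mul_comm (F := F) h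
  have e := evalAt_symm_center (p := p) hG φ hh hf 0
  have h1 : ∀ g ∈ Subgroup.center G, pullEval φ.toAlgHom (conjIndicator F h) g = 0 := by
    intro g hg
    obtain ⟨c, rfl⟩ := hZ g hg
    change evalAt _ (φ (MonoidAlgebra.single (c ^ p) 1)) = 0
    have e1 : MonoidAlgebra.single (c ^ p) (1 : F) = MonoidAlgebra.single c 1 ^ p := by simp
    rw [e1, map_pow, evalAt_pow_char hf]
    refine Finset.sum_eq_zero fun d _ => ?_
    rw [conjIndicator, if_neg, mul_zero]
    intro k
    obtain ⟨a, ha⟩ := isConj_iff.mp k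
    refine hne d ?_
    rw [← ha, Subgroup.mem_center_iff.mp hh a, mul_inv_cancel_right]
  rw [pow_zero, pow_one, conjIndicator_self, Finset.sum_eq_zero] at e
  · exact one_ne_zero e
  · intro g hg
    rw [pow_one, pow_one, h1 g (Finset.mem_filter.mp hg).2, mul_zero]

theorem card_center_le_of_algEquiv [Finite G] [Finite H] (hG : IsPGroup p G)
    (φ : MonoidAlgebra F G ≃ₐ[F] MonoidAlgebra F H) :
    Nat.card (Subgroup.center H) ≤ Nat.card (Subgroup.center G) := by
  classical
  have := Fintype.ofFinite G
  have := Fintype.ofFinite (Subgroup.center G)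
  have := Fintype.ofFinite (Subgroup.center H)
  let M : Matrix (Subgroup.center G) (Subgroup.center H) F :=
    fun g h => (φ.symm (MonoidAlgebra.single (h : H) 1)).coeff g
  let N : Matrix (Subgroup.center H) (Subgroup.center G) F :=
    fun h g => pullEval φ.toAlgHom (conjIndicator F (h : H)) g
  have hNM : N * M = 1 := by
    ext h' h
    have e := evalAt_symm_center (p := p) hG φ h.2
      (conjIndicator_mul_comm (F := F) (h' : H)) 0
    simp only [pow_zero, pow_one] at e
    have e2 : (N * M) h' h = conjIndicator F (h' : H) (h : H) := by
      rw [e, Finset.sum_subtype (p := fun g => g ∈ Subgroup.center G) _ (by simp)]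
      exact Finset.sum_congr rfl fun g _ => mul_comm _ _
    rw [e2, Matrix.one_apply]
    split_ifs with hh
    · rw [hh, conjIndicator_self]
    · exact conjIndicator_of_mem_center h.2 fun k => hh (Subtype.ext k.symm)
  have hinj : Function.Injective M.mulVecLin := by
    intro v w hvw
    have := congrArg (N.mulVec) hvw
    simpa [Matrix.mulVec_mulVec, hNM] using this
  have := LinearMap.finrank_le_finrank_of_injective hinj
  simpa [Nat.card_eq_fintype_card] using this

/-- The algebra homomorphism between group algebras of abelianizations induced by an algebra
homomorphism between group algebras. -/
noncomputable def abelianizationAlgHom (φ : MonoidAlgebra F G →ₐ[F] MonoidAlgebra F H) :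
    MonoidAlgebra F (Abelianization G) →ₐ[F] MonoidAlgebra F (Abelianization H) :=
  MonoidAlgebra.lift F _ _ ((Units.coeHom (MonoidAlgebra F (Abelianization H))).comp
      (Abelianization.lift (MonoidHom.toHomUnits
    ((((MonoidAlgebra.mapDomainAlgHom F F (Abelianization.of (G := H))).comp φ) :
      MonoidAlgebra F G →* MonoidAlgebra F (Abelianization H)).comp (MonoidAlgebra.of F G)))))

theorem abelianizationAlgHom_single (φ : MonoidAlgebra F G →ₐ[F] MonoidAlgebra F H) (g : G) :
    abelianizationAlgHom φ (MonoidAlgebra.single (Abelianization.of g) 1) =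
      MonoidAlgebra.mapDomainAlgHom F F (Abelianization.of (G := H))
        (φ (MonoidAlgebra.single g 1)) := by
  simp [abelianizationAlgHom]

theorem abelianizationAlgHom_mapDomain (φ : MonoidAlgebra F G →ₐ[F] MonoidAlgebra F H)
    (x : MonoidAlgebra F G) :
    abelianizationAlgHom φ (MonoidAlgebra.mapDomainAlgHom F F (Abelianization.of (G := G)) x) =
      MonoidAlgebra.mapDomainAlgHom F F (Abelianization.of (G := H)) (φ x) := by
  induction x using MonoidAlgebra.induction_linear with
  | zero => simp
  | add x y hx hy => simp only [map_add, hx, hy]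
  | single g r =>
    have e : MonoidAlgebra.single g r = r • MonoidAlgebra.single g (1 : F) := by
      simp
    rw [e, map_smul, map_smul, map_smul, map_smul, ← abelianizationAlgHom_single]
    simp

theorem abelianizationAlgHom_comp_eq_id (φ : MonoidAlgebra F G →ₐ[F] MonoidAlgebra F H)
    (ψ : MonoidAlgebra F H →ₐ[F] MonoidAlgebra F G) (h : ∀ x, ψ (φ x) = x) :
    (abelianizationAlgHom ψ).comp (abelianizationAlgHom φ) = AlgHom.id F _ := by
  refine MonoidAlgebra.algHom_ext (fun c => ?_) (Subsingleton.elim _ _)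
  obtain ⟨g, rfl⟩ := QuotientGroup.mk_surjective c
  change abelianizationAlgHom ψ (abelianizationAlgHom φ
    (MonoidAlgebra.single (Abelianization.of g) 1)) = MonoidAlgebra.single (Abelianization.of g) 1
  rw [abelianizationAlgHom_single, abelianizationAlgHom_mapDomain, h]
  simp

/-- Isomorphic group algebras induce isomorphic group algebras of abelianizations. -/
noncomputable def abelianizationAlgEquiv (φ : MonoidAlgebra F G ≃ₐ[F] MonoidAlgebra F H) :
    MonoidAlgebra F (Abelianization G) ≃ₐ[F] MonoidAlgebra F (Abelianization H) :=
  AlgEquiv.ofAlgHom (abelianizationAlgHom φ.toAlgHom) (abelianizationAlgHom φ.symm.toAlgHom)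
    (abelianizationAlgHom_comp_eq_id _ _ φ.apply_symm_apply)
    (abelianizationAlgHom_comp_eq_id _ _ φ.symm_apply_apply)

end Transport

section Additive

variable {p : ℕ} [Fact p.Prime] {F : Type*} [Field F]
  {G : Type*} [Group G] {H : Type*} [Group H]

theorem card_abelianization_eq_of_algEquiv [Finite G] [Finite H]
    (φ : MonoidAlgebra F G ≃ₐ[F] MonoidAlgebra F H) :
    Nat.card (Abelianization G) = Nat.card (Abelianization H) :=
  Nat.card_eq_of_monoidAlgebra_linearEquiv (abelianizationAlgEquiv φ).toLinearEquiv

theorem pow_mem_commutator_of_algEquiv [CharP F p] [Finite G]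
    (φ : MonoidAlgebra F G ≃ₐ[F] MonoidAlgebra F H) {n : ℕ}
    (hG : ∀ g : G, g ^ p ^ n ∈ commutator G) (h : H) : h ^ p ^ n ∈ commutator H := by
  have e : ∀ {K : Type _} [Group K] (k : K), k ∈ commutator K ↔ Abelianization.of k = 1 := by
    intro K _ k
    rw [← Abelianization.ker_of, MonoidHom.mem_ker]
  rw [e, map_pow]
  refine pow_eq_one_of_algEquiv (p := p) (abelianizationAlgEquiv φ) (fun c => ?_) _
  obtain ⟨g, rfl⟩ : ∃ g, Abelianization.of g = c := QuotientGroup.mk_surjective c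
  rw [← map_pow]
  exact (QuotientGroup.eq_one_iff _).mpr (hG g)

/-- The augmentation of a group algebra. -/
noncomputable def augment (F G : Type*) [Field F] [Group G] : MonoidAlgebra F G →ₐ[F] F :=
  MonoidAlgebra.lift F F G 1

@[simp]
theorem augment_single (g : G) (r : F) : augment F G (MonoidAlgebra.single g r) = r := by
  simp [augment]

theorem algHom_eq_augment [CharP F p] [Finite G] (hG : IsPGroup p G)
    (ψ : MonoidAlgebra F G →ₐ[F] F) : ψ = augment F G := by
  refine MonoidAlgebra.algHom_ext (fun g => ?_) (Subsingleton.elim _ _)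
  obtain ⟨n, hn⟩ := hG g
  have e : (ψ (MonoidAlgebra.single g 1) - 1) ^ p ^ n = 0 := by
    rw [sub_pow_char_pow, ← map_pow, MonoidAlgebra.single_pow, hn, one_pow,
      ← MonoidAlgebra.one_def, map_one, sub_self]
  rw [augment_single]
  exact sub_eq_zero.mp (eq_zero_of_pow_eq_zero e)

theorem augment_algEquiv [CharP F p] [Finite G] (hG : IsPGroup p G)
    (φ : MonoidAlgebra F G ≃ₐ[F] MonoidAlgebra F H) (x : MonoidAlgebra F G) :
    augment F H (φ x) = augment F G x :=
  AlgHom.congr_fun (algHom_eq_augment hG ((augment F H).comp φ.toAlgHom)) x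

theorem evalAt_mul_of_cup {x y z : G → F} (h : ∀ g h, z (g * h) = z g + z h + x g * y h)
    (u v : MonoidAlgebra F G) :
    evalAt z (u * v) = augment F G u * evalAt z v + evalAt x u * evalAt y v +
      evalAt z u * augment F G v := by
  induction u using MonoidAlgebra.induction_linear with
  | zero => simp
  | add u u' hu hu' => simp only [add_mul, map_add, hu, hu']; ring
  | single g r =>
    induction v using MonoidAlgebra.induction_linear with
    | zero => simp
    | add v v' hv hv' => simp only [mul_add, map_add, hv, hv']; ring
    | single h' s =>
      simp only [MonoidAlgebra.single_mul_single, evalAt_single, augment_single, h]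
      ring

/-- Additive functions on a group with values in a field. -/
def additiveMaps (F G : Type*) [Field F] [Group G] : Submodule F (G → F) where
  carrier := {y | ∀ g h, y (g * h) = y g + y h}
  add_mem' := fun {x y} hx hy g h => by simp only [Pi.add_apply, hx g h, hy g h]; ring
  zero_mem' := fun g h => by simp
  smul_mem' := fun c x hx g h => by simp only [Pi.smul_apply, hx g h, smul_add]

theorem evalAt_mul_of_mem_additiveMaps {y : G → F} (hy : y ∈ additiveMaps F G)
    (u v : MonoidAlgebra F G) :
    evalAt y (u * v) = augment F G u * evalAt y v + evalAt y u * augment F G v := by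
  have e := evalAt_mul_of_cup (x := 0) (y := 0) (z := y) (fun g h => by simp [hy g h]) u v
  rw [e, evalAt_zero]
  simp

theorem pullEval_cup [CharP F p] [Finite G] (hG : IsPGroup p G)
    (φ : MonoidAlgebra F G ≃ₐ[F] MonoidAlgebra F H) {x y z : H → F}
    (h : ∀ g h, z (g * h) = z g + z h + x g * y h) (g k : G) :
    pullEval φ.toAlgHom z (g * k) = pullEval φ.toAlgHom z g + pullEval φ.toAlgHom z k +
      pullEval φ.toAlgHom x g * pullEval φ.toAlgHom y k := by
  have e : MonoidAlgebra.single (g * k) (1 : F) =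
    MonoidAlgebra.single g 1 * MonoidAlgebra.single k 1 := by simp
  change evalAt z (φ _) = evalAt z (φ _) + evalAt z (φ _) + evalAt x (φ _) * evalAt y (φ _)
  rw [e, map_mul, evalAt_mul_of_cup h, augment_algEquiv hG, augment_algEquiv hG, augment_single,
    augment_single]
  ring

theorem pullEval_mem_additiveMaps [CharP F p] [Finite G] (hG : IsPGroup p G)
    (φ : MonoidAlgebra F G ≃ₐ[F] MonoidAlgebra F H) {y : H → F} (hy : y ∈ additiveMaps F H) :
    pullEval φ.toAlgHom y ∈ additiveMaps F G := by
  intro g k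
  have e : MonoidAlgebra.single (g * k) (1 : F) =
    MonoidAlgebra.single g 1 * MonoidAlgebra.single k 1 := by simp
  change evalAt y (φ _) = evalAt y (φ _) + evalAt y (φ _)
  rw [e, map_mul, evalAt_mul_of_mem_additiveMaps hy, augment_algEquiv hG, augment_algEquiv hG,
    augment_single, augment_single]
  ring

theorem pullEval_symm_pullEval (φ : MonoidAlgebra F G ≃ₐ[F] MonoidAlgebra F H) (f : H → F) :
    pullEval φ.symm.toAlgHom (pullEval φ.toAlgHom f) = f := by
  funext h
  change evalAt (pullEval φ.toAlgHom f) (φ.symm _) = f h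
  rw [evalAt_pullEval]
  change evalAt f (φ (φ.symm _)) = f h
  simp

/-- The linear equivalence between spaces of additive functions induced by an isomorphism of group
algebras. -/
noncomputable def additiveMapsEquiv [CharP F p] [Finite G] [Finite H] (hG : IsPGroup p G)
    (hH : IsPGroup p H) (φ : MonoidAlgebra F G ≃ₐ[F] MonoidAlgebra F H) :
    additiveMaps F H ≃ₗ[F] additiveMaps F G where
  toFun y := ⟨pullEval φ.toAlgHom y.1, pullEval_mem_additiveMaps hG φ y.2⟩
  invFun y := ⟨pullEval φ.symm.toAlgHom y.1, pullEval_mem_additiveMaps hH φ.symm y.2⟩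
  map_add' x y := by
    ext g
    simp [pullEval, evalAt_add]
  map_smul' c y := by
    ext g
    simp [pullEval, evalAt_smul]
  left_inv y := Subtype.ext (pullEval_symm_pullEval φ y.1)
  right_inv y := Subtype.ext (pullEval_symm_pullEval φ.symm y.1)

end Additive

open scoped commutatorElement

section PhiCommutator

variable {p : ℕ} {H : Type*} [Group H]

theorem exists_mem_center_of_normal [Fact p.Prime] [Finite H] (hH : IsPGroup p H) (N : Subgroup H)
    [N.Normal]
    (hN : N ≠ ⊥) : ∃ z ∈ N, z ∈ Subgroup.center H ∧ orderOf z = p := by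
  have hP : IsPGroup p (ConjAct H) := hH
  have : Finite (ConjAct H) := ‹Finite H›
  have hdvd : p ∣ Nat.card N := by
    rcases (hH.to_subgroup N).card_eq_or_dvd with h | h
    · exact absurd (Subgroup.card_eq_one.mp h) hN
    · exact h
  obtain ⟨w, hw, hw1⟩ := hP.exists_fixed_point_of_prime_dvd_card_of_fixed_point N hdvd
    (a := 1) (fun c => smul_one c)
  have hwc : (w : H) ∈ Subgroup.center H := by
    rw [Subgroup.mem_center_iff]
    intro g
    have := congrArg Subtype.val (hw (ConjAct.toConjAct g))
    rw [ConjAct.Subgroup.val_conj_smul, ConjAct.toConjAct_smul] at this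
    exact mul_inv_eq_iff_eq_mul.mp this
  obtain ⟨k, hk⟩ := (IsPGroup.iff_orderOf.mp hH) (w : H)
  have hk0 : k ≠ 0 := by
    rintro rfl
    rw [pow_zero, orderOf_eq_one_iff] at hk
    exact hw1 (Subtype.ext hk).symm
  refine ⟨(w : H) ^ p ^ (k - 1), N.pow_mem w.2 _, Subgroup.pow_mem _ hwc _, ?_⟩
  rw [orderOf_pow' _ (pow_ne_zero _ (Fact.out : p.Prime).ne_zero), hk,
    Nat.gcd_eq_right (pow_dvd_pow p (Nat.sub_le k 1)), Nat.pow_div (Nat.sub_le k 1)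
    (Fact.out : p.Prime).pos, show k - (k - 1) = 1 by omega, pow_one]

/-- The normal subgroup generated by `[H', H]` and the `p`-th powers of elements of `H'`. -/
def commutatorPhi (p : ℕ) (H : Type*) [Group H] : Subgroup H :=
  ⁅commutator H, ⊤⁆ ⊔ Subgroup.normalClosure {y | ∃ x ∈ commutator H, x ^ p = y}

instance : (commutatorPhi p H).Normal := by
  unfold commutatorPhi
  infer_instance

theorem commutatorPhi_le : commutatorPhi p H ≤ commutator H := by
  refine sup_le (Subgroup.commutator_le_left _ _) (Subgroup.normalClosure_le_normal ?_)
  rintro _ ⟨x, hx, rfl⟩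
  exact Subgroup.pow_mem _ hx p

theorem map_commutatorPhi_le {K : Type*} [Group K] (f : H →* K) (hf : Function.Surjective f) :
    (commutatorPhi p H).map f ≤ commutatorPhi p K := by
  have hc : (commutator H).map f = commutator K := by
    rw [map_commutator_eq, MonoidHom.range_eq_top.mpr hf]
    rfl
  rw [commutatorPhi, Subgroup.map_sup, Subgroup.map_commutator, hc,
    Subgroup.map_top_of_surjective f hf]
  refine sup_le_sup_left ?_ _
  rw [Subgroup.map_le_iff_le_comap]
  refine Subgroup.normalClosure_le_normal ?_
  rintro _ ⟨x, hx, rfl⟩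
  refine Subgroup.subset_normalClosure ⟨f x, ?_, (map_pow f x p).symm⟩
  rw [← hc]
  exact Subgroup.mem_map_of_mem f hx

theorem mem_of_pow_mem_of_coprime [Fact p.Prime] [Finite H] (hH : IsPGroup p H) (K : Subgroup H)
    {g : H} {i : ℤ}
    (hi : ¬ (p : ℤ) ∣ i) (hg : g ^ i ∈ K) : g ∈ K := by
  obtain ⟨k, hk⟩ := hH g
  have hcop : IsCoprime i ((p ^ k : ℕ) : ℤ) := by
    push_cast
    exact (((Nat.prime_iff_prime_int.mp Fact.out).coprime_iff_not_dvd).mpr hi).symm.pow_right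
  obtain ⟨u, v, huv⟩ := hcop
  have : g = (g ^ i) ^ u := by
    rw [← zpow_mul, mul_comm, ← zpow_one g]
    conv_lhs => rw [← huv, zpow_add, zpow_mul _ v, zpow_comm, zpow_natCast, hk]
    simp
  rw [this]
  exact Subgroup.zpow_mem _ hg u

theorem commutator_le_zpowers_of_le_sup_commutatorPhi [Fact p.Prime] {H : Type*} [Group H]
    [Finite H] (hH : IsPGroup p H) (g : H)
    (hg : g ∉ commutator H) (h : commutator H ≤ Subgroup.zpowers g ⊔ commutatorPhi p H) :
    commutator H ≤ Subgroup.zpowers g := by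
  by_cases hN : commutatorPhi p H = ⊥
  · rwa [hN, sup_bot_eq] at h
  obtain ⟨z, hzN, hzc, hz⟩ := exists_mem_center_of_normal hH _ hN
  have hzH : z ∈ commutator H := commutatorPhi_le hzN
  have hnor : (Subgroup.zpowers z).Normal := by
    refine ⟨fun n hn g => ?_⟩
    have hnc : n ∈ Subgroup.center H := (Subgroup.zpowers_le.mpr hzc) hn
    rwa [Subgroup.mem_center_iff.mp hnc g, mul_inv_cancel_right]
  let q := QuotientGroup.mk' (Subgroup.zpowers z)
  have hq : Function.Surjective q := QuotientGroup.mk'_surjective _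
  have hker : q.ker = Subgroup.zpowers z := QuotientGroup.ker_mk' _
  have hc : (commutator H).map q = commutator (H ⧸ Subgroup.zpowers z) := by
    rw [map_commutator_eq, MonoidHom.range_eq_top.mpr hq]
    rfl
  have hcard : Nat.card (H ⧸ Subgroup.zpowers z) < Nat.card H := by
    rw [Subgroup.card_eq_card_quotient_mul_card_subgroup (Subgroup.zpowers z), Nat.card_zpowers, hz]
    exact lt_mul_of_one_lt_right Nat.card_pos (Fact.out : p.Prime).one_lt
  have hzle : Subgroup.zpowers z ≤ commutator H := Subgroup.zpowers_le.mpr hzH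
  have ih := commutator_le_zpowers_of_le_sup_commutatorPhi
    (hH.to_quotient (Subgroup.zpowers z)) (q g)
    (by
      rw [← hc]
      rintro ⟨x, hx, hxg⟩
      have : x⁻¹ * g ∈ q.ker := by rw [MonoidHom.mem_ker, map_mul, map_inv, hxg, inv_mul_cancel]
      rw [hker] at this
      exact hg (by simpa using mul_mem hx (hzle this)))
    (by
      rw [← hc, Subgroup.map_le_iff_le_comap]
      refine h.trans ?_
      rw [← Subgroup.map_le_iff_le_comap, Subgroup.map_sup, MonoidHom.map_zpowers]
      exact sup_le_sup_left (map_commutatorPhi_le q hq) _)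
  have hsplit : ∀ x ∈ commutator H, ∃ i j : ℤ, x = g ^ i * z ^ j := by
    intro x hx
    have hx' : q x ∈ Subgroup.zpowers (q g) := ih (hc ▸ Subgroup.mem_map_of_mem q hx)
    obtain ⟨i, hi⟩ := Subgroup.mem_zpowers_iff.mp hx'
    have : (g ^ i)⁻¹ * x ∈ q.ker := by
      rw [MonoidHom.mem_ker, map_mul, map_inv, map_zpow, hi, inv_mul_cancel]
    rw [hker] at this
    obtain ⟨j, hj⟩ := Subgroup.mem_zpowers_iff.mp this
    exact ⟨i, j, by rw [hj, mul_inv_cancel_left]⟩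
  have hzcomm : ∀ (y : H) (j : ℤ), z ^ j * y = y * z ^ j := fun y j =>
    (Subgroup.mem_center_iff.mp (Subgroup.zpow_mem _ hzc j) y).symm
  have hzp : ∀ j : ℤ, (z ^ j) ^ (p : ℤ) = 1 := by
    intro j
    rw [← zpow_mul, mul_comm, zpow_mul, zpow_natCast, ← hz, pow_orderOf_eq_one, one_zpow]
  have hpow : ∀ x ∈ commutator H, x ^ p ∈ Subgroup.zpowers g := by
    intro x hx
    obtain ⟨i, j, rfl⟩ := hsplit x hx
    rw [Commute.mul_pow (hzcomm (g ^ i) j).symm, ← zpow_natCast (z ^ j), hzp, mul_one]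
    exact Subgroup.pow_mem _ (Subgroup.zpow_mem_zpowers g i) p
  have hcomm : ∀ x ∈ commutator H, ∀ y : H, ⁅x, y⁆ ∈ Subgroup.zpowers g := by
    intro x hx y
    obtain ⟨i, j, rfl⟩ := hsplit x hx
    have hi : (p : ℤ) ∣ i := by
      by_contra hi
      refine hg (mem_of_pow_mem_of_coprime hH _ hi ?_)
      have := mul_mem hx (inv_mem (Subgroup.zpow_mem _ hzH j))
      rwa [mul_inv_cancel_right] at this
    obtain ⟨i', rfl⟩ := hi
    obtain ⟨e, f, hef⟩ := hsplit ⁅y, g⁆ (Subgroup.commutator_mem_commutator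
      (Subgroup.mem_top _) (Subgroup.mem_top _))
    have hconj : y * g * y⁻¹ = g ^ (e + 1) * z ^ f := by
      rw [commutatorElement_def] at hef
      rw [zpow_add, zpow_one, ← hzcomm (g ^ e * g) f, ← mul_assoc, hzcomm, ← hef,
        inv_mul_cancel_right]
    have h1 : y * g ^ ((p : ℤ) * i') * y⁻¹ = g ^ ((e + 1) * (p * i')) := by
      rw [← conj_zpow, hconj, Commute.mul_zpow (hzcomm _ f).symm, ← zpow_mul, zpow_mul (z ^ f), hzp,
        one_zpow, mul_one]
    have h2 : ⁅g ^ ((p : ℤ) * i') * z ^ j, y⁆ =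
        g ^ ((p : ℤ) * i') * (y * g ^ ((p : ℤ) * i') * y⁻¹)⁻¹ := by
      rw [commutatorElement_def, mul_assoc _ (z ^ j) y, hzcomm]
      group
    rw [h2, h1]
    exact mul_mem (Subgroup.zpow_mem_zpowers _ _) (inv_mem (Subgroup.zpow_mem_zpowers _ _))
  refine h.trans (sup_le le_rfl (sup_le ?_ ?_))
  · exact Subgroup.commutator_le.mpr fun x hx y _ => hcomm x hx y
  · rw [Subgroup.normalClosure, Subgroup.closure_le]
    intro w hw
    rw [Group.mem_conjugatesOfSet_iff] at hw
    obtain ⟨_, ⟨x, hx, rfl⟩, hw⟩ := hw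
    obtain ⟨c, rfl⟩ := isConj_iff.mp hw
    rw [← conj_pow]
    exact hpow _ (Subgroup.Normal.conj_mem inferInstance x hx c)
termination_by Nat.card H

end PhiCommutator

section TwoGenerators

theorem finite_and_card_le_of_forall_exists {Γ T : Type*} [Group Γ] [Finite T] (D : Subgroup Γ)
    (f : T → Γ) (h : ∀ x ∈ D, ∃ t, f t = x) : Finite D ∧ Nat.card D ≤ Nat.card T := by
  choose g hg using h
  have hinj : Function.Injective fun x : D => g x.1 x.2 := by
    intro x y hxy
    have := congrArg f hxy
    simp only [hg] at this
    exact Subtype.ext this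
  exact ⟨Finite.of_injective _ hinj, Nat.card_le_card_of_injective _ hinj⟩

theorem card_closure_pair_le_of_commutator_central {Γ : Type*} [Group Γ] {α β γ : Γ}
    (h : β * α = α * β * γ) (hα : Commute γ α) (hβ : Commute γ β) {P Q R : ℕ}
    (hP : 0 < P) (hQ : 0 < Q) (hR : 0 < R) (hαP : α ^ P = 1) (hβQ : β ^ Q = 1) (hγR : γ ^ R = 1) :
    Finite (Subgroup.closure {α, β}) ∧ Nat.card (Subgroup.closure {α, β}) ≤ P * Q * R := by
  have hconj : β * α * β⁻¹ = α * γ := by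
    rw [h, mul_assoc α, ← hβ.eq, ← mul_assoc, mul_inv_cancel_right]
  have hconj' : β⁻¹ * α * β = α * γ⁻¹ := by
    rw [mul_assoc, inv_mul_eq_iff_eq_mul, ← mul_assoc, h, mul_inv_cancel_right]
  have h1 : ∀ i : ℤ, β * α ^ i = α ^ i * β * γ ^ i := by
    intro i
    have e : β * α ^ i * β⁻¹ = α ^ i * γ ^ i := by
      rw [← conj_zpow, hconj, hα.symm.mul_zpow]
    rw [mul_assoc, ← (hβ.zpow_left i).eq, ← mul_assoc, ← e, inv_mul_cancel_right]
  have h2 : ∀ i : ℤ, β⁻¹ * α ^ i = α ^ i * β⁻¹ * γ ^ (-i) := by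
    intro i
    have e : β⁻¹ * α ^ i * β = α ^ i * γ ^ (-i) := by
      have := conj_zpow (i := i) (a := β⁻¹) (b := α)
      rw [inv_inv] at this
      rw [← this, hconj', hα.symm.inv_right.mul_zpow, inv_zpow']
    rw [mul_assoc, ← (hβ.inv_right.zpow_left (-i)).eq, ← mul_assoc, ← e, mul_inv_cancel_right]
  have key : ∀ x ∈ Subgroup.closure {α, β}, ∃ i j k : ℤ, α ^ i * β ^ j * γ ^ k = x := by
    intro x hx
    induction hx using Subgroup.closure_induction_left with
    | one => exact ⟨0, 0, 0, by simp⟩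
    | mul_left g hg y hy ih =>
      obtain ⟨i, j, k, rfl⟩ := ih
      rcases hg with rfl | hg
      · exact ⟨i + 1, j, k, by rw [add_comm i 1, zpow_add, zpow_one]; simp only [mul_assoc]⟩
      · rw [Set.mem_singleton_iff] at hg
        subst hg
        refine ⟨i, j + 1, i + k, ?_⟩
        rw [← mul_assoc, ← mul_assoc, h1, mul_assoc (α ^ i * g),
          ((hβ.zpow_left i).zpow_right j).eq, add_comm j 1, zpow_add, zpow_add, zpow_one]
        simp only [mul_assoc]
    | inv_mul_cancel g hg y hy ih =>
      obtain ⟨i, j, k, rfl⟩ := ih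
      rcases hg with rfl | hg
      · exact ⟨-1 + i, j, k, by rw [zpow_add, zpow_neg_one]; simp only [mul_assoc]⟩
      · rw [Set.mem_singleton_iff] at hg
        subst hg
        refine ⟨i, -1 + j, -i + k, ?_⟩
        rw [← mul_assoc, ← mul_assoc, h2, mul_assoc (α ^ i * g⁻¹),
          ((hβ.zpow_left (-i)).zpow_right j).eq, zpow_add, zpow_add, zpow_neg_one]
        simp only [mul_assoc]
  have hmod : ∀ (g : Γ) {n : ℕ} (hn : 0 < n) (_ : g ^ n = 1) (i : ℤ),
      ∃ j : Fin n, g ^ (j : ℕ) = g ^ i := by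
    intro g n hn hg i
    have h0 : 0 ≤ i % n := Int.emod_nonneg _ (by exact_mod_cast hn.ne')
    have h1 : i % n < n := Int.emod_lt_of_pos _ (by exact_mod_cast hn)
    refine ⟨⟨(i % n).toNat, by omega⟩, ?_⟩
    rw [← zpow_natCast, Int.toNat_of_nonneg h0]
    conv_rhs => rw [← Int.emod_add_mul_ediv i n, zpow_add, zpow_mul, zpow_natCast, hg, one_zpow,
      mul_one]
  have := finite_and_card_le_of_forall_exists (Subgroup.closure {α, β})
    (fun t : Fin P × Fin Q × Fin R => α ^ (t.1 : ℕ) * β ^ (t.2.1 : ℕ) * γ ^ (t.2.2 : ℕ)) (by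
      intro x hx
      obtain ⟨i, j, k, rfl⟩ := key x hx
      obtain ⟨i', hi⟩ := hmod α hP hαP i
      obtain ⟨j', hj⟩ := hmod β hQ hβQ j
      obtain ⟨k', hk⟩ := hmod γ hR hγR k
      exact ⟨(i', j', k'), by simp only [hi, hj, hk]⟩)
  simpa [mul_assoc] using this

theorem card_closure_pair_le_of_metacyclic {Γ : Type*} [Group Γ] {α β : Γ} {k S N M : ℕ}
    (h : β * α = α ^ k * β) (hN : 0 < N) (hM : 0 < M) (hα : α ^ N = 1) (hβ : β ^ M = α ^ S) :
    Finite (Subgroup.closure {α, β}) ∧ Nat.card (Subgroup.closure {α, β}) ≤ N * M := by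
  have h1 : ∀ i : ℤ, β * α ^ i = α ^ (k * i) * β := by
    intro i
    have e : β * α * β⁻¹ = α ^ k := by rw [h, mul_inv_cancel_right]
    have e2 : β * α ^ i * β⁻¹ = α ^ (k * i) := by
      rw [← conj_zpow, e, zpow_mul, zpow_natCast]
    rw [← e2, inv_mul_cancel_right]
  have h2 : ∀ (n : ℕ) (i : ℤ), β ^ n * α ^ i = α ^ (k ^ n * i) * β ^ n := by
    intro n
    induction n with
    | zero => simp
    | succ n ih =>
      intro i
      rw [pow_succ, mul_assoc, h1, ← mul_assoc, ih, mul_assoc, pow_succ, mul_assoc]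
  have hβ1 : β⁻¹ = β ^ (M * N - 1) := by
    rw [inv_eq_iff_mul_eq_one, ← pow_succ', Nat.sub_add_cancel (Nat.mul_pos hM hN), pow_mul, hβ,
      ← pow_mul, mul_comm, pow_mul, hα, one_pow]
  have key : ∀ x ∈ Subgroup.closure {α, β}, ∃ i j : ℤ, α ^ i * β ^ j = x := by
    intro x hx
    induction hx using Subgroup.closure_induction_left with
    | one => exact ⟨0, 0, by simp⟩
    | mul_left g hg y hy ih =>
      obtain ⟨i, j, rfl⟩ := ih
      rcases hg with rfl | hg
      · exact ⟨1 + i, j, by rw [zpow_add, zpow_one]; simp only [mul_assoc]⟩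
      · rw [Set.mem_singleton_iff] at hg
        subst hg
        refine ⟨k * i, 1 + j, ?_⟩
        rw [← mul_assoc, h1, zpow_add, zpow_one, mul_assoc]
    | inv_mul_cancel g hg y hy ih =>
      obtain ⟨i, j, rfl⟩ := ih
      rcases hg with rfl | hg
      · exact ⟨-1 + i, j, by rw [zpow_add, zpow_neg_one]; simp only [mul_assoc]⟩
      · rw [Set.mem_singleton_iff] at hg
        subst hg
        refine ⟨k ^ (M * N - 1) * i, (M * N - 1 : ℕ) + j, ?_⟩
        rw [hβ1, ← mul_assoc, h2, zpow_add, zpow_natCast, mul_assoc]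
  have := finite_and_card_le_of_forall_exists (Subgroup.closure {α, β})
    (fun t : Fin N × Fin M => α ^ (t.1 : ℕ) * β ^ (t.2 : ℕ)) (by
      intro x hx
      obtain ⟨i, j, rfl⟩ := key x hx
      have j0 : 0 ≤ j % M := Int.emod_nonneg _ (by exact_mod_cast hM.ne')
      have j1 : j % M < M := Int.emod_lt_of_pos _ (by exact_mod_cast hM)
      set l : ℤ := i + S * (j / M)
      have i0 : 0 ≤ l % N := Int.emod_nonneg _ (by exact_mod_cast hN.ne')
      have i1 : l % N < N := Int.emod_lt_of_pos _ (by exact_mod_cast hN)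
      refine ⟨(⟨(l % N).toNat, by omega⟩, ⟨(j % M).toNat, by omega⟩), ?_⟩
      simp only
      rw [← zpow_natCast, ← zpow_natCast, Int.toNat_of_nonneg i0, Int.toNat_of_nonneg j0]
      have e1 : α ^ (l % N) = α ^ l := by
        conv_rhs => rw [← Int.emod_add_mul_ediv l N, zpow_add, zpow_mul, zpow_natCast, hα,
          one_zpow, mul_one]
      have e2 : β ^ j = α ^ (S * (j / M)) * β ^ (j % M) := by
        conv_lhs => rw [← Int.emod_add_mul_ediv j M, add_comm, zpow_add, zpow_mul, zpow_natCast, hβ,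
          ← zpow_natCast, ← zpow_mul]
      rw [e1, e2, zpow_add, mul_assoc])
  simpa using this

theorem exists_monoidHom_of_card_closure_le {A B : Type*} [Group A] [Group B] [Finite A] {a b : A}
    {a' b' : B} (hgen : Subgroup.closure {a, b} = ⊤)
    (hD : Finite (Subgroup.closure {(a, a'), (b, b')}) ∧
      Nat.card (Subgroup.closure {(a, a'), (b, b')}) ≤ Nat.card A) :
    ∃ f : A →* B, f a = a' ∧ f b = b' := by
  obtain ⟨hfin, hcard⟩ := hD
  set D := Subgroup.closure {(a, a'), (b, b')}
  let π : D →* A := (MonoidHom.fst A B).comp D.subtype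
  have ha : (a, a') ∈ D := Subgroup.subset_closure (by simp)
  have hb : (b, b') ∈ D := Subgroup.subset_closure (by simp)
  have hsurj : Function.Surjective π := by
    rw [← MonoidHom.range_eq_top, eq_top_iff, ← hgen, Subgroup.closure_le]
    rintro x (rfl | hx)
    · exact ⟨⟨_, ha⟩, rfl⟩
    · rw [Set.mem_singleton_iff] at hx
      subst hx
      exact ⟨⟨_, hb⟩, rfl⟩
  let e := MulEquiv.ofBijective π (hsurj.bijective_of_nat_card_le hcard)
  refine ⟨((MonoidHom.snd A B).comp D.subtype).comp e.symm.toMonoidHom, ?_, ?_⟩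
  · have : e.symm a = ⟨_, ha⟩ := e.symm_apply_eq.mpr rfl
    simp [this]
  · have : e.symm b = ⟨_, hb⟩ := e.symm_apply_eq.mpr rfl
    simp [this]

theorem nonempty_mulEquiv_of_monoidHom {A B : Type*} [Group A] [Group B] [Finite A] [Finite B]
    {a' b' : B} (hgen : Subgroup.closure {a', b'} = ⊤) (hcard : Nat.card A = Nat.card B)
    (f : A →* B) (ha : a' ∈ f.range) (hb : b' ∈ f.range) : Nonempty (A ≃* B) := by
  have hsurj : Function.Surjective f := by
    rw [← MonoidHom.range_eq_top, eq_top_iff, ← hgen, Subgroup.closure_le]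
    rintro x (rfl | hx)
    · exact ha
    · rw [Set.mem_singleton_iff] at hx
      exact hx ▸ hb
  exact ⟨MulEquiv.ofBijective f (hsurj.bijective_of_nat_card_le hcard.le)⟩

end TwoGenerators

theorem exists_pair_closure_eq_top_of_finrank_le {p : ℕ} [Fact p.Prime] (F : Type*) [Field F]
    [CharP F p] {A : Type*} [CommGroup A] [Finite A] (hA : IsPGroup p A)
    (h : Module.finrank F (additiveMaps F A) ≤ 2) :
    ∃ (a b : A) (s t : ℕ), Subgroup.closure {a, b} = ⊤ ∧ a ^ p ^ s = 1 ∧ b ^ p ^ t = 1 ∧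
      Nat.card A = p ^ (s + t) := by
  classical
  obtain ⟨ι, _, n, hn, ⟨e⟩⟩ := CommGroup.equiv_prod_multiplicative_zmod_of_finite A
  have hcard : Nat.card A = ∏ i, n i := by
    rw [Nat.card_congr e.toEquiv, Nat.card_pi]
    exact Finset.prod_congr rfl fun i _ => Nat.card_zmod (n i)
  obtain ⟨N, hN⟩ := IsPGroup.iff_card.mp hA
  have hpow : ∀ i, ∃ m, n i = p ^ m := fun i => by
    have : n i ∣ p ^ N := by
      rw [← hN, hcard]
      exact Finset.dvd_prod_of_mem n (Finset.mem_univ i)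
    obtain ⟨m, -, hm⟩ := (Nat.dvd_prime_pow Fact.out).mp this
    exact ⟨m, hm⟩
  choose m hm using hpow
  have hdvd : ∀ i, p ∣ n i := fun i => by
    rw [hm]
    refine dvd_pow_self p fun h0 => ?_
    have := hn i
    rw [hm, h0] at this
    simp at this
  let c : ι → A := fun i => e.symm (Pi.mulSingle i (Multiplicative.ofAdd 1))
  have hc : ∀ i, c i ^ n i = 1 := fun i => by
    rw [← map_pow, ← Pi.mulSingle_pow, ← ofAdd_nsmul]
    simp
  have hgen : ∀ x : A, x = ∏ i, c i ^ (Multiplicative.toAdd (e x i)).val := fun x => by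
    apply e.injective
    rw [map_prod]
    conv_lhs => rw [← Finset.univ_prod_mulSingle (e x)]
    refine Finset.prod_congr rfl fun i _ => ?_
    have : NeZero (n i) := ⟨by have := hn i; omega⟩
    rw [map_pow, MulEquiv.apply_symm_apply, ← Pi.mulSingle_pow, ← ofAdd_nsmul, nsmul_one,
      ZMod.natCast_zmod_val, ofAdd_toAdd]
  have hclos : ∀ s : Set A, (∀ i, c i ∈ s) → Subgroup.closure s = ⊤ := fun s hs => by
    rw [eq_top_iff]
    intro x _
    rw [hgen x]
    exact Subgroup.prod_mem _ fun i _ => Subgroup.pow_mem _ (Subgroup.subset_closure (hs i)) _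
  let L : (ι → F) →ₗ[F] additiveMaps F A :=
    { toFun := fun f => ⟨fun g => ∑ i, f i * ZMod.castHom (hdvd i) F (Multiplicative.toAdd (e g i)),
        fun g h => by
          rw [← Finset.sum_add_distrib]
          refine Finset.sum_congr rfl fun i _ => ?_
          rw [map_mul, Pi.mul_apply, toAdd_mul, map_add, mul_add]⟩
      map_add' := fun f f' => by
        ext g
        simp [add_mul, Finset.sum_add_distrib]
      map_smul' := fun r f => by
        ext g
        simp [Finset.mul_sum, mul_assoc] }
  have hL : Function.Injective L := by
    intro f f' hff
    funext j
    have hval : ∀ f, (L f : A → F) (c j) = f j := fun f => by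
      change ∑ i, f i * ZMod.castHom (hdvd i) F (Multiplicative.toAdd (e (c j) i)) = f j
      rw [Finset.sum_eq_single j]
      · rw [show Multiplicative.toAdd (e (c j) j) = 1 by simp [c], map_one, mul_one]
      · intro i _ hij
        simp [c, Pi.mulSingle_eq_of_ne hij]
      · simp
    rw [← hval f, ← hval f', hff]
  have hle := (LinearMap.finrank_le_finrank_of_injective hL).trans h
  rw [Module.finrank_fintype_fun_eq_card] at hle
  have hcp : ∀ i, c i ^ p ^ m i = 1 := fun i => hm i ▸ hc i
  obtain ⟨k, hk⟩ : ∃ k, k = Fintype.card ι := ⟨_, rfl⟩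
  let σ := (Fintype.equivFinOfCardEq hk.symm).symm
  have hcard' : Nat.card A = ∏ j : Fin k, p ^ m (σ j) := by
    rw [hcard, ← Equiv.prod_comp σ]
    exact Finset.prod_congr rfl fun j _ => hm _
  have hclos' : ∀ s : Set A, (∀ j, c (σ j) ∈ s) → Subgroup.closure s = ⊤ := fun s hs =>
    hclos s fun i => by simpa using hs (σ.symm i)
  rw [← hk] at hle
  clear_value σ
  clear hk
  interval_cases k
  · exact ⟨1, 1, 0, 0, hclos' _ (fun j => j.elim0), by simp, by simp, by simpa using hcard'⟩
  · refine ⟨1, c (σ 0), 0, m (σ 0), hclos' _ (fun j => ?_), by simp, hcp _, by simpa using hcard'⟩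
    fin_cases j
    simp
  · refine ⟨c (σ 0), c (σ 1), m (σ 0), m (σ 1), hclos' _ (fun j => ?_), hcp _, hcp _, ?_⟩
    · fin_cases j <;> simp
    · rw [hcard', Fin.prod_univ_two, pow_add]

theorem eq_top_of_sup_commutator_eq_top {p : ℕ} [Fact p.Prime] {H : Type*} [Group H] [Finite H]
    (hH : IsPGroup p H) (K : Subgroup H) (hK : K ⊔ commutator H = ⊤) : K = ⊤ := by
  by_contra hne
  obtain ⟨M, hM, hKM⟩ := (eq_top_or_exists_le_coatom K).resolve_left hne
  have hnil := hH.isNilpotent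
  have hMn : M.Normal := 
    Subgroup.NormalizerCondition.normal_of_coatom M Group.normalizerCondition_of_isNilpotent hM
  have hnt : Nontrivial (H ⧸ M) := QuotientGroup.nontrivial_iff.mpr hM.1
  have hcn := (hH.to_quotient M).bot_lt_center
  have hlt : M < (Subgroup.center (H ⧸ M)).comap (QuotientGroup.mk' M) := by
    conv_lhs => rw [← QuotientGroup.ker_mk' M, ← MonoidHom.comap_bot]
    exact (Subgroup.comap_lt_comap_of_surjective (QuotientGroup.mk'_surjective M)).mpr hcn
  have htop := hM.2 _ hlt
  have hcomm : commutator H ≤ M := by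
    rw [commutator_def, Subgroup.commutator_le]
    intro x _ y _
    have hx : QuotientGroup.mk' M x ∈ Subgroup.center (H ⧸ M) := by
      rw [← Subgroup.mem_comap, htop]
      exact Subgroup.mem_top x
    have hxy := Subgroup.mem_center_iff.mp hx (QuotientGroup.mk' M y)
    rw [← QuotientGroup.ker_mk' M, MonoidHom.mem_ker, map_commutatorElement,
      commutatorElement_eq_one_iff_mul_comm, hxy]
  exact hM.1 (eq_top_iff.mpr (hK ▸ sup_le hKM hcomm))

theorem commute_of_closure_pair_eq_top {K : Type*} [Group K] {a b : K}
    (hgen : Subgroup.closure {a, b} = ⊤) (h : b * a = a * b) (x y : K) : x * y = y * x := by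
  have hc : ∀ u ∈ ({a, b} : Set K), ∀ v ∈ ({a, b} : Set K), u * v = v * u := by
    rintro u (rfl | rfl) v (rfl | rfl)
    · rfl
    · exact h.symm
    · exact h
    · rfl
  have hcl := Subgroup.isMulCommutative_closure hc
  have hx : x ∈ Subgroup.closure {a, b} := hgen ▸ Subgroup.mem_top x
  have hy : y ∈ Subgroup.closure {a, b} := hgen ▸ Subgroup.mem_top y
  exact congrArg Subtype.val (hcl.is_comm.comm ⟨x, hx⟩ ⟨y, hy⟩)

theorem commutator_le_of_commute_quotient {K : Type*} [Group K] (N : Subgroup K) [N.Normal]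
    (h : ∀ x y : K ⧸ N, x * y = y * x) : commutator K ≤ N := by
  rw [commutator_def, Subgroup.commutator_le]
  intro x _ y _
  rw [← QuotientGroup.ker_mk' N, MonoidHom.mem_ker, map_commutatorElement,
    commutatorElement_eq_one_iff_mul_comm, h]

theorem closure_pair_map_eq_top {K L : Type*} [Group K] [Group L] {a b : K}
    (hgen : Subgroup.closure {a, b} = ⊤) (f : K →* L) (hf : Function.Surjective f) :
    Subgroup.closure {f a, f b} = ⊤ := by
  rw [← Set.image_pair, ← MonoidHom.map_closure, hgen, Subgroup.map_top_of_surjective f hf]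

theorem commutator_le_zpowers_of_central {K : Type*} [Group K] {a b c : K}
    (hgen : Subgroup.closure {a, b} = ⊤) (h : b * a = a * b * c) (hc : c ∈ Subgroup.center K) :
    commutator K ≤ Subgroup.zpowers c := by
  have hn : (Subgroup.zpowers c).Normal := ⟨fun n hn g => by
    have : n ∈ Subgroup.center K := (Subgroup.zpowers_le.mpr hc) hn
    rwa [Subgroup.mem_center_iff.mp this g, mul_inv_cancel_right]⟩
  have hg := closure_pair_map_eq_top hgen _ (QuotientGroup.mk'_surjective (Subgroup.zpowers c))
  refine commutator_le_of_commute_quotient _ (commute_of_closure_pair_eq_top hg ?_)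
  rw [← map_mul, h, map_mul, map_mul, (QuotientGroup.eq_one_iff c).mpr (Subgroup.mem_zpowers c)
    |> fun e => show QuotientGroup.mk' _ c = 1 from e, mul_one]

theorem IsMetacyclic.of_commutator_le_zpowers {H : Type*} [Group H] {a b : H}
    (hgen : Subgroup.closure {a, b} = ⊤) (h : commutator H ≤ Subgroup.zpowers a) :
    IsMetacyclic H := by
  have hn : (Subgroup.zpowers a).Normal := Subgroup.Normal.of_commutator_le _ h
  refine ⟨Subgroup.zpowers a, hn, inferInstance, ?_⟩
  have hg := closure_pair_map_eq_top hgen _ (QuotientGroup.mk'_surjective (Subgroup.zpowers a))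
  have ha : QuotientGroup.mk' (Subgroup.zpowers a) a = 1 :=
    (QuotientGroup.eq_one_iff a).mpr (Subgroup.mem_zpowers a)
  rw [ha, Subgroup.closure_insert_one, ← Subgroup.zpowers_eq_closure] at hg
  exact ⟨_, fun x => hg ▸ Subgroup.mem_top x⟩

theorem IsMetacyclic.exists_pair {G : Type*} [Group G] [Finite G] (hG : IsMetacyclic G) :
    ∃ (a b : G) (k : ℕ), Subgroup.closure {a, b} = ⊤ ∧ b * a = a ^ k * b ∧
      (Subgroup.zpowers a).Normal := by
  obtain ⟨N, hN, hc, hq⟩ := hG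
  obtain ⟨a, ha⟩ := Subgroup.isCyclic_iff_exists_zpowers_eq_top N |>.mp hc
  obtain ⟨b', hb⟩ := hq
  obtain ⟨b, rfl⟩ := QuotientGroup.mk'_surjective N b'
  have hn : (Subgroup.zpowers a).Normal := ha ▸ hN
  have hba : b * a * b⁻¹ ∈ Submonoid.powers a := by
    rw [mem_powers_iff_mem_zpowers]
    exact hn.conj_mem a (Subgroup.mem_zpowers a) b
  obtain ⟨k, hk⟩ := hba
  refine ⟨a, b, k, ?_, ?_, hn⟩
  · rw [eq_top_iff]
    intro x _
    obtain ⟨i, hi⟩ := hb (QuotientGroup.mk' N x)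
    have hx : (b ^ i)⁻¹ * x ∈ Subgroup.zpowers a := by
      rw [ha]
      exact QuotientGroup.eq.mp hi
    have h2 : Subgroup.zpowers a ≤ Subgroup.closure {a, b} := by
      rw [Subgroup.zpowers_le]
      exact Subgroup.subset_closure (by simp)
    have h3 := mul_mem (zpow_mem (Subgroup.subset_closure (by simp) :
      b ∈ Subgroup.closure {a, b}) i) (h2 hx)
    rwa [mul_inv_cancel_left] at h3
  · simp only at hk
    rw [hk, inv_mul_cancel_right]

/-- The Heisenberg group of triples over a field. -/
@[ext]
structure HeisenbergGroup (F : Type*) where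
  /-- The first coordinate. -/
  x : F
  /-- The second coordinate. -/
  y : F
  /-- The central coordinate. -/
  z : F

namespace HeisenbergGroup

variable {F : Type*} [Field F]

instance : Mul (HeisenbergGroup F) := ⟨fun g h => ⟨g.x + h.x, g.y + h.y, g.z + h.z + g.x * h.y⟩⟩

instance : One (HeisenbergGroup F) := ⟨⟨0, 0, 0⟩⟩

instance : Inv (HeisenbergGroup F) := ⟨fun g => ⟨-g.x, -g.y, -g.z + g.x * g.y⟩⟩

theorem mul_def (g h : HeisenbergGroup F) :
    g * h = ⟨g.x + h.x, g.y + h.y, g.z + h.z + g.x * h.y⟩ := rfl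

theorem one_def : (1 : HeisenbergGroup F) = ⟨0, 0, 0⟩ := rfl

theorem inv_def (g : HeisenbergGroup F) : g⁻¹ = ⟨-g.x, -g.y, -g.z + g.x * g.y⟩ := rfl

instance : Group (HeisenbergGroup F) := Group.ofLeftAxioms
  (fun g h k => by ext <;> simp only [mul_def] <;> ring)
  (fun g => by ext <;> simp [mul_def, one_def])
  (fun g => by ext <;> simp only [mul_def, one_def, inv_def] <;> ring)

theorem pow_eq (g : HeisenbergGroup F) (n : ℕ) :
    g ^ n = ⟨n * g.x, n * g.y, n * g.z + (n.choose 2 : ℕ) * (g.x * g.y)⟩ := by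
  induction n with
  | zero => simp [one_def]
  | succ n ih =>
    rw [pow_succ, ih, Nat.choose_succ_succ' n 1]
    ext <;> simp only [mul_def, Nat.choose_one_right] <;> push_cast <;> ring

end HeisenbergGroup

theorem eq_of_mem_additiveMaps {F G : Type*} [Field F] [Group G] {a b : G}
    (hgen : Subgroup.closure {a, b} = ⊤) {y y' : G → F} (hy : y ∈ additiveMaps F G)
    (hy' : y' ∈ additiveMaps F G) (ha : y a = y' a) (hb : y b = y' b) : y = y' := by
  let f : G →* Multiplicative F :=
    MonoidHom.mk' (fun g => Multiplicative.ofAdd (y g)) fun g h => by rw [hy g h]; rfl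
  let f' : G →* Multiplicative F :=
    MonoidHom.mk' (fun g => Multiplicative.ofAdd (y' g)) fun g h => by rw [hy' g h]; rfl
  have : f = f' := MonoidHom.eq_of_eqOn_dense hgen (by
    rintro g (rfl | hg)
    · exact congrArg Multiplicative.ofAdd ha
    · rw [Set.mem_singleton_iff.mp hg]
      exact congrArg Multiplicative.ofAdd hb)
  funext g
  exact congrArg Multiplicative.toAdd (DFunLike.congr_fun this g)

theorem additiveMaps_apply_one {F G : Type*} [Field F] [Group G] {y : G → F}
    (hy : y ∈ additiveMaps F G) : y 1 = 0 := by
  simpa using hy 1 1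

theorem additiveMaps_apply_pow {F G : Type*} [Field F] [Group G] {y : G → F}
    (hy : y ∈ additiveMaps F G) (g : G) (n : ℕ) : y (g ^ n) = n * y g := by
  induction n with
  | zero => simpa using additiveMaps_apply_one hy
  | succ n ih => rw [pow_succ, hy, ih]; push_cast; ring

theorem additiveMaps_apply_commutator {F G : Type*} [Field F] [Group G] {y : G → F}
    (hy : y ∈ additiveMaps F G) {g : G} (hg : g ∈ commutator G) : y g = 0 := by
  let f : G →* Multiplicative F :=
    MonoidHom.mk' (fun g => Multiplicative.ofAdd (y g)) fun g h => by rw [hy g h]; rfl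
  have := Abelianization.commutator_subset_ker f hg
  exact congrArg Multiplicative.toAdd (MonoidHom.mem_ker.mp this)

/-- Evaluation of additive maps at two elements. -/
def additiveMapsEvalPair (F : Type*) {G : Type*} [Field F] [Group G] (a b : G) :
    additiveMaps F G →ₗ[F] F × F where
  toFun y := (y.1 a, y.1 b)
  map_add' _ _ := rfl
  map_smul' _ _ := rfl

theorem additiveMapsEvalPair_injective (F : Type*) {G : Type*} [Field F] [Group G] {a b : G}
    (hgen : Subgroup.closure {a, b} = ⊤) : Function.Injective (additiveMapsEvalPair F a b) :=
  fun y y' h => Subtype.ext (eq_of_mem_additiveMaps hgen y.2 y'.2 (congrArg Prod.fst h)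
    (congrArg Prod.snd h))

theorem finrank_additiveMaps_le (F : Type*) {G : Type*} [Field F] [Group G] {a b : G}
    (hgen : Subgroup.closure {a, b} = ⊤) : Module.finrank F (additiveMaps F G) ≤ 2 := by
  have := LinearMap.finrank_le_finrank_of_injective (additiveMapsEvalPair_injective F hgen)
  simpa using this

theorem exists_additiveMap_of_finrank {F : Type*} {G : Type*} [Field F] [Group G] {a b : G}
    (hgen : Subgroup.closure {a, b} = ⊤) (h : Module.finrank F (additiveMaps F G) = 2)
    (a' b' : F) : ∃ y ∈ additiveMaps F G, y a = a' ∧ y b = b' := by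
  have hinj := additiveMapsEvalPair_injective F hgen
  have : FiniteDimensional F (additiveMaps F G) := Module.finite_of_finrank_eq_succ h
  have hs := (LinearMap.injective_iff_surjective_of_finrank_eq_finrank (by simp [h])).mp hinj
  obtain ⟨y, hy⟩ := hs (a', b')
  exact ⟨y.1, y.2, congrArg Prod.fst hy, congrArg Prod.snd hy⟩

theorem finrank_additiveMaps_eq_two {F : Type*} {G : Type*} [Field F] [Group G] {a b : G}
    (hgen : Subgroup.closure {a, b} = ⊤)
    (h : ∀ a' b' : F, ∃ y ∈ additiveMaps F G, y a = a' ∧ y b = b') :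
    Module.finrank F (additiveMaps F G) = 2 := by
  have e : additiveMaps F G ≃ₗ[F] F × F := LinearEquiv.ofBijective (additiveMapsEvalPair F a b)
    ⟨additiveMapsEvalPair_injective F hgen, fun ⟨a', b'⟩ => by
      obtain ⟨y, hy, h1, h2⟩ := h a' b'
      exact ⟨⟨y, hy⟩, Prod.ext h1 h2⟩⟩
  rw [e.finrank_eq]
  simp

theorem exists_generators_of_finrank_le {p : ℕ} [Fact p.Prime] (F : Type*) [Field F] [CharP F p]
    {H : Type*} [Group H] [Finite H] (hH : IsPGroup p H)
    (h : Module.finrank F (additiveMaps F H) ≤ 2) :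
    ∃ (a b : H) (s t : ℕ), Subgroup.closure {a, b} = ⊤ ∧ a ^ p ^ s ∈ commutator H ∧
      b ^ p ^ t ∈ commutator H ∧ Nat.card (Abelianization H) = p ^ (s + t) := by
  have hof : Function.Surjective (Abelianization.of : H →* Abelianization H) :=
    QuotientGroup.mk_surjective
  let L : additiveMaps F (Abelianization H) →ₗ[F] additiveMaps F H :=
    { toFun := fun y => ⟨fun g => y.1 (Abelianization.of g), fun g h => by
        simp only [map_mul]
        exact y.2 _ _⟩
      map_add' := fun _ _ => rfl
      map_smul' := fun _ _ => rfl }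
  have hL : Function.Injective L := by
    intro y y' hyy
    ext g
    obtain ⟨g, rfl⟩ := hof g
    exact congrFun (congrArg Subtype.val hyy) g
  have : FiniteDimensional F (additiveMaps F H) := inferInstance
  obtain ⟨a', b', s, t, hgen, ha, hb, hcard⟩ := exists_pair_closure_eq_top_of_finrank_le F
    (hH.of_surjective _ hof) ((LinearMap.finrank_le_finrank_of_injective hL).trans h)
  obtain ⟨a, rfl⟩ := hof a'
  obtain ⟨b, rfl⟩ := hof b'
  refine ⟨a, b, s, t, ?_, ?_, ?_, hcard⟩
  · apply eq_top_of_sup_commutator_eq_top hH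
    rw [← Abelianization.ker_of, ← Subgroup.comap_map_eq, MonoidHom.map_closure, Set.image_pair,
      hgen, Subgroup.comap_top]
  · rwa [← Abelianization.ker_of, MonoidHom.mem_ker, map_pow]
  · rwa [← Abelianization.ker_of, MonoidHom.mem_ker, map_pow]

theorem exists_additiveMap_of_card {p : ℕ} [Fact p.Prime] {F : Type*} [Field F] [CharP F p]
    {H : Type*} [Group H] [Finite H] {a b : H} {s t : ℕ} (hgen : Subgroup.closure {a, b} = ⊤)
    (ha : a ^ p ^ s ∈ commutator H) (hb : b ^ p ^ t ∈ commutator H)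
    (hcard : Nat.card (Abelianization H) = p ^ (s + t)) (hs : s ≠ 0) (ht : t ≠ 0) (a' b' : F) :
    ∃ y ∈ additiveMaps F H, y a = a' ∧ y b = b' := by
  have hof : Function.Surjective (Abelianization.of : H →* Abelianization H) :=
    QuotientGroup.mk_surjective
  rw [← Abelianization.ker_of, MonoidHom.mem_ker, map_pow] at ha hb
  have hpp : ∀ (c : F) (n : ℕ), n ≠ 0 → (Multiplicative.ofAdd c) ^ p ^ n = 1 := fun c n hn => by
    rw [← ofAdd_nsmul, nsmul_eq_mul, Nat.cast_pow, CharP.cast_eq_zero, zero_pow hn, zero_mul]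
    rfl
  have hp : 0 < p := (Fact.out : p.Prime).pos
  obtain ⟨f, hfa, hfb⟩ := exists_monoidHom_of_card_closure_le
    (a' := Multiplicative.ofAdd a') (b' := Multiplicative.ofAdd b')
    (closure_pair_map_eq_top hgen _ hof) (by
      have := card_closure_pair_le_of_commutator_central
        (α := (Abelianization.of a, Multiplicative.ofAdd a'))
        (β := (Abelianization.of b, Multiplicative.ofAdd b')) (γ := 1) (P := p ^ s) (Q := p ^ t)
        (R := 1) (by rw [mul_one, mul_comm]) (Commute.one_left _) (Commute.one_left _)
        (by positivity) (by positivity) one_pos (Prod.ext ha (hpp _ _ hs))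
        (Prod.ext hb (hpp _ _ ht)) (one_pow _)
      rwa [hcard, pow_add, ← mul_one (p ^ s * p ^ t)])
  refine ⟨fun g => Multiplicative.toAdd (f (Abelianization.of g)), fun g h => ?_, ?_, ?_⟩
  · simp only [map_mul]
    rfl
  · simp only [hfa]
    rfl
  · simp only [hfb]
    rfl

theorem cast_choose_two_eq_zero {p : ℕ} [hp : Fact p.Prime] (F : Type*) [Field F] [CharP F p]
    {t : ℕ} (ht : t ≠ 0) (h : p ≠ 2 ∨ t ≠ 1) : (((p ^ t).choose 2 : ℕ) : F) = 0 := by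
  rw [CharP.cast_eq_zero_iff F p]
  have h2 : (p ^ t).choose 2 * 2 = p ^ t * (p ^ t - 1) := by
    rw [Nat.choose_two_right, Nat.div_mul_cancel (Nat.even_mul_pred_self _).two_dvd]
  obtain ⟨t, rfl⟩ := Nat.exists_eq_add_one_of_ne_zero ht
  by_cases hp2 : p = 2
  · subst hp2
    obtain ⟨t, rfl⟩ := Nat.exists_eq_add_one_of_ne_zero (show t ≠ 0 by rintro rfl; simp at h)
    have : (2 ^ (t + 1 + 1)).choose 2 = 2 * (2 ^ t * (2 ^ (t + 1 + 1) - 1)) := by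
      apply Nat.eq_of_mul_eq_mul_right two_pos
      rw [h2]
      generalize 2 ^ (t + 1 + 1) - 1 = X
      ring
    exact ⟨_, this⟩
  · have : p ∣ (p ^ (t + 1)).choose 2 * 2 := by
      rw [h2]
      exact Dvd.dvd.mul_right (dvd_pow_self p (by omega)) _
    exact (hp.out.coprime_iff_not_dvd.mpr fun hd =>
      hp2 ((Nat.prime_dvd_prime_iff_eq hp.out Nat.prime_two).mp hd)).dvd_of_dvd_mul_right this

theorem exists_cup_of_commutator_central {p : ℕ} [hp : Fact p.Prime] {F : Type*} [Field F]
    [CharP F p] {K : Type*} [Group K] [Finite K] {a b c : K} {s t : ℕ}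
    (hgen : Subgroup.closure {a, b} = ⊤) (h : b * a = a * b * c) (hc : c ∈ Subgroup.center K)
    (hcp : c ^ p = 1) (ha : a ^ p ^ s = 1) (hb : b ^ p ^ t = 1)
        (hcard : p ^ (s + t + 1) ≤ Nat.card K)
    (hs : s ≠ 0) (ht : t ≠ 0) (hpt : p ≠ 2 ∨ t ≠ 1) (ya yb : F) :
    ∃ x y z : K → F, x ∈ additiveMaps F K ∧ y ∈ additiveMaps F K ∧ x a = 0 ∧ x b = 1 ∧
      y a = ya ∧ y b = yb ∧ ∀ g h, z (g * h) = z g + z h + x g * y h := by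
  have hpp : ∀ n : ℕ, n ≠ 0 → ((p ^ n : ℕ) : F) = 0 := fun n hn => by
    rw [Nat.cast_pow, CharP.cast_eq_zero, zero_pow hn]
  have hp0 : 0 < p := hp.out.pos
  have hcc : ∀ g, Commute c g := fun g => ((Subgroup.mem_center_iff.mp hc) g).symm
  obtain ⟨f, hfa, hfb⟩ := exists_monoidHom_of_card_closure_le
    (a' := (⟨0, ya, 0⟩ : HeisenbergGroup F)) (b' := ⟨1, yb, 0⟩) hgen (by
      have := card_closure_pair_le_of_commutator_central
        (α := (a, (⟨0, ya, 0⟩ : HeisenbergGroup F)))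
        (β := (b, ⟨1, yb, 0⟩)) (γ := (c, ⟨0, 0, ya⟩)) (P := p ^ s) (Q := p ^ t)
        (R := p) (Prod.ext h (by simp [HeisenbergGroup.mul_def, add_comm]))
        (Prod.ext (hcc a) (by simp [HeisenbergGroup.mul_def]))
        (Prod.ext (hcc b) (by simp [HeisenbergGroup.mul_def, add_comm]))
        (by positivity) (by positivity) hp0
        (Prod.ext ha (by simp [HeisenbergGroup.pow_eq, HeisenbergGroup.one_def, hs]))
        (Prod.ext hb (by simp [HeisenbergGroup.pow_eq, HeisenbergGroup.one_def, ht,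
          cast_choose_two_eq_zero F ht hpt]))
        (Prod.ext hcp (by simp [HeisenbergGroup.pow_eq, HeisenbergGroup.one_def]))
      exact ⟨this.1, this.2.trans (by rwa [← pow_add, ← pow_succ])⟩)
  refine ⟨fun g => (f g).x, fun g => (f g).y, fun g => (f g).z, fun g h => ?_, fun g h => ?_,
    ?_, ?_, ?_, ?_, fun g h => ?_⟩ <;>
  simp only [map_mul, HeisenbergGroup.mul_def, hfa, hfb]

theorem not_exists_cup_of_metacyclic {F : Type*} [Field F] {G : Type*} [Group G] {a b : G} {k : ℕ}
    (hgen : Subgroup.closure {a, b} = ⊤) (h : b * a = a ^ k * b)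
    (hrank : Module.finrank F (additiveMaps F G) = 2) {x : G → F} (hx : x ∈ additiveMaps F G)
    (hcup : ∀ y ∈ additiveMaps F G, ∃ z : G → F, ∀ g h, z (g * h) = z g + z h + x g * y h) :
    x = 0 := by
  have hk : (k : F) = 1 := by
    obtain ⟨y, hy, hya, -⟩ := exists_additiveMap_of_finrank hgen hrank 1 0
    have := congrArg y h
    rw [hy, hy, additiveMaps_apply_pow hy, hya] at this
    linear_combination -this
  have key : ∀ y ∈ additiveMaps F G,
      x b * y a - x a * y b = (k.choose 2 : ℕ) * (x a * y a) := fun y hy => by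
    obtain ⟨z, hz⟩ := hcup y hy
    have hzp : ∀ n : ℕ, z (a ^ n) = n * z a + (n.choose 2 : ℕ) * (x a * y a) := fun n => by
      induction n with
      | zero =>
        have := hz 1 1
        rw [additiveMaps_apply_one hy, mul_one] at this
        simp only [pow_zero, Nat.choose_zero_succ, Nat.cast_zero]
        linear_combination -this
      | succ n ih =>
        rw [pow_succ, hz, ih, additiveMaps_apply_pow hx, Nat.choose_succ_succ' n 1,
          Nat.choose_one_right]
        push_cast
        ring
    have := congrArg z h
    rw [hz, hz, hzp, additiveMaps_apply_pow hx, hk] at this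
    linear_combination this
  obtain ⟨y, hy, hya, hyb⟩ := exists_additiveMap_of_finrank hgen hrank 0 1
  obtain ⟨y', hy', hya', hyb'⟩ := exists_additiveMap_of_finrank hgen hrank 1 0
  have h1 := key y hy
  have h2 := key y' hy'
  rw [hya, hyb] at h1
  rw [hya', hyb'] at h2
  have hxa : x a = 0 := by linear_combination -h1
  refine eq_of_mem_additiveMaps hgen hx (Submodule.zero_mem _) hxa ?_
  rw [hxa] at h2
  simpa using h2

theorem commutator_le_zpowers_sup_of_pow_mem {p : ℕ} [hp : Fact p.Prime] {H : Type*} [Group H]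
    {P : Subgroup H} [P.Normal] {c : H ⧸ P} (hcp : c ^ p = 1)
    (hc : commutator (H ⧸ P) ≤ Subgroup.zpowers c) {g : H} {n : ℕ} (hn : g ^ n ∈ commutator H)
    (hP : g ^ n ∉ P) : commutator H ≤ Subgroup.zpowers g ⊔ P := by
  have hof := QuotientGroup.mk'_surjective P
  have hmap : (commutator H).map (QuotientGroup.mk' P) = commutator (H ⧸ P) := by
    rw [map_commutator_eq, MonoidHom.range_eq_top.mpr hof]
    rfl
  set d := QuotientGroup.mk' P (g ^ n) with hd
  have hd1 : d ≠ 1 := fun h => hP ((QuotientGroup.eq_one_iff _).mp h)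
  have hdc : d ∈ Subgroup.zpowers c := hc (hmap ▸ Subgroup.mem_map_of_mem _ hn)
  obtain ⟨i, hi⟩ := hdc
  simp only at hi
  have hpi : ¬ (p : ℤ) ∣ i := fun ⟨j, hj⟩ => hd1 (by
    rw [← hi, hj, zpow_mul, zpow_natCast, hcp, one_zpow])
  have hcop : IsCoprime i (p : ℤ) :=
    (((Nat.prime_iff_prime_int.mp hp.out).coprime_iff_not_dvd).mpr hpi).symm
  obtain ⟨u, v, huv⟩ := hcop
  have hcd : c ∈ Subgroup.zpowers d := ⟨u, by
    simp only
    rw [← hi, ← zpow_mul, show i * u = 1 - p * v by linear_combination huv, zpow_sub, zpow_mul c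
        (p : ℤ) v,
      zpow_natCast, hcp, one_zpow, inv_one, mul_one, zpow_one]⟩
  have h1 : commutator H ≤ (Subgroup.zpowers d).comap (QuotientGroup.mk' P) := by
    rw [← Subgroup.map_le_iff_le_comap, hmap]
    exact hc.trans (Subgroup.zpowers_le.mpr hcd)
  refine h1.trans ?_
  rw [← MonoidHom.map_zpowers, Subgroup.comap_map_eq, QuotientGroup.ker_mk']
  exact sup_le_sup_right (Subgroup.zpowers_le.mpr (Subgroup.pow_mem _ (Subgroup.mem_zpowers g) n)) P

theorem pow_le_card_quotient {p : ℕ} [hp : Fact p.Prime] {H : Type*} [Group H] [Finite H]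
    (hH : IsPGroup p H) {P : Subgroup H} [P.Normal] (hP : P ≤ commutator H)
        (hne : ¬ commutator H ≤ P) {n : ℕ}
    (hcard : Nat.card (Abelianization H) = p ^ n) : p ^ (n + 1) ≤ Nat.card (H ⧸ P) := by
  have h1 := Subgroup.relIndex_mul_index hP
  have h2 : (commutator H).index = p ^ n := hcard
  obtain ⟨m, hm⟩ := hH.exists_card_eq
  have h3 : P.relIndex (commutator H) ∣ p ^ m := by
    rw [← hm]
    exact (Dvd.intro _ h1).trans P.index_dvd_card
  obtain ⟨j, -, hj⟩ := (Nat.dvd_prime_pow hp.out).mp h3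
  have hj0 : j ≠ 0 := fun h0 => hne (by
    rw [← Subgroup.relIndex_eq_one, hj, h0, pow_zero])
  change p ^ (n + 1) ≤ P.index
  rw [← h1, h2, hj, pow_succ, mul_comm]
  exact Nat.mul_le_mul_right _ (Nat.le_self_pow hj0 p)

theorem IsMetacyclic.of_not_exists_cup {p : ℕ} [hp : Fact p.Prime] {F : Type*} [Field F] [CharP F p]
    {H : Type*} [Group H] [Finite H] (hH : IsPGroup p H) {a b : H} {s t : ℕ}
    (hgen : Subgroup.closure {a, b} = ⊤) (ha : a ^ p ^ s ∈ commutator H)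
    (hb : b ^ p ^ t ∈ commutator H) (hcard : Nat.card (Abelianization H) = p ^ (s + t))
    (hs : s ≠ 0) (hst : s ≤ t)
    (hcup : ∀ x ∈ additiveMaps F H, (∀ y ∈ additiveMaps F H, ∃ z : H → F,
      ∀ g h, z (g * h) = z g + z h + x g * y h) → x = 0) : IsMetacyclic H := by
  have ht : t ≠ 0 := by omega
  have hgenba : Subgroup.closure {b, a} = ⊤ := by rwa [Set.pair_comm]
  have hadd := exists_additiveMap_of_card (F := F) hgen ha hb hcard hs ht
  have hnotin : ∀ (g : H), (∃ y ∈ additiveMaps F H, y g ≠ 0) → g ∉ commutator H :=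
    fun g ⟨y, hy, hyg⟩ hg => hyg (additiveMaps_apply_commutator hy hg)
  have hfin : ∀ g g' : H, Subgroup.closure {g, g'} = ⊤ → (∃ y ∈ additiveMaps F H, y g ≠ 0) →
      commutator H ≤ Subgroup.zpowers g ⊔ commutatorPhi p H → IsMetacyclic H :=
    fun g g' hgg hg hle => IsMetacyclic.of_commutator_le_zpowers hgg
      (commutator_le_zpowers_of_le_sup_commutatorPhi hH g (hnotin g hg) hle)
  have hya : ∃ y ∈ additiveMaps F H, y a ≠ 0 := by
    obtain ⟨y, hy, h1, -⟩ := hadd 1 0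
    exact ⟨y, hy, by simp [h1]⟩
  have hyb : ∃ y ∈ additiveMaps F H, y b ≠ 0 := by
    obtain ⟨y, hy, -, h1⟩ := hadd 0 1
    exact ⟨y, hy, by simp [h1]⟩
  have hyab : ∃ y ∈ additiveMaps F H, y (a * b) ≠ 0 := by
    obtain ⟨y, hy, h1, h2⟩ := hadd 1 0
    exact ⟨y, hy, by simp [hy a b, h1, h2]⟩
  set P := commutatorPhi p H with hPdef
  by_cases hle : commutator H ≤ P
  · exact hfin a b hgen hya (hle.trans le_sup_right)
  have hof := QuotientGroup.mk'_surjective P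
  set π := QuotientGroup.mk' P with hπ
  have hker : ∀ g, π g = 1 ↔ g ∈ P := fun g => QuotientGroup.eq_one_iff g
  let c₀ : H := b⁻¹ * a⁻¹ * b * a
  have hc₀ : c₀ ∈ commutator H := by
    have : c₀ = ⁅b⁻¹, a⁻¹⁆ := by simp [c₀, commutatorElement_def]
    rw [this, commutator_def]
    exact Subgroup.commutator_mem_commutator trivial trivial
  have hcomm : π b * π a = π a * π b * π c₀ := by
    simp only [← map_mul, c₀]
    congr 1
    group
  have hcp : π c₀ ^ p = 1 := by
    rw [← map_pow, hker]
    exact (le_sup_right : _ ≤ P) (Subgroup.subset_normalClosure ⟨c₀, hc₀, rfl⟩)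
  have hcc : π c₀ ∈ Subgroup.center (H ⧸ P) := by
    rw [Subgroup.mem_center_iff]
    intro g
    obtain ⟨g, rfl⟩ := hof g
    have : ⁅c₀, g⁆ ∈ P := (le_sup_left : _ ≤ P) (Subgroup.commutator_mem_commutator hc₀ trivial)
    rw [← hker, map_commutatorElement, commutatorElement_eq_one_iff_mul_comm] at this
    exact this.symm
  have hgen' := closure_pair_map_eq_top hgen π hof
  have hcle := commutator_le_zpowers_of_central hgen' hcomm hcc
  by_cases haP : a ^ p ^ s ∈ P
  swap
  · exact hfin a b hgen hya (commutator_le_zpowers_sup_of_pow_mem hcp hcle ha haP)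
  by_cases hbP : b ^ p ^ t ∈ P
  swap
  · exact hfin b a hgenba hyb (commutator_le_zpowers_sup_of_pow_mem hcp hcle hb hbP)
  rw [← hker, map_pow] at haP hbP
  by_cases hpt : p ≠ 2 ∨ t ≠ 1
  · exfalso
    have hcK := pow_le_card_quotient hH (P := P) commutatorPhi_le hle hcard
    have hpull : ∀ y ∈ additiveMaps F (H ⧸ P), y ∘ π ∈ additiveMaps F H := fun y hy g h => by
      simp only [Function.comp_apply, map_mul]
      exact hy _ _
    obtain ⟨x, hx, hxa, hxb⟩ := hadd 0 1
    have hx0 : x ≠ 0 := fun h0 => by simp [h0] at hxb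
    refine hx0 (hcup x hx fun y hy => ?_)
    obtain ⟨x', y', z, hx', hy', hxa', hxb', hya', hyb', hz⟩ :=
      exists_cup_of_commutator_central hgen' hcomm hcc hcp haP hbP hcK hs ht hpt (y a) (y b)
    have e1 : x = x' ∘ π := eq_of_mem_additiveMaps hgen hx (hpull x' hx')
      (by rw [hxa]; exact hxa'.symm) (by rw [hxb]; exact hxb'.symm)
    have e2 : y = y' ∘ π := eq_of_mem_additiveMaps hgen hy (hpull y' hy') hya'.symm hyb'.symm
    refine ⟨z ∘ π, fun g h => ?_⟩
    rw [e1, e2]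
    simp only [Function.comp_apply, map_mul]
    exact hz _ _
  · obtain ⟨rfl, rfl⟩ : p = 2 ∧ t = 1 := by omega
    obtain rfl : s = 1 := by omega
    have hsq : π (a * b) ^ 2 = π c₀ := by
      have hc1 := fun g => (Subgroup.mem_center_iff.mp hcc) g
      rw [pow_one, pow_two] at haP hbP
      rw [map_mul, pow_two, mul_assoc (π a), ← mul_assoc (π b), hcomm, mul_assoc (π a * π b),
          ← hc1 (π b),
        mul_assoc (π a), ← mul_assoc (π b), hbP, one_mul, ← mul_assoc, haP, one_mul]
    have hgab : Subgroup.closure {a * b, a} = ⊤ := by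
      rw [eq_top_iff, ← hgen, Subgroup.closure_le]
      have h1 : a ∈ Subgroup.closure {a * b, a} := Subgroup.subset_closure (by simp)
      have h2 : a * b ∈ Subgroup.closure {a * b, a} := Subgroup.subset_closure (by simp)
      rintro g (rfl | hg)
      · exact h1
      · rw [Set.mem_singleton_iff.mp hg]
        simpa using mul_mem (inv_mem h1) h2
    have hcP : c₀ ∉ P := fun hmem => hle (by
      have h0 : commutator (H ⧸ P) ≤ ⊥ := by
        rw [← Subgroup.zpowers_one_eq_bot, ← (hker c₀).mpr hmem]
        exact hcle
      have := map_commutator_eq _ π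
      rw [MonoidHom.range_eq_top.mpr hof] at this
      rw [← QuotientGroup.ker_mk' P, ← MonoidHom.comap_bot, ← Subgroup.map_le_iff_le_comap, this]
      exact h0)
    have hqc : (a * b) ^ 2 * c₀⁻¹ ∈ P := by
      rw [← hker, map_mul, map_pow, hsq, map_inv, mul_inv_cancel]
    refine hfin (a * b) a hgab hyab (commutator_le_zpowers_sup_of_pow_mem hcp hcle (n := 2) ?_ ?_)
    · have := mul_mem (commutatorPhi_le hqc) hc₀
      rwa [inv_mul_cancel_right] at this
    · intro hmem
      rw [← hker, map_pow, hsq, hker] at hmem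
      exact hcP hmem

theorem IsMetacyclic.of_algEquiv {p : ℕ} [hp : Fact p.Prime] {F : Type*} [Field F] [CharP F p]
    {G H : Type*} [Group G] [Finite G] [Group H] [Finite H] (hG : IsPGroup p G)
    (hH : IsPGroup p H) (hmc : IsMetacyclic G) (φ : MonoidAlgebra F G ≃ₐ[F] MonoidAlgebra F H) :
    IsMetacyclic H := by
  obtain ⟨α, β, k, hgenG, hk, -⟩ := hmc.exists_pair
  have hrank := (additiveMapsEquiv hG hH φ).finrank_eq
  obtain ⟨a, b, s, t, hgen, ha, hb, hcard⟩ := exists_generators_of_finrank_le F hH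
    (hrank.trans_le (finrank_additiveMaps_le F hgenG))
  have hcyc : ∀ g h : H, Subgroup.closure {g, h} = ⊤ → g ∈ commutator H → IsMetacyclic H :=
    fun g h hgh hg => by
      have htop : Subgroup.zpowers h = ⊤ := by
        apply eq_top_of_sup_commutator_eq_top hH
        rw [eq_top_iff, ← hgh, Subgroup.closure_le]
        rintro x (rfl | hx)
        · exact (le_sup_right : _ ≤ Subgroup.zpowers h ⊔ commutator H) hg
        · rw [Set.mem_singleton_iff.mp hx]
          exact (le_sup_left : _ ≤ Subgroup.zpowers h ⊔ commutator H) (Subgroup.mem_zpowers h)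
      exact IsMetacyclic.of_commutator_le_zpowers (a := h) (b := g)
        (by rwa [Set.pair_comm]) (htop ▸ le_top)
  by_cases hs : s = 0
  · exact hcyc a b hgen (by simpa [hs] using ha)
  by_cases ht : t = 0
  · exact hcyc b a (by rwa [Set.pair_comm]) (by simpa [ht] using hb)
  have hrk : Module.finrank F (additiveMaps F G) = 2 := by
    rw [← hrank]
    exact finrank_additiveMaps_eq_two hgen (exists_additiveMap_of_card hgen ha hb hcard hs ht)
  have hcup : ∀ x ∈ additiveMaps F H, (∀ y ∈ additiveMaps F H, ∃ z : H → F,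
      ∀ g h, z (g * h) = z g + z h + x g * y h) → x = 0 := fun x hx hxy => by
    have h0 := not_exists_cup_of_metacyclic hgenG hk hrk (pullEval_mem_additiveMaps hG φ hx)
      fun y hy => by
        obtain ⟨z, hz⟩ := hxy _ (pullEval_mem_additiveMaps hH φ.symm hy)
        refine ⟨pullEval φ.toAlgHom z, fun g h => ?_⟩
        have := pullEval_cup hG φ hz g h
        have e := pullEval_symm_pullEval φ.symm y
        rw [AlgEquiv.symm_symm] at e
        rwa [e] at this
    have e := pullEval_symm_pullEval φ x
    rw [h0] at e
    rw [← e]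
    funext h
    change evalAt 0 _ = 0
    rw [evalAt_zero, LinearMap.zero_apply]
  rcases le_total s t with hst | hst
  · exact IsMetacyclic.of_not_exists_cup hH hgen ha hb hcard hs hst hcup
  · exact IsMetacyclic.of_not_exists_cup hH (by rwa [Set.pair_comm]) hb ha (by rwa [add_comm])
      ht hst hcup

/-- The congruence `k ≡ 1` modulo `p`, strengthened to modulo `4` if `p = 2`. -/
def IsPrincipalUnit (p : ℕ) (k : ℤ) : Prop := (p : ℤ) ∣ k - 1 ∧ (p = 2 → (4 : ℤ) ∣ k - 1)

theorem prime_not_dvd_of_dvd_sub_one {p : ℕ} [hp : Fact p.Prime] {k : ℤ} (h : (p : ℤ) ∣ k - 1) :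
    ¬ (p : ℤ) ∣ k := fun hk => by
  have := dvd_sub hk h
  rw [sub_sub_cancel] at this
  exact (Nat.prime_iff_prime_int.mp hp.out).not_dvd_one this

theorem emultiplicity_pow_prime_pow_sub_one {p : ℕ} [hp : Fact p.Prime] {k : ℤ}
    (hk : IsPrincipalUnit p k) (e : ℕ) :
    emultiplicity (p : ℤ) (k ^ p ^ e - 1) = emultiplicity (p : ℤ) (k - 1) + e := by
  have hnk := prime_not_dvd_of_dvd_sub_one hk.1
  rcases hp.out.eq_two_or_odd' with rfl | hodd
  · have := Int.two_pow_sub_pow' (y := 1) (2 ^ e) (hk.2 rfl) (by exact_mod_cast hnk)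
    rw [one_pow] at this
    push_cast at this ⊢
    rw [this, emultiplicity_pow_self (by norm_num) (by norm_num [Int.isUnit_iff])]
  · have := Int.emultiplicity_pow_sub_pow hp.out hodd (y := 1) hk.1 hnk (p ^ e)
    rw [one_pow] at this
    rw [this, emultiplicity_pow_self hp.out.ne_zero (Nat.isUnit_iff.not.mpr hp.out.ne_one)]

theorem IsPrincipalUnit.exists_pow_eq {p : ℕ} [hp : Fact p.Prime] {k : ℤ}
    (hk : IsPrincipalUnit p k) {r : ℕ} {u : ℤ} (hu : k - 1 = p ^ r * u) (hpu : ¬ (p : ℤ) ∣ u)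
    (e : ℕ) : ∃ v, k ^ p ^ e = 1 + p ^ (r + e) * v ∧ ¬ (p : ℤ) ∣ v := by
  have hp0 : (p : ℤ) ≠ 0 := by exact_mod_cast hp.out.ne_zero
  have h1 : emultiplicity (p : ℤ) (k - 1) = r := by
    rw [emultiplicity_eq_coe, hu]
    refine ⟨Dvd.intro _ rfl, fun h => hpu ?_⟩
    rw [pow_succ] at h
    exact (mul_dvd_mul_iff_left (pow_ne_zero r hp0)).mp h
  have h2 := emultiplicity_pow_prime_pow_sub_one hk e
  rw [h1, ← Nat.cast_add, emultiplicity_eq_coe] at h2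
  obtain ⟨⟨v, hv⟩, h3⟩ := h2
  refine ⟨v, by linear_combination hv, fun ⟨w, hw⟩ => h3 ⟨w, ?_⟩⟩
  rw [hv, hw]
  ring

theorem exists_int_modEq_inverse {p : ℕ} [hp : Fact p.Prime] {u : ℤ} (hu : ¬ (p : ℤ) ∣ u) (n : ℕ)
    (w : ℤ) : ∃ t : ℕ, (p : ℤ) ^ n ∣ t * u - w := by
  have hcop : IsCoprime u ((p : ℤ) ^ n) :=
    ((((Nat.prime_iff_prime_int.mp hp.out).coprime_iff_not_dvd).mpr hu).symm).pow_right
  obtain ⟨x, y, hxy⟩ := hcop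
  have hp0 : (0 : ℤ) < (p : ℤ) ^ n := pow_pos (by exact_mod_cast hp.out.pos) n
  refine ⟨((w * x) % (p : ℤ) ^ n).toNat, ?_⟩
  rw [Int.toNat_of_nonneg (Int.emod_nonneg _ hp0.ne')]
  have h1 := Int.emod_add_mul_ediv (w * x) ((p : ℤ) ^ n)
  refine ⟨-(w * x / (p : ℤ) ^ n) * u - w * y, ?_⟩
  linear_combination u * h1 + w * hxy

theorem IsPrincipalUnit.exists_pow_modEq {p : ℕ} [hp : Fact p.Prime] {k : ℤ}
    (hk : IsPrincipalUnit p k) {r : ℕ} {u u' : ℤ} (hu : k - 1 = p ^ r * u) (hpu : ¬ (p : ℤ) ∣ u)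
    (hpu' : ¬ (p : ℤ) ∣ u') (e : ℕ) :
    ∃ i : ℕ, ¬ p ∣ i ∧ (p : ℤ) ^ (r + 1 + e) ∣ k ^ i - (1 + p ^ r * u') := by
  have hr : r ≠ 0 := by
    rintro rfl
    rw [pow_zero, one_mul] at hu
    exact hpu (hu ▸ hk.1)
  obtain ⟨r, rfl⟩ := Nat.exists_eq_add_one_of_ne_zero hr
  induction e with
  | zero =>
    obtain ⟨t, w, hw⟩ := exists_int_modEq_inverse hpu 1 u'
    rw [pow_one] at hw
    refine ⟨t, fun h => hpu' ?_, ?_⟩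
    · obtain ⟨t', rfl⟩ := h
      exact ⟨t' * u - w, by push_cast at hw ⊢; linear_combination -hw⟩
    · obtain ⟨c, hc⟩ := Polynomial.powAddExpansion 1 ((p : ℤ) ^ (r + 1) * u) t
      rw [show k = 1 + p ^ (r + 1) * u by linear_combination hu, hc]
      refine ⟨w + c * u ^ 2 * p ^ r, ?_⟩
      simp only [one_pow]
      linear_combination (p : ℤ) ^ (r + 1) * hw
  | succ e ih =>
    obtain ⟨i, hpi, w, hw⟩ := ih
    obtain ⟨v, hv, hpv⟩ := hk.exists_pow_eq hu hpu (e + 1)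
    obtain ⟨t, w', hw'⟩ := exists_int_modEq_inverse hpv 1 (-w)
    rw [pow_one] at hw'
    refine ⟨i + p ^ (e + 1) * t, fun h => hpi ?_, ?_⟩
    · rw [pow_succ', mul_assoc] at h
      exact (Nat.dvd_add_left (dvd_mul_right _ _)).mp h
    · obtain ⟨c, hc⟩ := Polynomial.powAddExpansion 1 ((p : ℤ) ^ (r + 1 + (e + 1)) * v) t
      obtain ⟨d, hd⟩ := (hk.1.trans (sub_one_dvd_pow_sub_one k i) : (p : ℤ) ∣ k ^ i - 1)
      rw [pow_add k i, pow_mul k, hv, hc]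
      simp only [one_pow]
      refine ⟨w' + d * t * v + (1 + p * d) * c * v ^ 2 * p ^ (r + e + 1), ?_⟩
      rw [show k ^ i = 1 + p * d by linear_combination hd] at hw ⊢
      linear_combination hw + (p : ℤ) ^ (r + 1 + (e + 1)) * hw'

theorem prime_pow_dvd_geom_sum {p : ℕ} [hp : Fact p.Prime] {k : ℤ} (hk : (p : ℤ) ∣ k - 1) (m : ℕ) :
    (p : ℤ) ^ m ∣ ∑ j ∈ Finset.range (p ^ m), k ^ j := by
  induction m generalizing k with
  | zero => simp
  | succ m ih =>
    have h1 : ∑ j ∈ Finset.range (p ^ (m + 1)), k ^ j =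
        (∑ j ∈ Finset.range p, k ^ j) * ∑ j ∈ Finset.range (p ^ m), (k ^ p) ^ j := by
      rw [pow_succ', Finset.sum_mul_sum, Finset.sum_comm, ← Finset.sum_product']
      symm
      refine Finset.sum_nbij' (fun x => x.2 + p * x.1) (fun j => (j / p, j % p)) ?_ ?_ ?_ ?_ ?_
      · rintro ⟨x, y⟩ h
        simp only [Finset.mem_product, Finset.mem_range] at h ⊢
        nlinarith
      · intro j h
        simp only [Finset.mem_product, Finset.mem_range] at h ⊢
        exact ⟨Nat.div_lt_of_lt_mul h, Nat.mod_lt _ hp.out.pos⟩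
      · rintro ⟨x, y⟩ h
        simp only [Finset.mem_product, Finset.mem_range] at h ⊢
        rw [Nat.add_mul_div_left _ _ hp.out.pos, Nat.div_eq_of_lt h.2, zero_add,
          Nat.add_mul_mod_self_left, Nat.mod_eq_of_lt h.2]
      · intro j _
        simp only
        exact Nat.mod_add_div j p
      · rintro ⟨x, y⟩ _
        simp only
        rw [← pow_mul, pow_add]
    rw [h1, pow_succ']
    refine mul_dvd_mul ?_ (ih (hk.trans (sub_one_dvd_pow_sub_one k p)))
    have h2 : (p : ℤ) ∣ ∑ j ∈ Finset.range p, (k ^ j - 1) :=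
      Finset.dvd_sum fun j _ => hk.trans (sub_one_dvd_pow_sub_one k j)
    rw [Finset.sum_sub_distrib] at h2
    have h3 := dvd_add h2 (dvd_refl (p : ℤ))
    simpa using h3

theorem IsPrincipalUnit.exists_geom_sum_eq {p : ℕ} [hp : Fact p.Prime] {k : ℤ}
    (hk : IsPrincipalUnit p k) (m : ℕ) :
    ∃ v, ∑ j ∈ Finset.range (p ^ m), k ^ j = p ^ m * v ∧ ¬ (p : ℤ) ∣ v := by
  have hp0 : (p : ℤ) ≠ 0 := by exact_mod_cast hp.out.ne_zero
  by_cases hk1 : k = 1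
  · exact ⟨1, by simp [hk1], (Nat.prime_iff_prime_int.mp hp.out).not_dvd_one⟩
  have hfin : FiniteMultiplicity (p : ℤ) (k - 1) :=
    Int.finiteMultiplicity_iff.mpr ⟨by simpa using hp.out.ne_one, sub_ne_zero.mpr hk1⟩
  obtain ⟨u, hu, hpu⟩ := hfin.exists_eq_pow_mul_and_not_dvd
  obtain ⟨v, hv⟩ := prime_pow_dvd_geom_sum hk.1 m
  refine ⟨v, hv, fun ⟨w, hw⟩ => ?_⟩
  obtain ⟨z, hz, hpz⟩ := hk.exists_pow_eq hu hpu m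
  have h1 := geom_sum_mul k (p ^ m)
  rw [hv, hz] at h1
  have h2 : (p : ℤ) ^ (multiplicity (p : ℤ) (k - 1) + m) * z =
      (p : ℤ) ^ (multiplicity (p : ℤ) (k - 1) + m) * (p * (w * u)) := by
    rw [pow_add]
    linear_combination -h1 + (p : ℤ) ^ m * (k - 1) * hw + (p : ℤ) ^ m * p * w * hu
  exact hpz ⟨_, mul_left_cancel₀ (pow_ne_zero _ hp0) h2⟩

theorem geom_sum_one_add_modEq {p r : ℕ} (hr : r ≠ 0) (y : ℤ) (q : ℕ) :
    (p : ℤ) ^ (r + 1) ∣ ∑ j ∈ Finset.range q, (1 + p ^ r * y) ^ j -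
        (q + p ^ r * y * q.choose 2) := by
  obtain ⟨r, rfl⟩ := Nat.exists_eq_add_one_of_ne_zero hr
  induction q with
  | zero => simp
  | succ q ih =>
    obtain ⟨w, hw⟩ := ih
    obtain ⟨c, hc⟩ := Polynomial.powAddExpansion 1 ((p : ℤ) ^ (r + 1) * y) q
    rw [Finset.sum_range_succ, hc, Nat.choose_succ_succ' q 1, Nat.choose_one_right]
    simp only [one_pow]
    refine ⟨w + c * y ^ 2 * p ^ r, ?_⟩
    push_cast
    linear_combination hw

theorem exists_pow_mul_sub_of_int {p : ℕ} [hp : Fact p.Prime] (n : ℕ) (z : ℤ) :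
    ∃ (s : ℕ) (x : ℤ), s ≤ n ∧ ¬ (p : ℤ) ∣ x ∧ (p : ℤ) ^ n ∣ z - p ^ s * x := by
  by_cases h : (p : ℤ) ^ n ∣ z
  · exact ⟨n, 1, le_rfl, (Nat.prime_iff_prime_int.mp hp.out).not_dvd_one, by
      simpa using dvd_sub h (dvd_refl _)⟩
  · have hfin : FiniteMultiplicity (p : ℤ) z :=
      Int.finiteMultiplicity_iff.mpr ⟨by simpa using hp.out.ne_one, by rintro rfl; simp at h⟩
    obtain ⟨u, hu, hpu⟩ := hfin.exists_eq_pow_mul_and_not_dvd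
    refine ⟨multiplicity (p : ℤ) z, u, ?_, hpu, by simp [← hu]⟩
    by_contra hlt
    exact h (hu ▸ Dvd.dvd.mul_right (pow_dvd_pow _ (by omega)) _)

theorem prime_dvd_sub_one_of_dvd_pow {p : ℕ} [hp : Fact p.Prime] {k : ℤ} {m : ℕ}
    (h : (p : ℤ) ∣ k ^ p ^ m - 1) : (p : ℤ) ∣ k - 1 := by
  rw [← ZMod.intCast_zmod_eq_zero_iff_dvd] at h ⊢
  push_cast at h ⊢
  rwa [ZMod.pow_card_pow] at h

theorem mul_zpow_of_mul_eq {G : Type*} [Group G] {a b : G} {k : ℤ} (h : b * a = a ^ k * b) (i : ℤ) :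
    b * a ^ i = a ^ (k * i) * b := by
  have e : b * a * b⁻¹ = a ^ k := by rw [h, mul_inv_cancel_right]
  rw [zpow_mul, ← e, conj_zpow, inv_mul_cancel_right]

theorem pow_mul_zpow_of_mul_eq {G : Type*} [Group G] {a b : G} {k : ℤ} (h : b * a = a ^ k * b)
    (j : ℕ) (i : ℤ) : b ^ j * a ^ i = a ^ (k ^ j * i) * b ^ j := by
  induction j with
  | zero => simp
  | succ j ih =>
    rw [pow_succ', mul_assoc, ih, ← mul_assoc, mul_zpow_of_mul_eq h, mul_assoc, pow_succ' k,
      mul_assoc]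

theorem zpow_mul_pow_eq {G : Type*} [Group G] {a b : G} {k : ℤ} (h : b * a = a ^ k * b) (i : ℤ)
    (n : ℕ) : (a ^ i * b) ^ n = a ^ (i * ∑ j ∈ Finset.range n, k ^ j) * b ^ n := by
  induction n with
  | zero => simp
  | succ n ih =>
    rw [pow_succ, ih, mul_assoc, ← mul_assoc (b ^ n), pow_mul_zpow_of_mul_eq h,
      Finset.sum_range_succ, mul_add, zpow_add, pow_succ]
    simp only [mul_assoc, mul_comm i]

/-- The elements `a`, `b` generate `G`, satisfy `b * a = a ^ k * b`, `a ^ N = 1`, `b ^ M = a ^ S`,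
and `G` has order `N * M`. -/
structure IsMetacyclicPair {G : Type*} [Group G] (a b : G) (N M : ℕ) (S k : ℤ) : Prop where
  closure_eq : Subgroup.closure {a, b} = ⊤
  mul_eq : b * a = a ^ k * b
  pow_left : a ^ N = 1
  pow_right : b ^ M = a ^ S
  card_eq : Nat.card G = N * M

namespace IsMetacyclicPair

variable {G : Type*} [Group G] {a b : G} {N M : ℕ} {S k : ℤ}

theorem zpow_emod (h : IsMetacyclicPair a b N M S k) {i j : ℤ} (hij : (N : ℤ) ∣ i - j) :
    a ^ i = a ^ j := by
  obtain ⟨c, hc⟩ := hij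
  rw [show i = N * c + j by linear_combination hc, zpow_add, zpow_mul, zpow_natCast, h.pow_left,
    one_zpow, one_mul]

theorem congr (h : IsMetacyclicPair a b N M S k) {S' k' : ℤ} (hS : (N : ℤ) ∣ S - S')
    (hk : (N : ℤ) ∣ k - k') : IsMetacyclicPair a b N M S' k' :=
  ⟨h.closure_eq, h.zpow_emod hk ▸ h.mul_eq, h.pow_left, h.zpow_emod hS ▸ h.pow_right, h.card_eq⟩

theorem exists_nat_modEq {N : ℕ} (hN : 0 < N) (z : ℤ) : ∃ t : ℕ, t < N ∧ (N : ℤ) ∣ z - t := by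
  have hN' : (0 : ℤ) < N := by exact_mod_cast hN
  have h1 := Int.emod_nonneg z hN'.ne'
  have h2 := Int.emod_lt_of_pos z hN'
  refine ⟨(z % N).toNat, by omega, ?_⟩
  rw [Int.toNat_of_nonneg h1]
  exact Int.dvd_self_sub_emod

theorem nonempty_mulEquiv [Finite G] (h : IsMetacyclicPair a b N M S k) {H : Type*} [Group H]
    [Finite H] {a' b' : H} (h' : IsMetacyclicPair a' b' N M S k) : Nonempty (G ≃* H) := by
  have hpos : 0 < N * M := h.card_eq ▸ Nat.card_pos
  have hN : 0 < N := Nat.pos_of_mul_pos_right hpos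
  have hM : 0 < M := Nat.pos_of_mul_pos_left hpos
  obtain ⟨k', -, hk'⟩ := exists_nat_modEq hN k
  obtain ⟨S', -, hS'⟩ := exists_nat_modEq hN S
  replace h := h.congr hS' hk'
  replace h' := h'.congr hS' hk'
  have hm := h.mul_eq
  have hm' := h'.mul_eq
  have hp := h.pow_right
  have hp' := h'.pow_right
  rw [zpow_natCast] at hm hm' hp hp'
  obtain ⟨f, hfa, hfb⟩ := exists_monoidHom_of_card_closure_le (a' := a') (b' := b') h.closure_eq (by
    rw [h.card_eq]
    exact card_closure_pair_le_of_metacyclic (α := (a, a')) (β := (b, b')) (k := k') (S := S')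
      (Prod.ext hm hm') hN hM (Prod.ext h.pow_left h'.pow_left) (Prod.ext hp hp'))
  exact nonempty_mulEquiv_of_monoidHom h'.closure_eq (h.card_eq.trans h'.card_eq.symm) f
    ⟨a, hfa⟩ ⟨b, hfb⟩

theorem zpowers_normal [Finite G] (h : IsMetacyclicPair a b N M S k) :
    (Subgroup.zpowers a).Normal := by
  have hle : Subgroup.closure {a, b} ≤ Subgroup.normalizer (Subgroup.zpowers a : Set G) := by
    rw [Subgroup.closure_le]
    rintro x (rfl | hx)
    · exact Subgroup.le_normalizer (Subgroup.mem_zpowers x)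
    · rw [Set.mem_singleton_iff.mp hx]
      refine Subgroup.mem_normalizer_fintype (fun y hy => ?_)
      obtain ⟨i, rfl⟩ := hy
      exact ⟨k * i, by simp only [mul_zpow_of_mul_eq h.mul_eq, mul_inv_cancel_right]⟩
  rw [h.closure_eq] at hle
  exact Subgroup.normalizer_eq_top_iff.mp (top_le_iff.mp hle)

theorem exists_eq [Finite G] (h : IsMetacyclicPair a b N M S k) (g : G) :
    ∃ i j : ℕ, i < N ∧ j < M ∧ g = a ^ i * b ^ j := by
  have hpos : 0 < N * M := h.card_eq ▸ Nat.card_pos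
  have hN : 0 < N := Nat.pos_of_mul_pos_right hpos
  have hM : 0 < M := Nat.pos_of_mul_pos_left hpos
  have hn := h.zpowers_normal
  have hg := closure_pair_map_eq_top h.closure_eq _
    (QuotientGroup.mk'_surjective (Subgroup.zpowers a))
  have ha : QuotientGroup.mk' (Subgroup.zpowers a) a = 1 :=
    (QuotientGroup.eq_one_iff a).mpr (Subgroup.mem_zpowers a)
  have hb : QuotientGroup.mk' (Subgroup.zpowers a) b ^ M = 1 := by
    rw [← map_pow, h.pow_right]
    exact (QuotientGroup.eq_one_iff _).mpr (Subgroup.zpow_mem _ (Subgroup.mem_zpowers a) S)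
  rw [ha, Subgroup.closure_insert_one, ← Subgroup.zpowers_eq_closure] at hg
  obtain ⟨j, hj⟩ : QuotientGroup.mk' (Subgroup.zpowers a) g ∈ Subgroup.zpowers _ :=
    hg ▸ Subgroup.mem_top _
  simp only at hj
  obtain ⟨j', hj', c, hc⟩ := exists_nat_modEq hM j
  rw [show j = M * c + j' by linear_combination hc, zpow_add, zpow_mul, zpow_natCast, hb, one_zpow,
    one_mul, zpow_natCast, ← map_pow] at hj
  have hmem : g * (b ^ j')⁻¹ ∈ Subgroup.zpowers a := by
    rw [← QuotientGroup.eq_one_iff]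
    change QuotientGroup.mk' (Subgroup.zpowers a) (g * (b ^ j')⁻¹) = 1
    rw [map_mul, map_inv, hj, mul_inv_cancel]
  obtain ⟨i, hi⟩ := hmem
  simp only at hi
  obtain ⟨i', hi', hi2⟩ := exists_nat_modEq hN i
  refine ⟨i', j', hi', hj', ?_⟩
  rw [← zpow_natCast a, ← h.zpow_emod hi2, hi, inv_mul_cancel_right]

theorem eq_and_eq [Finite G] (h : IsMetacyclicPair a b N M S k) {i j i' j' : ℕ} (hi : i < N)
    (hj : j < M) (hi' : i' < N) (hj' : j' < M) (e : a ^ i * b ^ j = a ^ i' * b ^ j') :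
    i = i' ∧ j = j' := by
  have hsurj : Function.Surjective fun x : Fin N × Fin M => a ^ x.1.1 * b ^ x.2.1 := fun g => by
    obtain ⟨i, j, hi, hj, e⟩ := h.exists_eq g
    exact ⟨(⟨i, hi⟩, ⟨j, hj⟩), e.symm⟩
  have hb := hsurj.bijective_of_nat_card_le (by simp [h.card_eq])
  have := hb.1 (a₁ := (⟨i, hi⟩, ⟨j, hj⟩)) (a₂ := (⟨i', hi'⟩, ⟨j', hj'⟩)) e
  simpa using this

theorem pos [Finite G] (h : IsMetacyclicPair a b N M S k) : 0 < N ∧ 0 < M := by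
  have hpos : 0 < N * M := h.card_eq ▸ Nat.card_pos
  exact ⟨Nat.pos_of_mul_pos_right hpos, Nat.pos_of_mul_pos_left hpos⟩

theorem orderOf_eq [Finite G] (h : IsMetacyclicPair a b N M S k) : orderOf a = N := by
  have hle := orderOf_le_of_pow_eq_one h.pos.1 h.pow_left
  by_contra hne
  have h2 := h.eq_and_eq (i := orderOf a) (j := 0) (i' := 0) (j' := 0) (by omega) h.pos.2 h.pos.1
    h.pos.2 (by rw [pow_orderOf_eq_one, pow_zero a])
  exact (orderOf_pos a).ne' h2.1

theorem zpow_eq_one_iff [Finite G] (h : IsMetacyclicPair a b N M S k) {i : ℤ} :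
    a ^ i = 1 ↔ (N : ℤ) ∣ i := by
  rw [← h.orderOf_eq, orderOf_dvd_iff_zpow_eq_one]

theorem zpow_eq_zpow_iff [Finite G] (h : IsMetacyclicPair a b N M S k) {i j : ℤ} :
    a ^ i = a ^ j ↔ (N : ℤ) ∣ i - j := by
  rw [← h.zpow_eq_one_iff, zpow_sub, mul_inv_eq_one]

theorem pow_mem_zpowers_iff [Finite G] (h : IsMetacyclicPair a b N M S k) {j : ℕ} :
    b ^ j ∈ Subgroup.zpowers a ↔ M ∣ j := by
  constructor
  · intro hj
    have h1 : b ^ (j % M) ∈ Subgroup.zpowers a := by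
      rw [← Nat.mod_add_div j M, pow_add, pow_mul, h.pow_right] at hj
      exact (Subgroup.mul_mem_cancel_right _ (Subgroup.pow_mem _
        (Subgroup.zpow_mem _ (Subgroup.mem_zpowers a) S) _)).mp hj
    obtain ⟨i, hi⟩ := h1
    simp only at hi
    obtain ⟨i', hi', hi2⟩ := exists_nat_modEq h.pos.1 i
    rw [h.zpow_emod hi2, zpow_natCast] at hi
    have := h.eq_and_eq (i := i') (j := 0) (i' := 0) (j' := j % M) hi' h.pos.2 h.pos.1
      (Nat.mod_lt _ h.pos.2) (by simpa using hi)
    exact Nat.dvd_of_mod_eq_zero this.2.symm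
  · rintro ⟨c, rfl⟩
    rw [pow_mul, h.pow_right]
    exact Subgroup.pow_mem _ (Subgroup.zpow_mem _ (Subgroup.mem_zpowers a) S) _

theorem dvd_pow_sub_one [Finite G] (h : IsMetacyclicPair a b N M S k) : (N : ℤ) ∣ k ^ M - 1 := by
  have := pow_mul_zpow_of_mul_eq h.mul_eq M 1
  rw [h.pow_right, ← zpow_add, ← zpow_add, h.zpow_eq_zpow_iff] at this
  obtain ⟨c, hc⟩ := this
  exact ⟨-c, by linear_combination -hc⟩

theorem dvd_mul_sub_one [Finite G] (h : IsMetacyclicPair a b N M S k) : (N : ℤ) ∣ (k - 1) * S := by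
  have := mul_zpow_of_mul_eq h.mul_eq S
  rw [← h.pow_right, ← pow_succ', pow_succ, mul_right_cancel_iff, h.pow_right,
    h.zpow_eq_zpow_iff] at this
  obtain ⟨c, hc⟩ := this
  exact ⟨-c, by linear_combination -hc⟩

theorem commutator_eq [Finite G] (h : IsMetacyclicPair a b N M S k) :
    commutator G = Subgroup.zpowers (a ^ (k - 1)) := by
  have hmem : a ^ (k - 1) ∈ commutator G := by
    have : ⁅b, a⁆ = a ^ (k - 1) := by
      rw [commutatorElement_def, h.mul_eq, mul_inv_cancel_right, zpow_sub, zpow_one]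
    rw [← this, commutator_def]
    exact Subgroup.commutator_mem_commutator trivial trivial
  refine le_antisymm ?_ (Subgroup.zpowers_le.mpr hmem)
  have hn : (Subgroup.zpowers (a ^ (k - 1))).Normal := by
    refine ⟨fun x hx g => ?_⟩
    obtain ⟨i, j, -, -, rfl⟩ := h.exists_eq g
    obtain ⟨l, rfl⟩ := hx
    refine ⟨k ^ j * l, ?_⟩
    simp only
    rw [← zpow_mul, ← zpow_mul, eq_mul_inv_iff_mul_eq, mul_assoc (a ^ i),
      pow_mul_zpow_of_mul_eq h.mul_eq, ← mul_assoc (a ^ _), ← mul_assoc (a ^ _), ← zpow_natCast a i,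
          ← zpow_add,
      ← zpow_add]
    congr 2
    ring
  refine commutator_le_of_commute_quotient _ (commute_of_closure_pair_eq_top
    (closure_pair_map_eq_top h.closure_eq _ (QuotientGroup.mk'_surjective _)) ?_)
  rw [← map_mul, ← map_mul, h.mul_eq]
  refine QuotientGroup.eq.mpr ?_
  have e : (a ^ k * b)⁻¹ * (a * b) = b⁻¹ * a ^ (-(k - 1)) * b⁻¹⁻¹ := by
    rw [show -(k - 1) = -k + 1 by ring, zpow_add, zpow_neg]
    group
  rw [e]
  refine hn.conj_mem _ ?_ _
  rw [zpow_neg]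
  exact inv_mem (Subgroup.mem_zpowers _)

end IsMetacyclicPair

theorem IsMetacyclic.exists_isMetacyclicPair {p : ℕ} [hp : Fact p.Prime] {G : Type*} [Group G]
    [Finite G] (hG : IsPGroup p G) (hmc : IsMetacyclic G) :
    ∃ (a b : G) (n m : ℕ) (S k : ℤ), IsMetacyclicPair a b (p ^ n) (p ^ m) S k := by
  obtain ⟨a, b, k, hgen, hk, hn⟩ := hmc.exists_pair
  obtain ⟨N, hN⟩ := hG.exists_card_eq
  have h1 := Subgroup.card_mul_index (Subgroup.zpowers a)
  rw [hN] at h1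
  obtain ⟨n, -, hn1⟩ := (Nat.dvd_prime_pow hp.out).mp (Dvd.intro _ h1)
  obtain ⟨m, -, hm1⟩ := (Nat.dvd_prime_pow hp.out).mp (Dvd.intro_left _ h1)
  have hb : b ^ p ^ m ∈ Subgroup.zpowers a := by
    rw [← hm1]
    exact Subgroup.pow_index_mem _ b
  obtain ⟨S, hS⟩ := hb
  refine ⟨a, b, n, m, S, k, hgen, by rwa [zpow_natCast], ?_, hS.symm, ?_⟩
  · rw [← hn1, Nat.card_zpowers, pow_orderOf_eq_one]
  · rw [hN, ← h1, hn1, hm1]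

/-- `k = 1 + p ^ r * u` is a principal unit with `p ∤ u` and `r < n`, or `k = 1` and `r = n`. -/
def IsReducedExponent (p n r : ℕ) (k : ℤ) : Prop :=
  k = 1 ∧ r = n ∨ IsPrincipalUnit p k ∧ r < n ∧ ∃ u : ℤ, k - 1 = p ^ r * u ∧ ¬ (p : ℤ) ∣ u

theorem IsReducedExponent.isPrincipalUnit {p n r : ℕ} {k : ℤ} (h : IsReducedExponent p n r k) :
    IsPrincipalUnit p k := by
  rcases h with ⟨rfl, -⟩ | h
  · simp [IsPrincipalUnit]
  · exact h.1

theorem IsReducedExponent.le {p n r : ℕ} {k : ℤ} (h : IsReducedExponent p n r k) : r ≤ n := by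
  rcases h with ⟨-, rfl⟩ | h
  exacts [le_rfl, h.2.1.le]

theorem IsReducedExponent.exists_eq {p n r : ℕ} {k : ℤ} (h : IsReducedExponent p n r k) :
    ∃ u : ℤ, k = 1 + p ^ r * u := by
  rcases h with ⟨rfl, -⟩ | ⟨-, -, u, hu, -⟩
  exacts [⟨0, by simp⟩, ⟨u, by linear_combination hu⟩]

theorem IsPrincipalUnit.exists_isReducedExponent {p : ℕ} [hp : Fact p.Prime] {k : ℤ}
    (hk : IsPrincipalUnit p k) (n : ℕ) :
    ∃ (r : ℕ) (k' : ℤ), (p : ℤ) ^ n ∣ k - k' ∧ IsReducedExponent p n r k' := by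
  obtain ⟨r, u, hr, hu, h⟩ := exists_pow_mul_sub_of_int (p := p) n (k - 1)
  rcases hr.eq_or_lt with rfl | hr
  · refine ⟨r, 1, ?_, Or.inl ⟨rfl, rfl⟩⟩
    simpa using dvd_add h (Dvd.intro u rfl)
  refine ⟨r, 1 + p ^ r * u, by convert h using 1; ring, Or.inr ⟨⟨?_, ?_⟩, hr, u, by ring, hu⟩⟩
  · obtain ⟨c, hc⟩ := dvd_sub hk.1 ((dvd_pow_self (p : ℤ) (by omega)).trans h)
    exact ⟨c, by linear_combination hc⟩
  · rintro rfl
    have h1 := hk.2 rfl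
    have h2 : (2 : ℤ) ∣ k - 1 := hk.1
    by_cases hn : n = 1
    · obtain rfl : r = 0 := by omega
      subst hn
      obtain ⟨c, hc⟩ := dvd_sub h2 h
      push_cast at hc
      exact absurd ⟨c, by push_cast; linear_combination hc⟩ hu
    · have h3 : (4 : ℤ) ∣ (2 : ℤ) ^ n := pow_dvd_pow (2 : ℤ) (show 2 ≤ n by omega)
      obtain ⟨c, hc⟩ := dvd_sub h1 (h3.trans h)
      exact ⟨c, by linear_combination hc⟩

theorem prime_dvd_choose_two_prime_pow {p : ℕ} [hp : Fact p.Prime] {s : ℕ} (h : p = 2 → s ≠ 1) :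
    (p : ℤ) ∣ ((p ^ s).choose 2 : ℕ) := by
  rcases Nat.eq_zero_or_pos s with rfl | hs
  · simp
  norm_cast
  rcases hp.out.eq_two_or_odd' with rfl | hodd
  · have h1 := h rfl
    obtain ⟨s, rfl⟩ := Nat.exists_eq_add_of_le (show 2 ≤ s by omega)
    rw [Nat.choose_two_right]
    rw [show 2 ^ (2 + s) = 2 * (2 * 2 ^ s) by ring, mul_assoc, Nat.mul_div_cancel_left _ two_pos,
      mul_assoc]
    exact dvd_mul_right _ _
  · have h2 : 2 ∣ p ^ s - 1 := by
      obtain ⟨c, hc⟩ := hodd.pow (n := s)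
      exact ⟨c, by omega⟩
    rw [Nat.choose_two_right, Nat.mul_div_assoc _ h2]
    exact (dvd_pow_self p hs.ne').mul_right _

theorem IsReducedExponent.exists_geom_sum_add_eq {p : ℕ} [hp : Fact p.Prime] {n m r s : ℕ}
    {k x : ℤ} (hk : IsReducedExponent p n r k) (hx : ¬ (p : ℤ) ∣ x) (hsr : s < r) (hsm : s ≤ m) :
    ∃ (i : ℕ) (c : ℤ), ¬ (p : ℤ) ∣ c ∧
      ∑ j ∈ Finset.range (p ^ s), (k ^ (p ^ (m - s) * i)) ^ j + p ^ s * x * i = p ^ r * c := by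
  have hp' := Nat.prime_iff_prime_int.mp hp.out
  obtain ⟨u, hu⟩ := hk.exists_eq
  have hy : ∀ e : ℕ, ∃ y, k ^ e = 1 + p ^ r * y := fun e => by
    obtain ⟨w, hw⟩ := sub_one_dvd_pow_sub_one k e
    exact ⟨u * w, by rw [hu] at hw ⊢; linear_combination hw⟩
  have key : ∀ (i : ℕ) (y d : ℤ), k ^ (p ^ (m - s) * i) = 1 + p ^ r * y → ¬ (p : ℤ) ∣ d →
      (p : ℤ) ^ (r + 1) ∣ p ^ s + p ^ r * y * ((p ^ s).choose 2 : ℕ) + p ^ s * x * i - p ^ r * d →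
      ∃ (i : ℕ) (c : ℤ), ¬ (p : ℤ) ∣ c ∧
      ∑ j ∈ Finset.range (p ^ s), (k ^ (p ^ (m - s) * i)) ^ j + p ^ s * x * i = p ^ r * c := by
    intro i y d hi hd h
    have h1 := geom_sum_one_add_modEq (p := p) (r := r) (by omega) y (p ^ s)
    rw [← hi] at h1
    obtain ⟨w, hw⟩ := dvd_add h1 h
    refine ⟨i, d + p * w, fun hc => hd ((dvd_add_left (dvd_mul_right _ _)).mp hc), ?_⟩
    push_cast at hw
    linear_combination hw
  by_cases hcase : p = 2 ∧ s = 1 ∧ m = 1 ∧ r < n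
  · obtain ⟨rfl, rfl, rfl, hrn⟩ := hcase
    rcases hk with ⟨-, rfl⟩ | ⟨hk, -, v, hv, hv'⟩
    · omega
    obtain ⟨i, hi⟩ := exists_int_modEq_inverse hx (r + 1) (-1)
    obtain ⟨y, hy⟩ := hy (2 ^ (1 - 1) * i)
    have hp0 : ((2 : ℕ) : ℤ) ^ r ≠ 0 := by positivity
    refine key i y y hy (fun hy2 => ?_) ?_
    · have hi2 : ¬ ((2 : ℕ) : ℤ) ∣ i := fun h => by
        have h3 := dvd_sub (h.mul_right x)
          ((dvd_pow_self ((2 : ℕ) : ℤ) (show r + 1 ≠ 0 by omega)).trans hi)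
        rw [show (i : ℤ) * x - (i * x - -1) = -1 by ring, dvd_neg] at h3
        exact hp'.not_dvd_one h3
      obtain ⟨c, hc⟩ := Polynomial.powAddExpansion 1 (((2 : ℕ) : ℤ) ^ r * v) i
      rw [show 1 + ((2 : ℕ) : ℤ) ^ r * v = k by linear_combination -hv] at hc
      rw [Nat.sub_self, pow_zero, one_mul] at hy
      simp only [one_pow] at hc
      have hyv : y = i * v + c * v ^ 2 * ((2 : ℕ) : ℤ) ^ r := mul_left_cancel₀ hp0 (by
        linear_combination hc - hy)
      rw [hyv, Int.dvd_add_left ((dvd_pow_self _ (by omega)).mul_left _)] at hy2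
      exact (hp'.dvd_or_dvd hy2).elim hi2 hv'
    · obtain ⟨w, hw⟩ := hi
      refine ⟨2 * w, ?_⟩
      push_cast at hw ⊢
      norm_num
      linear_combination 2 * hw
  · obtain ⟨i, hi⟩ := exists_int_modEq_inverse hx (r + 1) (p ^ (r - s) - 1)
    obtain ⟨y, hy⟩ := hy (p ^ (m - s) * i)
    refine key i y 1 hy hp'.not_dvd_one ?_
    have hyc : (p : ℤ) ∣ y * ((p ^ s).choose 2 : ℕ) := by
      by_cases h2 : p = 2 ∧ s = 1
      · obtain ⟨rfl, rfl⟩ := h2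
        refine Dvd.dvd.mul_right ?_ _
        have hp0 : ((2 : ℕ) : ℤ) ^ r ≠ 0 := by positivity
        by_cases hrn : r = n
        · have hk1 : k = 1 := by
            rcases hk with h | h
            exacts [h.1, absurd hrn h.2.1.ne]
          rw [hk1, one_pow] at hy
          have : ((2 : ℕ) : ℤ) ^ r * y = 0 := by linear_combination -hy
          exact (mul_eq_zero.mp this).resolve_left hp0 ▸ dvd_zero _
        · obtain ⟨m, rfl⟩ := Nat.exists_eq_add_of_le (show 2 ≤ m by have := hk.le; omega)
          rw [show 2 ^ (2 + m - 1) * i = (2 ^ m * i) * 2 by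
            rw [show 2 + m - 1 = m + 1 by omega]; ring, pow_mul] at hy
          obtain ⟨c, hc⟩ := hk.isPrincipalUnit.1.trans (sub_one_dvd_pow_sub_one k (2 ^ m * i))
          obtain ⟨d, hd⟩ : ((2 : ℕ) : ℤ) ^ r ∣ k ^ (2 ^ m * i) - 1 :=
            Dvd.dvd.trans ⟨u, by linear_combination hu⟩ (sub_one_dvd_pow_sub_one k (2 ^ m * i))
          refine ⟨d * (1 + c), mul_left_cancel₀ hp0 ?_⟩
          push_cast at hc hd hy ⊢
          linear_combination -hy + (k ^ (2 ^ m * i) + 1) * hd + 2 ^ r * d * hc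
      · exact (prime_dvd_choose_two_prime_pow (by tauto)).mul_left y
    obtain ⟨w, hw⟩ := hi
    obtain ⟨z, hz⟩ := hyc
    have e : (p : ℤ) ^ r = p ^ s * p ^ (r - s) := by rw [← pow_add]; congr 1; omega
    refine ⟨z + p ^ s * w, ?_⟩
    linear_combination p ^ r * hz + p ^ s * hw - e

namespace IsMetacyclicPair

theorem isPGroup {p : ℕ} {G : Type*} [Group G] {a b : G} {n m : ℕ} {S k : ℤ}
    (h : IsMetacyclicPair a b (p ^ n) (p ^ m) S k) : IsPGroup p G :=
  IsPGroup.of_card (n := n + m) (by rw [h.card_eq, pow_add])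

theorem mul_snd {G : Type*} [Group G] {a b : G} {N M : ℕ} {S k : ℤ}
    (h : IsMetacyclicPair a b N M S k) :
    IsMetacyclicPair a (a * b) N M (∑ j ∈ Finset.range M, k ^ j + S) k := by
  refine ⟨top_le_iff.mp ?_, ?_, h.pow_left, ?_, h.card_eq⟩
  · rw [← h.closure_eq, Subgroup.closure_le]
    have ha : a ∈ Subgroup.closure {a, a * b} := Subgroup.subset_closure (by simp)
    rintro x (rfl | hx)
    · exact ha
    · rw [Set.mem_singleton_iff.mp hx]
      exact (Subgroup.mul_mem_cancel_left _ ha).mp (Subgroup.subset_closure (by simp))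
  · rw [mul_assoc, h.mul_eq, ← mul_assoc, ← mul_assoc]
    congr 1
    exact (Commute.self_zpow a k).eq
  · have := zpow_mul_pow_eq h.mul_eq 1 M
    rw [zpow_one, one_mul, h.pow_right, ← zpow_add] at this
    exact this

theorem exists_of_lt {p : ℕ} [hp : Fact p.Prime] {G : Type*} [Group G] {a b : G} {n m : ℕ}
    {S k : ℤ} (h : IsMetacyclicPair a b (p ^ n) (p ^ m) S k) (hk : IsPrincipalUnit p k)
    {s : ℕ} {x : ℤ} (hS : S = p ^ s * x) (hms : m < s) :
    ∃ x' : ℤ, ¬ (p : ℤ) ∣ x' ∧ IsMetacyclicPair a (a * b) (p ^ n) (p ^ m) (p ^ m * x') k := by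
  obtain ⟨v, hv, hpv⟩ := hk.exists_geom_sum_eq m
  obtain ⟨e, rfl⟩ := Nat.exists_eq_add_of_lt hms
  refine ⟨v + p * (p ^ e * x), fun hd => hpv ((dvd_add_left (dvd_mul_right _ _)).mp hd), ?_⟩
  convert h.mul_snd using 1
  rw [hv, hS]
  ring

variable {p : ℕ} [hp : Fact p.Prime] {G : Type*} [Group G] [Finite G] {a b : G} {n m : ℕ} {S k : ℤ}

theorem pow_snd (h : IsMetacyclicPair a b (p ^ n) (p ^ m) S k) {i : ℕ} (hi : ¬ p ∣ i) :
    IsMetacyclicPair a (b ^ i) (p ^ n) (p ^ m) (S * i) (k ^ i) := by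
  refine ⟨top_le_iff.mp ?_, ?_, h.pow_left, ?_, h.card_eq⟩
  · rw [← h.closure_eq, Subgroup.closure_le]
    rintro x (rfl | hx)
    · exact Subgroup.subset_closure (by simp)
    · rw [Set.mem_singleton_iff.mp hx]
      refine mem_of_pow_mem_of_coprime h.isPGroup _ (i := i) (by exact_mod_cast hi) ?_
      rw [zpow_natCast]
      exact Subgroup.subset_closure (by simp)
  · simpa using pow_mul_zpow_of_mul_eq h.mul_eq i 1
  · rw [← pow_mul, mul_comm, pow_mul, h.pow_right, zpow_mul, zpow_natCast]

theorem zpow_fst {S t : ℤ} (h : IsMetacyclicPair a b (p ^ n) (p ^ m) (S * t) k)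
    (ht : ¬ (p : ℤ) ∣ t) : IsMetacyclicPair (a ^ t) b (p ^ n) (p ^ m) S k := by
  refine ⟨top_le_iff.mp ?_, ?_, ?_, ?_, h.card_eq⟩
  · rw [← h.closure_eq, Subgroup.closure_le]
    rintro x (rfl | hx)
    · refine mem_of_pow_mem_of_coprime h.isPGroup _ ht ?_
      exact Subgroup.subset_closure (by simp)
    · rw [Set.mem_singleton_iff.mp hx]
      exact Subgroup.subset_closure (by simp)
  · rw [mul_zpow_of_mul_eq h.mul_eq, ← zpow_mul, mul_comm t]
  · rw [← zpow_natCast, ← zpow_mul, mul_comm, zpow_mul, zpow_natCast, h.pow_left, one_zpow]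
  · rw [h.pow_right, ← zpow_mul, mul_comm]

/-- Replacing `a` by `a * b ^ e` for a suitable `e` when `b ^ p ^ m` generates a larger subgroup
than `a ^ (k - 1)`. -/
theorem exists_swap (h : IsMetacyclicPair a b (p ^ n) (p ^ m) S k) {r s : ℕ}
    (hk : IsReducedExponent p n r k) {x : ℤ} (hS : S = p ^ s * x) (hx : ¬ (p : ℤ) ∣ x)
    (hsr : s < r) (hsm : s ≤ m) :
    ∃ (e : ℕ) (t u : ℤ), ¬ (p : ℤ) ∣ t ∧ k = 1 + p ^ r * u ∧
      IsMetacyclicPair (a * b ^ e) b (p ^ (s + (n - r))) (p ^ (m + (r - s))) (p ^ s * (t * x))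
        (1 + p ^ s * (t * u)) := by
  obtain ⟨i, c, hc, hsum⟩ := hk.exists_geom_sum_add_eq hx hsr hsm
  obtain ⟨u, hu⟩ := hk.exists_eq
  obtain ⟨t, ht⟩ := exists_int_modEq_inverse hc (n + 1) 1
  have hrn := hk.le
  have ht' : ¬ (p : ℤ) ∣ t := fun hd => by
    have h1 := dvd_sub (hd.mul_right c) ((dvd_pow_self (p : ℤ) (Nat.succ_ne_zero n)).trans ht)
    rw [sub_sub_cancel] at h1
    exact (Nat.prime_iff_prime_int.mp hp.out).not_dvd_one h1
  set e := p ^ (m - s) * i with he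
  have hpe : p ^ s * p ^ (m - s) = p ^ m := by rw [← pow_add]; congr 1; omega
  have hpow : (a * b ^ e) ^ p ^ s = a ^ ((p : ℤ) ^ r * c) := by
    have h1 := zpow_mul_pow_eq (a := a) (b := b ^ e) (k := k ^ e)
      (by simpa using pow_mul_zpow_of_mul_eq h.mul_eq e 1) 1 (p ^ s)
    rw [zpow_one, one_mul] at h1
    rw [h1, ← pow_mul, show e * p ^ s = p ^ m * i by rw [he, ← hpe]; ring, pow_mul b,
      h.pow_right, ← zpow_natCast (a ^ S), ← zpow_mul, ← zpow_add, ← hsum, hS]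
  have hpow' : ∀ w : ℤ, (a * b ^ e) ^ ((p : ℤ) ^ s * (t * w)) = a ^ ((p : ℤ) ^ r * w) := fun w => by
    rw [zpow_mul, ← Nat.cast_pow, zpow_natCast, hpow, ← zpow_mul]
    apply h.zpow_emod
    push_cast
    obtain ⟨z, hz⟩ := ht
    exact ⟨p ^ r * p * w * z, by linear_combination p ^ r * w * hz⟩
  refine ⟨e, t, u, ht', hu, top_le_iff.mp ?_, ?_, ?_, ?_, ?_⟩
  · rw [← h.closure_eq, Subgroup.closure_le]
    have hb : b ∈ Subgroup.closure {a * b ^ e, b} := Subgroup.subset_closure (by simp)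
    rintro x (rfl | hx)
    · exact (Subgroup.mul_mem_cancel_right _ (Subgroup.pow_mem _ hb e)).mp
        (Subgroup.subset_closure (by simp))
    · rw [Set.mem_singleton_iff.mp hx]
      exact hb
  · rw [add_comm 1, zpow_add, hpow', zpow_one, ← mul_assoc, h.mul_eq, ← mul_assoc (a ^ _),
      ← zpow_add_one,
      mul_assoc, mul_assoc, ← pow_succ, ← pow_succ', hu]
    congr 2
    ring
  · rw [pow_add, pow_mul, hpow, ← zpow_natCast, ← zpow_mul, h.zpow_eq_one_iff]
    push_cast
    refine ⟨c, ?_⟩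
    rw [show (p : ℤ) ^ n = p ^ r * p ^ (n - r) by rw [← pow_add]; congr 1; omega]
    ring
  · rw [pow_add, pow_mul, h.pow_right, hpow', ← zpow_natCast, ← zpow_mul, hS]
    congr 1
    push_cast
    rw [show (p : ℤ) ^ r = p ^ s * p ^ (r - s) by rw [← pow_add]; congr 1; omega]
    ring
  · rw [h.card_eq, ← pow_add, ← pow_add]
    congr 1
    omega

end IsMetacyclicPair

/-- The normal form of the metacyclic `p`-groups on which `b` acts by a principal unit. -/
structure IsOrdinaryPair {G : Type*} [Group G] (p : ℕ) (a b : G) (n m r s : ℕ) : Prop where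
  pair : IsMetacyclicPair a b (p ^ n) (p ^ m) (p ^ s) (1 + p ^ r)
  r_le_s : r ≤ s
  s_le_m : s ≤ m
  s_le_n : s ≤ n
  two_le : p = 2 → 2 ≤ r ∨ r = n

namespace IsMetacyclicPair

variable {p : ℕ} [hp : Fact p.Prime] {G : Type*} [Group G] [Finite G] {a b : G} {n m : ℕ} {S k : ℤ}

theorem exists_isOrdinaryPair (h : IsMetacyclicPair a b (p ^ n) (p ^ m) S k) {r s : ℕ} {x : ℤ}
    (hk : IsReducedExponent p n r k) (hS : S = p ^ s * x) (hx : ¬ (p : ℤ) ∣ x) (hrs : r ≤ s)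
    (hsm : s ≤ m) (hsn : s ≤ n) : ∃ a b : G, IsOrdinaryPair p a b n m r s := by
  rcases hk with ⟨rfl, rfl⟩ | ⟨hk, hrn, u, hu, hpu⟩
  · refine ⟨a ^ x, b, ?_, hrs, hsm, hsn, fun _ => Or.inr rfl⟩
    refine zpow_fst (h.congr (hS ▸ by simp) ?_) hx
    exact ⟨-1, by push_cast; ring⟩
  · obtain ⟨i, hi, hmod⟩ := hk.exists_pow_modEq (u' := 1) hu hpu
      (Nat.prime_iff_prime_int.mp hp.out).not_dvd_one (n - r)
    refine ⟨a ^ (x * i), b ^ i, ?_, hrs, hsm, hsn, ?_⟩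
    · refine zpow_fst ((h.pow_snd hi).congr ?_ ?_) ?_
      · rw [hS, mul_assoc, sub_self]
        exact dvd_zero _
      · rw [mul_one] at hmod
        push_cast
        exact (pow_dvd_pow _ (by omega)).trans hmod
      · intro hd
        exact ((Nat.prime_iff_prime_int.mp hp.out).dvd_or_dvd hd).elim hx
          (fun h => hi (by exact_mod_cast h))
    · rintro rfl
      left
      by_contra hr
      have h4 := hk.2 rfl
      rw [hu] at h4
      obtain rfl | rfl : r = 0 ∨ r = 1 := by omega
      · push_cast at h4 hpu
        omega
      · push_cast at h4 hpu
        omega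

theorem exists_isOrdinaryPair_or_of_le (h : IsMetacyclicPair a b (p ^ n) (p ^ m) S k) {r s : ℕ}
    {x : ℤ} (hk : IsReducedExponent p n r k) (hS : S = p ^ s * x) (hx : ¬ (p : ℤ) ∣ x)
    (hsm : s ≤ m) (hsn : s ≤ n) :
    (∃ (a b : G) (n m r s : ℕ), IsOrdinaryPair p a b n m r s) ∨ p = 2 ∧
      ∃ (a b : G) (n m : ℕ) (S k : ℤ), IsMetacyclicPair a b (2 ^ n) (2 ^ m) S k ∧ 2 ≤ n ∧
        4 ∣ k + 1 := by
  rcases le_or_gt r s with hrs | hsr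
  · obtain ⟨a, b, h'⟩ := h.exists_isOrdinaryPair hk hS hx hrs hsm hsn
    exact Or.inl ⟨a, b, _, _, _, _, h'⟩
  obtain ⟨e, t, u, ht, hu, h'⟩ := h.exists_swap hk hS hx hsr hsm
  have htx : ¬ (p : ℤ) ∣ t * x := fun hd =>
    ((Nat.prime_iff_prime_int.mp hp.out).dvd_or_dvd hd).elim ht hx
  rcases hk with ⟨rfl, rfl⟩ | ⟨hk, hrn, v, hv, hpv⟩
  · left
    have hu0 : u = 0 := by
      have h1 : (p : ℤ) ^ r * u = 0 := by linear_combination -hu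
      exact (mul_eq_zero.mp h1).resolve_left (pow_ne_zero _ (by exact_mod_cast hp.out.ne_zero))
    subst hu0
    obtain ⟨a', b', h''⟩ := h'.exists_isOrdinaryPair (r := s) (s := s)
      (Or.inl ⟨by ring, by omega⟩) rfl htx le_rfl (by omega) (by omega)
    exact ⟨a', b', _, _, _, _, h''⟩
  · have hp0 : ∀ e, (p : ℤ) ^ e ≠ 0 := fun e => pow_ne_zero _ (by exact_mod_cast hp.out.ne_zero)
    obtain rfl : u = v := mul_left_cancel₀ (hp0 r) (by linear_combination hv - hu)
    have hs : s ≠ 0 := by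
      rintro rfl
      obtain ⟨c, hc⟩ := h.dvd_mul_sub_one
      rw [hS, hv] at hc
      push_cast at hc
      rw [show (p : ℤ) ^ n = p ^ r * p ^ (n - r) by rw [← pow_add]; congr 1; omega] at hc
      have h1 : u * x = p ^ (n - r) * c := mul_left_cancel₀ (hp0 r) (by linear_combination hc)
      exact ((Nat.prime_iff_prime_int.mp hp.out).dvd_or_dvd
        (h1 ▸ (dvd_pow_self (p : ℤ) (by omega)).mul_right c)).elim hpv hx
    have htu : ¬ (p : ℤ) ∣ t * u := fun hd =>
      ((Nat.prime_iff_prime_int.mp hp.out).dvd_or_dvd hd).elim ht hpv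
    by_cases h2 : p = 2 ∧ s = 1
    · right
      obtain ⟨rfl, rfl⟩ := h2
      refine ⟨rfl, _, _, _, _, _, _, h', by omega, ?_⟩
      push_cast at htu
      omega
    · left
      have hk' : IsPrincipalUnit p (1 + p ^ s * (t * u)) := by
        rw [IsPrincipalUnit, add_sub_cancel_left]
        refine ⟨(dvd_pow_self _ hs).mul_right _, ?_⟩
        rintro rfl
        exact (pow_dvd_pow (2 : ℤ) (show 2 ≤ s by omega)).mul_right _
      obtain ⟨a', b', h''⟩ := h'.exists_isOrdinaryPair (r := s) (s := s)
        (Or.inr ⟨hk', by omega, _, by ring, htu⟩) rfl htx le_rfl (by omega) (by omega)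
      exact ⟨a', b', _, _, _, _, h''⟩

theorem exists_isOrdinaryPair_or_of_isPrincipalUnit (h : IsMetacyclicPair a b (p ^ n) (p ^ m) S k)
    (hk : IsPrincipalUnit p k) :
    (∃ (a b : G) (n m r s : ℕ), IsOrdinaryPair p a b n m r s) ∨ p = 2 ∧
      ∃ (a b : G) (n m : ℕ) (S k : ℤ), IsMetacyclicPair a b (2 ^ n) (2 ^ m) S k ∧ 2 ≤ n ∧
        4 ∣ k + 1 := by
  obtain ⟨r, k', hkk, hk'⟩ := hk.exists_isReducedExponent n
  obtain ⟨s, x, hsn, hx, hS⟩ := exists_pow_mul_sub_of_int (p := p) n S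
  replace h := h.congr (by exact_mod_cast hS) (by exact_mod_cast hkk)
  rcases le_or_gt s m with hsm | hms
  · exact h.exists_isOrdinaryPair_or_of_le hk' rfl hx hsm hsn
  · obtain ⟨x', hx', h'⟩ := h.exists_of_lt hk'.isPrincipalUnit rfl hms
    exact h'.exists_isOrdinaryPair_or_of_le hk' rfl hx' le_rfl (by omega)

end IsMetacyclicPair

theorem IsMetacyclic.exists_isOrdinaryPair_or {p : ℕ} [hp : Fact p.Prime] {G : Type*} [Group G]
    [Finite G] (hG : IsPGroup p G) (hmc : IsMetacyclic G) :
    (∃ (a b : G) (n m r s : ℕ), IsOrdinaryPair p a b n m r s) ∨ p = 2 ∧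
      ∃ (a b : G) (n m : ℕ) (S k : ℤ), IsMetacyclicPair a b (2 ^ n) (2 ^ m) S k ∧ 2 ≤ n ∧
        4 ∣ k + 1 := by
  obtain ⟨a, b, n, m, S, k, h⟩ := hmc.exists_isMetacyclicPair hG
  by_cases h1 : ((p ^ n : ℕ) : ℤ) ∣ k - 1
  · exact (h.congr (S' := S) (k' := 1) (by simp) h1).exists_isOrdinaryPair_or_of_isPrincipalUnit
      ⟨by simp, by simp⟩
  have hn : n ≠ 0 := by
    rintro rfl
    simp at h1
  have hpk : (p : ℤ) ∣ k - 1 := by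
    refine prime_dvd_sub_one_of_dvd_pow (m := m) (dvd_trans ?_ h.dvd_pow_sub_one)
    push_cast
    exact dvd_pow_self _ hn
  by_cases h2 : IsPrincipalUnit p k
  · exact h.exists_isOrdinaryPair_or_of_isPrincipalUnit h2
  · obtain ⟨rfl, h4⟩ : p = 2 ∧ ¬ (4 : ℤ) ∣ k - 1 := by
      by_contra hc
      exact h2 ⟨hpk, fun h => by tauto⟩
    refine Or.inr ⟨rfl, a, b, n, m, S, k, h, ?_, ?_⟩
    · by_contra hlt
      obtain rfl : n = 1 := by omega
      exact h1 (by simpa using hpk)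
    · push_cast at hpk
      omega

namespace IsMetacyclicPair

variable {p : ℕ} [hp : Fact p.Prime] {G : Type*} [Group G] [Finite G] {a b : G} {n m : ℕ} {S k : ℤ}

theorem card_abelianization_eq (h : IsMetacyclicPair a b (p ^ n) (p ^ m) S k) {r : ℕ} (hr : r ≤ n)
    (hc : commutator G = Subgroup.zpowers (a ^ p ^ r)) :
    Nat.card (Abelianization G) = p ^ (m + r) := by
  have h1 := Subgroup.card_mul_index (commutator G)
  have h2 : Nat.card (commutator G) = p ^ (n - r) := by
    rw [hc, Nat.card_zpowers, orderOf_pow, h.orderOf_eq,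
      Nat.gcd_eq_right (pow_dvd_pow p hr), Nat.pow_div hr hp.out.pos]
  rw [h2, h.card_eq] at h1
  have h3 : p ^ (n - r) * p ^ (m + r) = p ^ n * p ^ m := by
    rw [← pow_add, ← pow_add]
    congr 1
    omega
  exact Nat.eq_of_mul_eq_mul_left (pow_pos hp.out.pos _) (h1.trans h3.symm)

theorem le_of_forall_pow_mem_commutator (h : IsMetacyclicPair a b (p ^ n) (p ^ m) S k) {e : ℕ}
    (he : ∀ g : G, g ^ p ^ e ∈ commutator G) : m ≤ e := by
  have h1 := he b
  rw [h.commutator_eq] at h1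
  have h2 : b ^ p ^ e ∈ Subgroup.zpowers a :=
    Subgroup.zpowers_le.mpr (Subgroup.zpow_mem _ (Subgroup.mem_zpowers a) _) h1
  rw [h.pow_mem_zpowers_iff] at h2
  exact (Nat.pow_dvd_pow_iff_le_right hp.out.one_lt).mp h2

theorem pow_mem_commutator {N M e : ℕ} (h : IsMetacyclicPair a b N M S k)
    (ha : a ^ e ∈ commutator G) (hb : b ^ e ∈ commutator G) (g : G) : g ^ e ∈ commutator G := by
  obtain ⟨i, j, -, -, rfl⟩ := h.exists_eq g
  rw [← Abelianization.ker_of, MonoidHom.mem_ker] at *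
  rw [map_pow] at ha hb
  rw [map_pow, map_mul, mul_pow, map_pow, map_pow, pow_right_comm, ha, pow_right_comm, hb, one_pow,
    one_pow, one_mul]

theorem le_of_forall_pow_eq_one {s : ℕ} (h : IsMetacyclicPair a b (p ^ n) (p ^ m) (p ^ s) k)
    {e : ℕ} (he : ∀ g : G, g ^ p ^ e = 1) : m + n ≤ s + e := by
  have h1 := he b
  have h2 : m ≤ e := h.le_of_forall_pow_mem_commutator fun g => he g ▸ one_mem _
  obtain ⟨d, rfl⟩ := Nat.exists_eq_add_of_le h2
  rw [pow_add, pow_mul, h.pow_right, ← zpow_natCast, ← zpow_mul, h.zpow_eq_one_iff] at h1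
  have h3 : p ^ n ∣ p ^ (s + d) := by
    rw [pow_add]
    exact_mod_cast h1
  have := (Nat.pow_dvd_pow_iff_le_right hp.out.one_lt).mp h3
  omega

theorem pow_eq_one {s : ℕ} (h : IsMetacyclicPair a b (p ^ n) (p ^ m) (p ^ s) k) (hsn : s ≤ n)
    (hsm : s ≤ m) (g : G) : g ^ p ^ (m + (n - s)) = 1 := by
  obtain ⟨i, j, -, -, rfl⟩ := h.exists_eq g
  have h1 := zpow_mul_pow_eq (a := a) (b := b ^ j) (k := k ^ j)
      (by simpa using pow_mul_zpow_of_mul_eq h.mul_eq j 1) i (p ^ m)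
  rw [zpow_natCast] at h1
  rw [pow_add, pow_mul, h1, ← pow_mul, mul_comm j, pow_mul b, h.pow_right, ← zpow_natCast (a ^ _) j,
    ← zpow_mul, ← zpow_add, ← zpow_natCast, ← zpow_mul, h.zpow_eq_one_iff]
  rcases Nat.eq_zero_or_pos n with rfl | hn
  · simp
  have hk : (p : ℤ) ∣ k - 1 := by
    refine prime_dvd_sub_one_of_dvd_pow (m := m) (dvd_trans ?_ h.dvd_pow_sub_one)
    push_cast
    exact dvd_pow_self _ hn.ne'
  obtain ⟨w, hw⟩ := prime_pow_dvd_geom_sum (hk.trans (sub_one_dvd_pow_sub_one k j)) m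
  rw [hw]
  have e1 : (p : ℤ) ^ n = p ^ s * p ^ (n - s) := by rw [← pow_add]; congr 1; omega
  have e2 : (p : ℤ) ^ m = p ^ s * p ^ (m - s) := by rw [← pow_add]; congr 1; omega
  push_cast
  rw [e1, e2]
  exact ⟨i * p ^ (m - s) * w + j, by ring⟩

end IsMetacyclicPair

namespace IsOrdinaryPair

theorem r_le_n {p : ℕ} {G : Type*} [Group G] {a b : G} {n m r s : ℕ}
    (h : IsOrdinaryPair p a b n m r s) : r ≤ n := h.r_le_s.trans h.s_le_n

theorem commutator_eq {p : ℕ} {G : Type*} [Group G] [Finite G] {a b : G} {n m r s : ℕ}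
    (h : IsOrdinaryPair p a b n m r s) :
    commutator G = Subgroup.zpowers (a ^ p ^ r) := by
  rw [h.pair.commutator_eq, add_sub_cancel_left, ← Nat.cast_pow, zpow_natCast]

theorem pow_mem_commutator {p : ℕ} {G : Type*} [Group G] [Finite G] {a b : G} {n m r s : ℕ}
    (h : IsOrdinaryPair p a b n m r s) (g : G) : g ^ p ^ m ∈ commutator G := by
  have ha : ∀ e, r ≤ e → a ^ p ^ e ∈ commutator G := fun e he => by
    obtain ⟨d, rfl⟩ := Nat.exists_eq_add_of_le he
    rw [h.commutator_eq, pow_add, pow_mul]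
    exact Subgroup.pow_mem _ (Subgroup.mem_zpowers _) _
  refine h.pair.pow_mem_commutator (ha m (h.r_le_s.trans h.s_le_m)) ?_ g
  rw [h.pair.pow_right, ← Nat.cast_pow, zpow_natCast]
  exact ha s h.r_le_s

variable {p : ℕ} [hp : Fact p.Prime] {G : Type*} [Group G] [Finite G] {a b : G} {n m r s : ℕ}

theorem card_abelianization_eq (h : IsOrdinaryPair p a b n m r s) :
    Nat.card (Abelianization G) = p ^ (m + r) :=
  h.pair.card_abelianization_eq h.r_le_n h.commutator_eq

theorem nonempty_mulEquiv_of_algEquiv {F : Type*} [Field F] [CharP F p] {H : Type*} [Group H]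
    [Finite H] {a' b' : H} {n' m' r' s' : ℕ} (h : IsOrdinaryPair p a b n m r s)
    (h' : IsOrdinaryPair p a' b' n' m' r' s') (φ : MonoidAlgebra F G ≃ₐ[F] MonoidAlgebra F H) :
    Nonempty (G ≃* H) := by
  have hinj := Nat.pow_right_injective hp.out.two_le
  have h1 := Nat.card_eq_of_monoidAlgebra_linearEquiv φ.toLinearEquiv
  rw [h.pair.card_eq, h'.pair.card_eq, ← pow_add, ← pow_add] at h1
  have h2 := card_abelianization_eq_of_algEquiv φ
  rw [h.card_abelianization_eq, h'.card_abelianization_eq] at h2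
  replace h1 := hinj h1
  replace h2 := hinj h2
  have h3 := h'.pair.le_of_forall_pow_mem_commutator
    (pow_mem_commutator_of_algEquiv φ h.pow_mem_commutator)
  have h4 := h.pair.le_of_forall_pow_mem_commutator
    (pow_mem_commutator_of_algEquiv φ.symm h'.pow_mem_commutator)
  obtain rfl : m = m' := by omega
  obtain rfl : n = n' := by omega
  obtain rfl : r = r' := by omega
  have h5 := h'.pair.le_of_forall_pow_eq_one
    (pow_eq_one_of_algEquiv φ (h.pair.pow_eq_one h.s_le_n h.s_le_m))
  have h6 := h.pair.le_of_forall_pow_eq_one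
    (pow_eq_one_of_algEquiv φ.symm (h'.pair.pow_eq_one h'.s_le_n h'.s_le_m))
  have h7 := h.s_le_n
  have h8 := h'.s_le_n
  obtain rfl : s = s' := by omega
  exact h.pair.nonempty_mulEquiv h'.pair

end IsOrdinaryPair

/-- The normal form of the metacyclic `2`-groups on which `b` does not act by a principal unit. -/
structure IsExceptionalPair {G : Type*} [Group G] (a b : G) (n m l ε : ℕ) : Prop where
  pair : IsMetacyclicPair a b (2 ^ n) (2 ^ m) (2 ^ (n - 1) * ε) (2 ^ l - 1)
  two_le : 2 ≤ l
  l_le_n : l ≤ n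
  one_le : 1 ≤ m
  n_le : n ≤ l + m
  eps_le : ε ≤ 1
  n_ne_add : ε = 1 → n ≠ l + m
  n_ne_succ : ε = 1 → 2 ≤ m → n ≠ l + 1

theorem exists_two_pow_sub_one_pow_eq {l : ℕ} (hl : 2 ≤ l) {m : ℕ} (hm : 1 ≤ m) :
    ∃ v : ℤ, ((2 : ℤ) ^ l - 1) ^ 2 ^ m = 1 + 2 ^ (l + m) * v ∧ ¬ (2 : ℤ) ∣ v := by
  have hk : IsPrincipalUnit 2 (1 - 2 ^ l) := by
    rw [IsPrincipalUnit, sub_sub_cancel_left]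
    exact ⟨(dvd_pow_self _ (by omega)).neg_right,
      fun _ => Dvd.dvd.neg_right (pow_dvd_pow (2 : ℤ) hl)⟩
  obtain ⟨v, hv, hv2⟩ := hk.exists_pow_eq (p := 2) (r := l) (u := -1) (by push_cast; ring)
    (by norm_num) m
  refine ⟨v, ?_, hv2⟩
  have he : Even (2 ^ m) := Nat.even_pow.mpr ⟨even_two, by omega⟩
  rw [← neg_sub, he.neg_pow]
  exact_mod_cast hv

theorem exists_geom_sum_two_pow_sub_one_eq {l : ℕ} (hl : 2 ≤ l) {m : ℕ} (hm : 1 ≤ m) :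
    ∃ v : ℤ, ∑ j ∈ Finset.range (2 ^ m), ((2 : ℤ) ^ l - 1) ^ j = 2 ^ (l + m - 1) * v ∧
      ¬ (2 : ℤ) ∣ v := by
  obtain ⟨v, hv, hv2⟩ := exists_two_pow_sub_one_pow_eq hl hm
  have h1 := geom_sum_mul ((2 : ℤ) ^ l - 1) (2 ^ m)
  obtain ⟨l, rfl⟩ := Nat.exists_eq_add_of_le hl
  have h2 : (∑ j ∈ Finset.range (2 ^ m), ((2 : ℤ) ^ (2 + l) - 1) ^ j) * (2 ^ (l + 1) - 1) =
      2 ^ (l + m + 1) * v := by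
    refine mul_left_cancel₀ (two_ne_zero (α := ℤ)) ?_
    rw [hv] at h1
    linear_combination h1
  have hodd : IsCoprime ((2 : ℤ) ^ (l + m + 1)) (2 ^ (l + 1) - 1) :=
    IsCoprime.pow_left ⟨2 ^ l, -1, by ring⟩
  obtain ⟨w, hw⟩ := hodd.dvd_of_dvd_mul_right (Dvd.intro v h2.symm)
  refine ⟨w, by rw [hw]; congr 2; omega, fun ⟨c, hc⟩ => hv2 ⟨c * (2 ^ (l + 1) - 1), ?_⟩⟩
  rw [hw, hc] at h2
  exact mul_left_cancel₀ (pow_ne_zero (l + m + 1) (two_ne_zero (α := ℤ)))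
      (by linear_combination -h2)

namespace IsMetacyclicPair

/-- Replacing `b` by `a * b` changes `b ^ 2 ^ m` if `b ^ 2 ^ m` acts on `a` with the largest
possible order. -/
theorem eps_eq_zero_of_eq_add {G : Type*} [Group G] {a b : G} {n m l : ℕ}
    (h : IsMetacyclicPair a b (2 ^ n) (2 ^ m) (2 ^ (n - 1)) (2 ^ l - 1))
    (hl : 2 ≤ l) (hm : 1 ≤ m) (hn : n = l + m) :
    IsMetacyclicPair a (a * b) (2 ^ n) (2 ^ m) (2 ^ (n - 1) * (0 : ℕ)) (2 ^ l - 1) := by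
  obtain ⟨v, hv, hv2⟩ := exists_geom_sum_two_pow_sub_one_eq hl hm
  refine h.mul_snd.congr ?_ (by simp)
  rw [hv, hn]
  refine ⟨(v + 1) / 2, ?_⟩
  have h2 : 2 * ((v + 1) / 2) = v + 1 := by omega
  obtain ⟨d, hd⟩ : ∃ d, l + m = d + 1 := ⟨l + m - 1, by omega⟩
  rw [hd, Nat.add_sub_cancel]
  push_cast
  linear_combination -2 ^ d * h2

/-- Replacing `a` by `a * b ^ 2 ^ (m - 1)` turns an action by `2 ^ (n - 1) - 1` into the action
by `-1` if `b ^ 2 ^ m` is the involution in `zpowers a`. -/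
theorem mul_pow_fst {G : Type*} [Group G] {a b : G} {n m : ℕ}
    (h : IsMetacyclicPair a b (2 ^ n) (2 ^ m) (2 ^ (n - 1)) (2 ^ (n - 1) - 1))
    (hn : 3 ≤ n) (hm : 2 ≤ m) :
    IsMetacyclicPair (a * b ^ 2 ^ (m - 1)) b (2 ^ n) (2 ^ m) (2 ^ (n - 1)) (2 ^ n - 1) := by
  set c := b ^ 2 ^ (m - 1) with hc
  obtain ⟨v, hv, -⟩ := exists_two_pow_sub_one_pow_eq (l := n - 1) (by omega) (m := m - 1) (by omega)
  have hcomm : Commute a c := by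
    have h1 := pow_mul_zpow_of_mul_eq h.mul_eq (2 ^ (m - 1)) 1
    rw [zpow_one, hv, mul_one, h.zpow_emod (j := 1), zpow_one] at h1
    · exact h1.symm
    · refine ⟨2 ^ (m - 2) * v, ?_⟩
      rw [show n - 1 + (m - 1) = n + (m - 2) by omega]
      push_cast
      ring
  have hc2 : c ^ 2 = a ^ 2 ^ (n - 1) := by
    rw [hc, ← pow_mul, ← pow_succ, Nat.sub_add_cancel (by omega), h.pow_right]
    exact_mod_cast zpow_natCast a _
  have h4 : (a * c) ^ 4 = a ^ 4 := by
    rw [hcomm.mul_pow, show 4 = 2 * 2 by rfl, pow_mul c, hc2, ← pow_mul (a) (2 ^ _), ← pow_succ,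
      Nat.sub_add_cancel (by omega), h.pow_left, mul_one]
  have h4' : ∀ j, (a * c) ^ 2 ^ (2 + j) = a ^ 2 ^ (2 + j) := fun j => by
    rw [pow_add, pow_mul, pow_mul]
    exact congrArg (· ^ 2 ^ j) h4
  obtain ⟨n, rfl⟩ := Nat.exists_eq_add_of_le hn
  have e1 : 3 + n - 1 = 2 + n := by omega
  have hN : (a * c) ^ 2 ^ (3 + n) = 1 := by
    rw [← h.pow_left, show 3 + n = 2 + (1 + n) by omega, h4']
  have hb : c ∈ Subgroup.closure {a * c, b} :=
    Subgroup.pow_mem _ (Subgroup.subset_closure (by simp)) _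
  refine ⟨top_le_iff.mp ?_, ?_, hN, ?_, h.card_eq⟩
  · rw [← h.closure_eq, Subgroup.closure_le]
    rintro x (rfl | hx)
    · exact (Subgroup.mul_mem_cancel_right _ hb).mp (Subgroup.subset_closure (by simp))
    · rw [Set.mem_singleton_iff.mp hx]
      exact Subgroup.subset_closure (by simp)
  · have e2 : (a * c) ^ ((2 : ℤ) ^ (3 + n) - 1) = a⁻¹ * c⁻¹ := by
      have : (2 : ℤ) ^ (3 + n) = ((2 ^ (3 + n) : ℕ) : ℤ) := by push_cast; rfl
      rw [zpow_sub_one, this, zpow_natCast, hN, one_mul, hcomm.eq, mul_inv_rev]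
    have e3 : a ^ ((2 : ℤ) ^ (3 + n - 1) - 1) = a⁻¹ * c⁻¹ * c⁻¹ := by
      have e4 : c ^ 2 * c ^ 2 = 1 := by
        rw [hc2, ← pow_add, ← two_mul, ← pow_succ', Nat.sub_add_cancel (by omega), h.pow_left]
      have e5 : (2 : ℤ) ^ (3 + n - 1) = ((2 ^ (3 + n - 1) : ℕ) : ℤ) := by push_cast; rfl
      rw [zpow_sub_one, e5, zpow_natCast, ← hc2, mul_assoc, ← mul_inv_rev, ← pow_two,
        ← eq_inv_of_mul_eq_one_left e4]
      exact ((hcomm.inv_left).pow_right 2).eq.symm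
    rw [e2, ← mul_assoc, h.mul_eq, e3]
    have hbc : b * c = c * b := by rw [hc, ← pow_succ, pow_succ']
    rw [mul_assoc _ b, hbc, ← mul_assoc, inv_mul_cancel_right]
  · rw [h.pow_right, e1, show ((2 : ℤ) ^ (2 + n)) = ((2 ^ (2 + n) : ℕ) : ℤ) by push_cast; rfl,
      zpow_natCast, zpow_natCast, h4']

variable {G : Type*} [Group G] [Finite G] {a b : G} {n m : ℕ}

theorem exists_eps {S k : ℤ} (h : IsMetacyclicPair a b (2 ^ n) (2 ^ m) S k) (hn : 2 ≤ n)
    (hk : 4 ∣ k + 1) : ∃ ε : ℕ, ε ≤ 1 ∧ IsMetacyclicPair a b (2 ^ n) (2 ^ m)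
        (2 ^ (n - 1) * ε) k := by
  obtain ⟨c, hc⟩ := hk
  have h1 := h.dvd_mul_sub_one
  obtain ⟨n, rfl⟩ := Nat.exists_eq_add_of_le (show 1 ≤ n by omega)
  have h2 : (2 : ℤ) ^ n ∣ (2 * c - 1) * S := by
    obtain ⟨d, hd⟩ := h1
    refine ⟨d, mul_left_cancel₀ (two_ne_zero (α := ℤ)) ?_⟩
    rw [show k = 4 * c - 1 by linear_combination hc] at hd
    push_cast at hd
    linear_combination hd
  have hodd : IsCoprime ((2 : ℤ) ^ n) (2 * c - 1) := IsCoprime.pow_left ⟨c, -1, by ring⟩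
  obtain ⟨w, rfl⟩ := hodd.dvd_of_dvd_mul_left h2
  refine ⟨(w % 2).toNat, by omega, h.congr ?_ (by simp)⟩
  rw [Int.toNat_of_nonneg (by omega), Nat.add_sub_cancel_left]
  refine ⟨w / 2, ?_⟩
  have := Int.emod_add_mul_ediv w 2
  push_cast
  linear_combination -2 ^ n * this

theorem exists_two_pow_sub_one {k : ℤ} {ε : ℕ}
    (h : IsMetacyclicPair a b (2 ^ n) (2 ^ m) (2 ^ (n - 1) * ε) k) (hn : 2 ≤ n) (hk : 4 ∣ k + 1) :
    ∃ (b : G) (l : ℕ), 2 ≤ l ∧ l ≤ n ∧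
      IsMetacyclicPair a b (2 ^ n) (2 ^ m) (2 ^ (n - 1) * ε) (2 ^ l - 1) := by
  have hk' : IsPrincipalUnit 2 (-k) := by
    refine ⟨?_, fun _ => ?_⟩
    · push_cast
      omega
    · omega
  obtain ⟨l, k', hkk, hk'⟩ := hk'.exists_isReducedExponent n
  have hkk' : ((2 ^ n : ℕ) : ℤ) ∣ k - -k' := by
    obtain ⟨c, hc⟩ := hkk
    exact ⟨-c, by push_cast at hc ⊢; linear_combination -hc⟩
  rcases hk' with ⟨rfl, rfl⟩ | ⟨hk', hln, u, hu, hu2⟩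
  · refine ⟨b, l, hn, le_rfl, h.congr (S' := 2 ^ (l - 1) * ε) (by simp) ?_⟩
    obtain ⟨c, hc⟩ := hkk'
    exact ⟨c - 1, by push_cast at hc ⊢; linear_combination hc⟩
  · obtain ⟨i, hi, c, hc⟩ := hk'.exists_pow_modEq (u' := -1) hu hu2 (by norm_num) (n - l)
    have hodd : Odd i := by
      rw [← Nat.not_even_iff_odd, even_iff_two_dvd]
      exact hi
    refine ⟨b ^ i, l, ?_, hln.le, ((h.congr (S' := 2 ^ (n - 1) * ε) (by simp) hkk').pow_snd
        hi).congr ?_ ?_⟩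
    · by_contra hl
      have h4 := hk'.2 rfl
      rw [hu] at h4
      obtain rfl | rfl : l = 0 ∨ l = 1 := by omega
      · push_cast at h4 hu2
        omega
      · push_cast at h4 hu2
        omega
    · obtain ⟨j, rfl⟩ := hodd
      obtain ⟨n, rfl⟩ := Nat.exists_eq_add_of_le hn
      rw [show 2 + n - 1 = n + 1 by omega]
      refine ⟨ε * j, ?_⟩
      push_cast
      ring
    · rw [hodd.neg_pow]
      rw [show l + 1 + (n - l) = n + 1 by omega] at hc
      refine ⟨-2 * c, ?_⟩
      push_cast at hc ⊢
      linear_combination -hc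

end IsMetacyclicPair

theorem IsMetacyclicPair.exists_isExceptionalPair {G : Type*} [Group G] [Finite G] {a b : G}
    {n m : ℕ} {S k : ℤ} (h : IsMetacyclicPair a b (2 ^ n) (2 ^ m) S k) (hn : 2 ≤ n)
    (hk : 4 ∣ k + 1) : ∃ (a b : G) (n m l ε : ℕ), IsExceptionalPair a b n m l ε := by
  have hm : 1 ≤ m := by
    by_contra hm
    obtain rfl : m = 0 := by omega
    have h1 := (pow_dvd_pow (2 : ℤ) hn).trans (by simpa using h.dvd_pow_sub_one)
    omega
  obtain ⟨ε, hε, h⟩ := h.exists_eps hn hk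
  obtain ⟨b, l, hl, hln, h⟩ := h.exists_two_pow_sub_one hn hk
  have hnlm : n ≤ l + m := by
    obtain ⟨v, hv, hv2⟩ := exists_two_pow_sub_one_pow_eq hl hm
    have h1 := h.dvd_pow_sub_one
    rw [hv, add_sub_cancel_left] at h1
    push_cast at h1
    by_contra hlt
    obtain ⟨d, rfl⟩ := Nat.exists_eq_add_of_lt (not_le.mp hlt)
    obtain ⟨w, hw⟩ := h1
    exact hv2 ⟨2 ^ d * w, mul_left_cancel₀ (pow_ne_zero (l + m) (two_ne_zero (α := ℤ))) (by
      rw [hw]; ring)⟩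
  by_cases hε1 : ε = 1
  · subst hε1
    rw [Nat.cast_one, mul_one] at h
    by_cases h1 : n = l + m
    · exact ⟨_, _, n, m, l, 0, h.eps_eq_zero_of_eq_add hl hm h1, hl, hln, hm, hnlm, zero_le_one,
        by simp, by simp⟩
    by_cases h2 : 2 ≤ m ∧ n = l + 1
    · obtain ⟨h2, rfl⟩ := h2
      refine ⟨a * b ^ 2 ^ (m - 1), b, l + 1, m, l + 1, 1, ?_, by omega, le_rfl, hm, by omega,
          le_rfl, by omega,
        by omega⟩
      rw [Nat.cast_one, mul_one]
      exact h.mul_pow_fst (by omega) h2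
    · refine ⟨a, b, n, m, l, 1, ?_, hl, hln, hm, hnlm, le_rfl, fun _ => h1, fun _ h => by tauto⟩
      rwa [Nat.cast_one, mul_one]
  · exact ⟨a, b, n, m, l, ε, h, hl, hln, hm, hnlm, hε, fun h => absurd h hε1,
      fun h => absurd h hε1⟩

namespace IsExceptionalPair

theorem dvd_pow_sub_one_iff {n l d j : ℕ} (hl : 2 ≤ l) (hln : l ≤ n) (hd : d = max 1 (n - l)) :
    (2 : ℤ) ^ n ∣ (2 ^ l - 1) ^ j - 1 ↔ 2 ^ d ∣ j := by
  have e : ∀ i : ℕ, (((2 ^ l - 1 : ℤ) : ZMod (2 ^ n)) ^ i = 1 ↔ (2 : ℤ) ^ n ∣ (2 ^ l - 1) ^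
      i - 1) :=
    fun i => by
      have := ZMod.intCast_zmod_eq_zero_iff_dvd (((2 : ℤ) ^ l - 1) ^ i - 1) (2 ^ n)
      rw [Int.cast_sub, Int.cast_pow, Int.cast_one, sub_eq_zero] at this
      rw [this]
      push_cast
      rfl
  obtain ⟨d, rfl⟩ : ∃ d', d = d' + 1 := ⟨d - 1, by omega⟩
  have ho : orderOf ((2 ^ l - 1 : ℤ) : ZMod (2 ^ n)) = 2 ^ (d + 1) := by
    refine orderOf_eq_prime_pow ?_ ?_
    · rw [e]
      rcases Nat.eq_zero_or_pos d with rfl | hd0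
      · intro h
        rw [pow_zero, pow_one] at h
        have h1 := (pow_dvd_pow (2 : ℤ) (hl.trans hln)).trans h
        have h2 := pow_dvd_pow (2 : ℤ) hl
        omega
      · obtain ⟨v, hv, hv2⟩ := exists_two_pow_sub_one_pow_eq hl hd0
        rw [hv, add_sub_cancel_left, show n = l + d + 1 by omega, pow_succ,
          mul_dvd_mul_iff_left (by positivity)]
        exact hv2
    · rw [e]
      obtain ⟨v, hv, hv2⟩ := exists_two_pow_sub_one_pow_eq hl (Nat.succ_pos d)
      rw [hv, add_sub_cancel_left]
      exact (pow_dvd_pow 2 (by omega)).mul_right v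
  rw [← e, ← orderOf_dvd_iff_pow_eq_one, ho]

variable {G : Type*} [Group G] [Finite G] {a b : G} {n m l ε : ℕ}

theorem commutator_eq (h : IsExceptionalPair a b n m l ε) :
    commutator G = Subgroup.zpowers (a ^ 2 ^ 1) := by
  obtain ⟨l', rfl⟩ := Nat.exists_eq_add_of_le h.two_le
  have e : a ^ ((2 : ℤ) ^ (2 + l') - 1 - 1) = (a ^ 2 ^ 1) ^ ((2 : ℤ) ^ (l' + 1) - 1) := by
    rw [← zpow_natCast, ← zpow_mul]
    congr 1
    push_cast
    ring
  rw [h.pair.commutator_eq, e]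
  refine le_antisymm (Subgroup.zpowers_le.mpr (Subgroup.zpow_mem _ (Subgroup.mem_zpowers _) _)) ?_
  rw [Subgroup.zpowers_le]
  refine mem_of_pow_mem_of_coprime h.pair.isPGroup _ (i := (2 : ℤ) ^ (l' + 1) - 1) ?_
    (Subgroup.mem_zpowers _)
  rw [pow_succ]
  push_cast
  omega

theorem card_abelianization_eq (h : IsExceptionalPair a b n m l ε) :
    Nat.card (Abelianization G) = 2 ^ (m + 1) :=
  h.pair.card_abelianization_eq (by have := h.two_le; have := h.l_le_n; omega) h.commutator_eq

theorem pow_eq {G : Type*} [Group G] {a b : G} {n m l ε : ℕ}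
    (h : IsExceptionalPair a b n m l ε) : b ^ 2 ^ m = a ^ (2 ^ (n - 1) * ε) := by
  rw [h.pair.pow_right]
  exact_mod_cast zpow_natCast a _

theorem pow_mem_commutator (h : IsExceptionalPair a b n m l ε) (g : G) :
    g ^ 2 ^ m ∈ commutator G := by
  have ha : ∀ e i, 1 ≤ e → a ^ (2 ^ e * i) ∈ commutator G := fun e i he => by
    obtain ⟨d, rfl⟩ := Nat.exists_eq_add_of_le he
    rw [h.commutator_eq, pow_add 2, mul_assoc, pow_mul]
    exact Subgroup.pow_mem _ (Subgroup.mem_zpowers _) _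
  refine h.pair.pow_mem_commutator (mul_one (2 ^ m) ▸ ha m 1 h.one_le) ?_ g
  rw [h.pow_eq]
  exact ha _ _ (by have := h.two_le; have := h.l_le_n; omega)

theorem pow_mul_pow_mem_center_iff (h : IsExceptionalPair a b n m l ε) {d i j : ℕ}
    (hd : d = max 1 (n - l)) : a ^ i * b ^ j ∈ Subgroup.center G ↔ 2 ^ (n - 1) ∣ i ∧ 2 ^ d ∣ j := by
  have hn : 1 ≤ n := by have := h.two_le; have := h.l_le_n; omega
  have ha : a ^ i * b ^ j * a = a * (a ^ i * b ^ j) ↔ 2 ^ d ∣ j := by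
    have h1 := pow_mul_zpow_of_mul_eq h.pair.mul_eq j 1
    rw [zpow_one, mul_one] at h1
    rw [← dvd_pow_sub_one_iff h.two_le h.l_le_n hd, mul_assoc, h1, ← mul_assoc, ← mul_assoc,
      mul_left_inj, ← pow_succ', pow_succ, mul_right_inj]
    conv_lhs => rw [← zpow_one a, ← zpow_mul, one_mul, h.pair.zpow_eq_zpow_iff]
    push_cast
    rfl
  have hb : a ^ i * b ^ j * b = b * (a ^ i * b ^ j) ↔ 2 ^ (n - 1) ∣ i := by
    have h1 := mul_zpow_of_mul_eq h.pair.mul_eq i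
    rw [zpow_natCast] at h1
    rw [← mul_assoc b, h1, mul_assoc, mul_assoc, ← pow_succ, ← pow_succ', mul_left_inj, eq_comm,
      ← zpow_natCast a i, h.pair.zpow_eq_zpow_iff]
    obtain ⟨l', hl'⟩ := Nat.exists_eq_add_of_le h.two_le
    obtain ⟨n', rfl⟩ := Nat.exists_eq_add_of_le hn
    rw [hl', show ((2 : ℤ) ^ (2 + l') - 1) * i - i = 2 * ((2 ^ (l' + 1) - 1) * i) by ring]
    push_cast
    rw [pow_add, pow_one, mul_dvd_mul_iff_left two_ne_zero]
    have hc : IsCoprime ((2 : ℤ) ^ n') (2 ^ (l' + 1) - 1) :=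
      IsCoprime.pow_left ⟨2 ^ l', -1, by ring⟩
    rw [Nat.add_sub_cancel_left, ← Int.natCast_dvd_natCast]
    push_cast
    exact ⟨hc.dvd_of_dvd_mul_left, fun h => h.mul_left _⟩
  rw [← ha, ← hb, Subgroup.mem_center_iff]
  constructor
  · exact fun H => ⟨(H b).symm, (H a).symm⟩
  · rintro ⟨hb, ha⟩ g
    have : Subgroup.closure {a, b} ≤ Subgroup.centralizer {a ^ i * b ^ j} := by
      rw [Subgroup.closure_le]
      rintro x (rfl | hx)
      · simpa [Subgroup.mem_centralizer_singleton_iff] using ha.symm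
      · rw [Set.mem_singleton_iff.mp hx]
        simpa [Subgroup.mem_centralizer_singleton_iff] using hb.symm
    rw [h.pair.closure_eq] at this
    exact Subgroup.mem_centralizer_singleton_iff.mp (this (Subgroup.mem_top g))

theorem exists_center_eq (h : IsExceptionalPair a b n m l ε) {d : ℕ}
    (hd : d = max 1 (n - l)) {g : G} (hg : g ∈ Subgroup.center G) :
    ∃ x y : ℕ, x < 2 ∧ y < 2 ^ (m - d) ∧ g = a ^ (2 ^ (n - 1) * x) * b ^ (2 ^ d * y) := by
  obtain ⟨i, j, hi, hj, rfl⟩ := h.pair.exists_eq g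
  rw [h.pow_mul_pow_mem_center_iff hd] at hg
  obtain ⟨⟨x, rfl⟩, y, rfl⟩ := hg
  have h1 := h.one_le
  have h2 := h.n_le
  have h3 := h.two_le
  have h4 := h.l_le_n
  refine ⟨x, y, ?_, ?_, rfl⟩
  · rw [show 2 ^ n = 2 ^ (n - 1) * 2 by rw [← pow_succ]; congr 1; omega] at hi
    exact Nat.lt_of_mul_lt_mul_left hi
  · rw [show 2 ^ m = 2 ^ d * 2 ^ (m - d) by rw [← pow_add]; congr 1; omega] at hj
    exact Nat.lt_of_mul_lt_mul_left hj

theorem card_center (h : IsExceptionalPair a b n m l ε) {d : ℕ} (hd : d = max 1 (n - l)) :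
    Nat.card (Subgroup.center G) = 2 * 2 ^ (m - d) := by
  have h1 := h.one_le
  have h2 := h.n_le
  have h3 := h.two_le
  have h4 := h.l_le_n
  have e1 : 2 ^ n = 2 ^ (n - 1) * 2 := by rw [← pow_succ]; congr 1; omega
  have e2 : 2 ^ m = 2 ^ d * 2 ^ (m - d) := by rw [← pow_add]; congr 1; omega
  let f : Fin 2 × Fin (2 ^ (m - d)) → Subgroup.center G := fun x =>
    ⟨a ^ (2 ^ (n - 1) * x.1.1) * b ^ (2 ^ d * x.2.1), (h.pow_mul_pow_mem_center_iff hd).mpr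
      ⟨dvd_mul_right _ _, dvd_mul_right _ _⟩⟩
  have hf : Function.Bijective f := by
    constructor
    · rintro ⟨x, y⟩ ⟨x', y'⟩ e
      have hlt : ∀ x : Fin 2, 2 ^ (n - 1) * x.1 < 2 ^ n := fun x => by
        rw [e1]
        exact Nat.mul_lt_mul_of_pos_left x.2 (by positivity)
      have hlt' : ∀ y : Fin (2 ^ (m - d)), 2 ^ d * y.1 < 2 ^ m := fun y => by
        rw [e2]
        exact Nat.mul_lt_mul_of_pos_left y.2 (by positivity)
      have := h.pair.eq_and_eq (hlt x) (hlt' y) (hlt x') (hlt' y') (congrArg Subtype.val e)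
      rw [Nat.mul_right_inj (by positivity), Nat.mul_right_inj (by positivity)] at this
      exact Prod.ext (Fin.ext this.1) (Fin.ext this.2)
    · rintro ⟨g, hg⟩
      obtain ⟨x, y, hx, hy, rfl⟩ := h.exists_center_eq hd hg
      exact ⟨(⟨x, hx⟩, ⟨y, hy⟩), rfl⟩
  rw [← Nat.card_eq_of_bijective f hf]
  simp

end IsExceptionalPair

namespace IsExceptionalPair

theorem pow_mul_pow_sq {G : Type*} [Group G] {a b : G} {n m l ε : ℕ}
    (h : IsExceptionalPair a b n m l ε) (i j : ℕ) :
    (a ^ i * b ^ j) ^ 2 = a ^ ((i : ℤ) * (1 + (2 ^ l - 1) ^ j)) * b ^ (2 * j) := by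
  have h1 := zpow_mul_pow_eq (k := (2 ^ l - 1) ^ j) (b := b ^ j)
    (by simpa using pow_mul_zpow_of_mul_eq h.pair.mul_eq j 1) i 2
  rw [zpow_natCast] at h1
  rw [h1, ← pow_mul, mul_comm j, Finset.sum_range_succ, Finset.sum_range_one, pow_zero, pow_one]

variable {G : Type*} [Group G] [Finite G] {a b : G} {n m l ε : ℕ}

theorem pow_eq_one_iff (h : IsExceptionalPair a b n m l ε) {i : ℕ} : a ^ i = 1 ↔ 2 ^ n ∣ i := by
  rw [← orderOf_dvd_iff_pow_eq_one, h.pair.orderOf_eq]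

theorem pow_two_pow_sub_one_ne_one (h : IsExceptionalPair a b n m l ε) : a ^ 2 ^ (n - 1) ≠ 1 := by
  rw [Ne, h.pow_eq_one_iff, Nat.pow_dvd_pow_iff_le_right (by norm_num)]
  have := h.two_le
  have := h.l_le_n
  omega

theorem center_pow_eq_one_iff (h : IsExceptionalPair a b n m l ε) {d : ℕ} (hd : d = max 1 (n - l))
    (hdm : d < m) : (∀ g ∈ Subgroup.center G, g ^ 2 ^ (m - d) = 1) ↔ ε = 0 := by
  have e : 2 ^ d * 2 ^ (m - d) = 2 ^ m := by rw [← pow_add]; congr 1; omega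
  constructor
  · intro H
    have h1 := H (b ^ 2 ^ d) (by simpa using
      (h.pow_mul_pow_mem_center_iff (i := 0) hd).mpr ⟨dvd_zero _, dvd_refl _⟩)
    rw [← pow_mul, e, h.pow_eq] at h1
    have h2 := h.eps_le
    by_contra h3
    rw [show ε = 1 by omega, mul_one] at h1
    exact h.pow_two_pow_sub_one_ne_one h1
  · rintro rfl g hg
    obtain ⟨x, y, -, -, rfl⟩ := h.exists_center_eq hd hg
    have hz : a ^ (2 ^ (n - 1) * x) ∈ Subgroup.center G := by
      simpa using (h.pow_mul_pow_mem_center_iff (j := 0) hd).mpr ⟨dvd_mul_right _ x, dvd_zero _⟩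
    have hc : Commute (a ^ (2 ^ (n - 1) * x)) (b ^ (2 ^ d * y)) :=
      (Subgroup.mem_center_iff.mp hz _).symm
    rw [hc.mul_pow, ← pow_mul, ← pow_mul, mul_right_comm (2 ^ d), e, pow_mul b, h.pow_eq, mul_zero,
      pow_zero, one_pow, mul_one, h.pow_eq_one_iff]
    have : 2 ^ n ∣ 2 ^ (n - 1) * 2 ^ (m - d) := by
      rw [← pow_add]
      exact pow_dvd_pow 2 (by omega)
    rw [mul_right_comm]
    exact this.mul_right x

theorem exists_sq_eq_of_mem_center (h : IsExceptionalPair a b n m l ε) (hl : n = l + 1) {g : G}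
    (hg : g ∈ Subgroup.center G) : ∃ c, c ^ 2 = g := by
  have hd : 1 = max 1 (n - l) := by omega
  obtain ⟨x, y, -, -, rfl⟩ := h.exists_center_eq hd hg
  have h2 := h.two_le
  have he : ∀ t, (2 : ℤ) ^ n ∣ (2 ^ l - 1) ^ (2 * t) - 1 := fun t =>
    (dvd_pow_sub_one_iff h.two_le h.l_le_n hd).mpr (by rw [pow_one]; exact dvd_mul_right _ _)
  rw [pow_one]
  rcases Nat.even_or_odd' y with ⟨t, rfl | rfl⟩
  · refine ⟨a ^ (2 ^ (n - 2) * x) * b ^ (2 * t), ?_⟩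
    rw [h.pow_mul_pow_sq, ← zpow_natCast a, mul_left_inj, h.pair.zpow_eq_zpow_iff]
    obtain ⟨w, hw⟩ := he t
    rw [sub_eq_iff_eq_add] at hw
    rw [hw]
    refine ⟨2 ^ (n - 2) * x * w, ?_⟩
    rw [show n - 1 = n - 2 + 1 by omega]
    push_cast
    ring
  · refine ⟨a ^ x * b ^ (2 * t + 1), ?_⟩
    rw [h.pow_mul_pow_sq, ← zpow_natCast a, mul_left_inj, h.pair.zpow_eq_zpow_iff]
    obtain ⟨w, hw⟩ := he t
    rw [sub_eq_iff_eq_add] at hw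
    rw [pow_succ, hw, show n - 1 = l by omega]
    refine ⟨x * w * (2 ^ l - 1), ?_⟩
    push_cast
    ring

theorem sq_ne (h : IsExceptionalPair a b n m l 0) (hl : n = l) (hm : 2 ≤ m) (c : G) :
    c ^ 2 ≠ a ^ 2 ^ (n - 1) * b ^ 2 := by
  obtain ⟨i, j, hi, hj, rfl⟩ := h.pair.exists_eq c
  intro H
  rw [h.pow_mul_pow_sq] at H
  have h4 : 2 ^ m = 4 * 2 ^ (m - 2) := by
    rw [show 4 = 2 ^ 2 by norm_num, ← pow_add]; congr 1; omega
  have hz : a ^ 2 ^ (n - 1) ∈ Subgroup.zpowers a := Subgroup.pow_mem _ (Subgroup.mem_zpowers _) _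
  rcases Nat.eq_zero_or_pos j with rfl | hj0
  · have : b ^ 2 ∈ Subgroup.zpowers a := by
      rw [← (Subgroup.zpowers a).mul_mem_cancel_left hz, ← H, mul_zero, pow_zero b, mul_one (_ ^ _)]
      exact Subgroup.zpow_mem _ (Subgroup.mem_zpowers _) _
    rw [h.pair.pow_mem_zpowers_iff] at this
    have := Nat.le_of_dvd two_pos this
    have : 0 < 2 ^ (m - 2) := by positivity
    omega
  · obtain ⟨j, rfl⟩ : ∃ j', j = j' + 1 := ⟨j - 1, by omega⟩
    rw [mul_add 2, mul_one 2, pow_add b, ← mul_assoc, mul_left_inj] at H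
    have hb : b ^ (2 * j) ∈ Subgroup.zpowers a := by
      rw [← H] at hz
      exact ((Subgroup.zpowers a).mul_mem_cancel_left
        (Subgroup.zpow_mem _ (Subgroup.mem_zpowers _) _)).mp hz
    rw [h.pair.pow_mem_zpowers_iff] at hb
    have hodd : Odd (j + 1) := by
      rw [h4] at hb
      obtain ⟨w, hw⟩ := hb
      rw [mul_assoc] at hw
      exact ⟨2 ^ (m - 2) * w, by omega⟩
    have hd : (2 : ℤ) ^ n ∣ 1 + (2 ^ l - 1) ^ (j + 1) := by
      have := hodd.add_dvd_pow_add_pow 1 ((2 : ℤ) ^ l - 1)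
      rw [one_pow, add_sub_cancel] at this
      rwa [hl]
    obtain ⟨w, hw⟩ := hb
    rw [(h.pair.zpow_eq_one_iff).mpr (by push_cast; exact hd.mul_left _),
      one_mul, hw, pow_mul, h.pow_eq, mul_zero, pow_zero, one_pow] at H
    exact h.pow_two_pow_sub_one_ne_one H.symm

section AlgEquiv

variable {F : Type*} [Field F] [CharP F 2] {H : Type*} [Group H] [Finite H]

theorem card_eq {G : Type*} [Group G] {a b : G} {n m l ε : ℕ}
    (h : IsExceptionalPair a b n m l ε) : Nat.card G = 2 ^ (n + m) := by
  rw [h.pair.card_eq, pow_add]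

/-- Away from the groups of maximal class the parameters are determined by the order, the center
and the abelianization. -/
theorem eq_of_algEquiv (h : IsExceptionalPair a b n m l ε) {a' b' : H} {n' m' l' ε' : ℕ}
    (h' : IsExceptionalPair a' b' n' m' l' ε')
    (φ : MonoidAlgebra F G ≃ₐ[F] MonoidAlgebra F H) :
    n = n' ∧ m = m' ∧ (2 ≤ m → l = l' ∧ ε = ε') := by
  have hG := h.pair.isPGroup
  have hH := h'.pair.isPGroup
  have hm : m = m' := by
    have := card_abelianization_eq_of_algEquiv φ
    rw [h.card_abelianization_eq, h'.card_abelianization_eq] at this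
    have := Nat.pow_right_injective le_rfl this
    omega
  subst hm
  have hn : n = n' := by
    have := Nat.card_eq_of_monoidAlgebra_linearEquiv φ.toLinearEquiv
    rw [h.card_eq, h'.card_eq] at this
    have := Nat.pow_right_injective le_rfl this
    omega
  subst hn
  refine ⟨rfl, rfl, fun hm => ?_⟩
  have hc := le_antisymm (card_center_le_of_algEquiv hH φ.symm)
    (card_center_le_of_algEquiv hG φ)
  obtain ⟨d, hd⟩ : ∃ d, d = max 1 (n - l) := ⟨_, rfl⟩
  obtain ⟨d', hd'⟩ : ∃ d', d' = max 1 (n - l') := ⟨_, rfl⟩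
  rw [h.card_center hd, h'.card_center hd', Nat.mul_right_inj two_ne_zero] at hc
  have hc := Nat.pow_right_injective le_rfl hc
  have := h.n_le
  have := h'.n_le
  have := h.l_le_n
  have := h'.l_le_n
  have := h.eps_le
  have := h'.eps_le
  obtain rfl : d = d' := by omega
  rcases (show d ≤ m by omega).lt_or_eq with hdm | hdm
  · have hε : ε = ε' := by
      have e : ε = 0 ↔ ε' = 0 := by
        rw [← h.center_pow_eq_one_iff hd hdm, ← h'.center_pow_eq_one_iff hd' hdm]
        exact ⟨fun H g hg => center_pow_eq_one_of_algEquiv hG φ H g hg,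
          fun H g hg => center_pow_eq_one_of_algEquiv hH φ.symm H g hg⟩
      omega
    subst hε
    refine ⟨?_, rfl⟩
    have h1 := fun hε => h.n_ne_succ hε hm
    have h2 := fun hε => h'.n_ne_succ hε hm
    by_contra hll
    have hε : ε = 0 := by omega
    subst hε
    rcases (show n = l ∧ n = l' + 1 ∨ n = l' ∧ n = l + 1 by omega) with ⟨e, e'⟩ | ⟨e, e'⟩
    · obtain ⟨c, hc⟩ := exists_pow_eq_of_algEquiv hH φ.symm
        (fun g hg => h'.exists_sq_eq_of_mem_center e' hg) (a ^ 2 ^ (n - 1) * b ^ 2)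
        ((h.pow_mul_pow_mem_center_iff (d := 1) (by omega)).mpr ⟨dvd_refl _, by simp⟩)
      exact h.sq_ne e hm c hc
    · obtain ⟨c, hc⟩ := exists_pow_eq_of_algEquiv hG φ
        (fun g hg => h.exists_sq_eq_of_mem_center e' hg) (a' ^ 2 ^ (n - 1) * b' ^ 2)
        ((h'.pow_mul_pow_mem_center_iff (d := 1) (by omega)).mpr ⟨dvd_refl _, by simp⟩)
      exact h'.sq_ne e hm c hc
  · have h1 := h.n_ne_add
    have h2 := h'.n_ne_add
    omega

end AlgEquiv

/-- Ordinary and exceptional metacyclic groups are separated by their abelianizations. -/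
theorem not_nonempty_algEquiv {F : Type*} [Field F] [CharP F 2] {H : Type*} [Group H] [Finite H]
    (h : IsExceptionalPair a b n m l ε) {a' b' : H} {n' m' r' s' : ℕ}
    (h' : IsOrdinaryPair 2 a' b' n' m' r' s')
    (φ : MonoidAlgebra F G ≃ₐ[F] MonoidAlgebra F H) : False := by
  have hm : m = m' := le_antisymm
    (h.pair.le_of_forall_pow_mem_commutator fun g =>
      pow_mem_commutator_of_algEquiv φ.symm h'.pow_mem_commutator g)
    (h'.pair.le_of_forall_pow_mem_commutator fun g =>
      pow_mem_commutator_of_algEquiv φ h.pow_mem_commutator g)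
  have h1 := card_abelianization_eq_of_algEquiv φ
  rw [h.card_abelianization_eq, h'.card_abelianization_eq] at h1
  have h1 := Nat.pow_right_injective le_rfl h1
  have h2 := Nat.card_eq_of_monoidAlgebra_linearEquiv φ.toLinearEquiv
  rw [h.card_eq, h'.pair.card_eq, ← pow_add] at h2
  have h2 := Nat.pow_right_injective le_rfl h2
  have h3 := h.two_le
  have h4 := h.l_le_n
  have h5 := h'.two_le rfl
  omega

end IsExceptionalPair

/-- The part of an element of `F[G]` that is supported on the coset `C * t`. -/
noncomputable def cosetPart (F : Type*) {G C : Type*} [Field F] [Group G] [CommGroup C] (ι : C →* G)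
    (t : G) : MonoidAlgebra F G →ₗ[F] MonoidAlgebra F C := by
  classical exact
  (Finsupp.linearCombination F fun g : G =>
    if h : ∃ c, g = ι c * t then MonoidAlgebra.single h.choose 1 else 0) ∘ₗ
    (MonoidAlgebra.coeffLinearEquiv F).toLinearMap

section cosetPart

variable {F G C : Type*} [Field F] [Group G] [CommGroup C] {ι : C →* G}

theorem cosetPart_single_mul (hι : Function.Injective ι) (t : G) (c : C) (r : F) :
    cosetPart F ι t (MonoidAlgebra.single (ι c * t) r) = MonoidAlgebra.single c r := by
  simp only [cosetPart, MonoidAlgebra.coeffLinearEquiv, LinearMap.comp_apply]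
  simp only [mul_left_inj, LinearEquiv.coe_coe, Equiv.linearEquiv_apply,
    MonoidAlgebra.coeffEquiv_apply, MonoidAlgebra.coeff_single,
    Finsupp.linearCombination_single, exists_apply_eq_apply', dite_true]
  generalize_proofs h
  rw [← hι h.choose_spec]
  simp

theorem cosetPart_single_of_ne {t g : G} (h : ∀ c, g ≠ ι c * t) (r : F) :
    cosetPart F ι t (MonoidAlgebra.single g r) = 0 := by
  have h : ¬ ∃ c, g = ι c * t := fun ⟨c, hc⟩ => h c hc
  simp [cosetPart, MonoidAlgebra.coeffLinearEquiv, h]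

end cosetPart

/-- `G` is generated by an abelian subgroup `C` of index two and an element `b` acting on `C` by
`σ`, with square `ζ`. -/
structure IsIndexTwo {G C : Type*} [Group G] [CommGroup C] (ι : C →* G) (σ : C →* C) (b : G)
    (ζ : C) : Prop where
  injective : Function.Injective ι
  mul_eq : ∀ c, b * ι c = ι (σ c) * b
  sq_eq : b * b = ι ζ
  exists_eq : ∀ g, ∃ c, g = ι c ∨ g = ι c * b
  ne : ∀ c, ι c ≠ b

namespace IsIndexTwo

variable {F G C : Type*} [Field F] [Group G] [CommGroup C] {ι : C →* G} {σ : C →* C} {b : G} {ζ : C}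

theorem fst_single (h : IsIndexTwo ι σ b ζ) (c : C) (r : F) :
    cosetPart F ι 1 (MonoidAlgebra.single (ι c) r) = MonoidAlgebra.single c r := by
  simpa using cosetPart_single_mul h.injective 1 c r

theorem snd_single_mul (h : IsIndexTwo ι σ b ζ) (c : C) (r : F) :
    cosetPart F ι b (MonoidAlgebra.single (ι c * b) r) = MonoidAlgebra.single c r :=
  cosetPart_single_mul h.injective b c r

theorem fst_single_mul (h : IsIndexTwo ι σ b ζ) (c : C) (r : F) :
    cosetPart F ι 1 (MonoidAlgebra.single (ι c * b) r) = 0 :=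
  cosetPart_single_of_ne (fun c' e => h.ne (c⁻¹ * c') (by
    rw [map_mul, map_inv, ← mul_one (ι c'), ← e, inv_mul_cancel_left])) r

theorem snd_single (h : IsIndexTwo ι σ b ζ) (c : C) (r : F) :
    cosetPart F ι b (MonoidAlgebra.single (ι c) r) = 0 :=
  cosetPart_single_of_ne (fun c' e => h.ne (c'⁻¹ * c) (by
    rw [map_mul, map_inv, e, inv_mul_cancel_left])) r

theorem induction_linear (h : IsIndexTwo ι σ b ζ) {P : MonoidAlgebra F G → Prop}
    (zero : P 0) (add : ∀ x y, P x → P y → P (x + y))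
    (single : ∀ c r, P (MonoidAlgebra.single (ι c) r))
    (single_mul : ∀ c r, P (MonoidAlgebra.single (ι c * b) r)) (x) : P x := by
  induction x using MonoidAlgebra.induction_linear with
  | zero => exact zero
  | add x y hx hy => exact add x y hx hy
  | single g r =>
    obtain ⟨c, rfl | rfl⟩ := h.exists_eq g
    · exact single c r
    · exact single_mul c r

theorem evalAt_eq (h : IsIndexTwo ι σ b ζ) (f : G → F) (v : MonoidAlgebra F G) :
    evalAt f v = evalAt (fun c => f (ι c)) (cosetPart F ι 1 v) +
      evalAt (fun c => f (ι c * b)) (cosetPart F ι b v) := by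
  induction v using h.induction_linear with
  | zero => simp
  | add x y hx hy => simp only [map_add, hx, hy]; ring
  | single c r => simp [h.fst_single, h.snd_single]
  | single_mul c r => simp [h.fst_single_mul, h.snd_single_mul]

theorem fst_mul (h : IsIndexTwo ι σ b ζ) (u v : MonoidAlgebra F G) :
    cosetPart F ι 1 (u * v) = cosetPart F ι 1 u * cosetPart F ι 1 v + MonoidAlgebra.single ζ 1 *
      (cosetPart F ι b u * MonoidAlgebra.mapDomainAlgHom F F σ (cosetPart F ι b v)) := by
  induction u using h.induction_linear with
  | zero => simp
  | add x y hx hy => simp only [add_mul, map_add, hx, hy]; ring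
  | single c r =>
    induction v using h.induction_linear with
    | zero => simp
    | add x y hx hy => simp only [mul_add, map_add, hx, hy]; ring
    | single c' r' =>
      rw [MonoidAlgebra.single_mul_single, ← map_mul, h.fst_single, h.fst_single, h.fst_single,
        h.snd_single]
      simp
    | single_mul c' r' =>
      rw [MonoidAlgebra.single_mul_single, ← mul_assoc, ← map_mul, h.fst_single_mul,
        h.fst_single_mul, h.snd_single]
      simp
  | single_mul c r =>
    induction v using h.induction_linear with
    | zero => simp
    | add x y hx hy => simp only [mul_add, map_add, hx, hy]; ring
    | single c' r' =>
      rw [MonoidAlgebra.single_mul_single, mul_assoc, h.mul_eq, ← mul_assoc, ← map_mul,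
        h.fst_single_mul, h.fst_single_mul, h.snd_single]
      simp
    | single_mul c' r' =>
      rw [MonoidAlgebra.single_mul_single, ← mul_assoc (ι c * b), mul_assoc (ι c) b, h.mul_eq,
        mul_assoc (ι c), mul_assoc (ι (σ c')), h.sq_eq, ← map_mul, ← map_mul, h.fst_single,
        h.fst_single_mul, h.snd_single_mul, h.snd_single_mul]
      simp [MonoidAlgebra.single_mul_single, mul_comm, mul_left_comm]

theorem snd_mul (h : IsIndexTwo ι σ b ζ) (u v : MonoidAlgebra F G) :
    cosetPart F ι b (u * v) = cosetPart F ι 1 u * cosetPart F ι b v +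
      cosetPart F ι b u * MonoidAlgebra.mapDomainAlgHom F F σ (cosetPart F ι 1 v) := by
  induction u using h.induction_linear with
  | zero => simp
  | add x y hx hy => simp only [add_mul, map_add, hx, hy]; ring
  | single c r =>
    induction v using h.induction_linear with
    | zero => simp
    | add x y hx hy => simp only [mul_add, map_add, hx, hy]; ring
    | single c' r' =>
      rw [MonoidAlgebra.single_mul_single, ← map_mul, h.snd_single, h.snd_single, h.snd_single]
      simp
    | single_mul c' r' =>
      rw [MonoidAlgebra.single_mul_single, ← mul_assoc, ← map_mul, h.snd_single_mul,
        h.snd_single_mul, h.fst_single, h.snd_single]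
      simp [MonoidAlgebra.single_mul_single]
  | single_mul c r =>
    induction v using h.induction_linear with
    | zero => simp
    | add x y hx hy => simp only [mul_add, map_add, hx, hy]; ring
    | single c' r' =>
      rw [MonoidAlgebra.single_mul_single, mul_assoc, h.mul_eq, ← mul_assoc, ← map_mul,
        h.snd_single_mul, h.snd_single_mul, h.snd_single, h.fst_single]
      simp [MonoidAlgebra.single_mul_single]
    | single_mul c' r' =>
      rw [MonoidAlgebra.single_mul_single, ← mul_assoc (ι c * b), mul_assoc (ι c) b, h.mul_eq,
        mul_assoc (ι c), mul_assoc (ι (σ c')), h.sq_eq, ← map_mul, ← map_mul, h.snd_single,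
        h.fst_single_mul, h.fst_single_mul]
      simp

end IsIndexTwo

section

variable {F C : Type*} [Field F] [CommGroup C]

theorem evalAt_mapDomainAlgHom (σ : C →* C) (f : C → F) (u : MonoidAlgebra F C) :
    evalAt f (MonoidAlgebra.mapDomainAlgHom F F σ u) = evalAt (fun c => f (σ c)) u := by
  induction u using MonoidAlgebra.induction_linear with
  | zero => simp
  | add x y hx hy => simp only [map_add, hx, hy]
  | single c r => simp

theorem augment_mapDomainAlgHom (σ : C →* C) (u : MonoidAlgebra F C) :
    augment F C (MonoidAlgebra.mapDomainAlgHom F F σ u) = augment F C u := by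
  induction u using MonoidAlgebra.induction_linear with
  | zero => simp
  | add x y hx hy => simp only [map_add, hx, hy]
  | single c r => simp

theorem evalAt_mul_mapDomainAlgHom_comm {σ : C →* C} {f : C → F}
    (hf : ∀ c d, f (c * σ d) = f (d * σ c)) (u v : MonoidAlgebra F C) :
    evalAt f (u * MonoidAlgebra.mapDomainAlgHom F F σ v) =
      evalAt f (v * MonoidAlgebra.mapDomainAlgHom F F σ u) := by
  induction u using MonoidAlgebra.induction_linear with
  | zero => simp
  | add x y hx hy => simp only [map_add, add_mul, mul_add, hx, hy]
  | single c r =>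
    induction v using MonoidAlgebra.induction_linear with
    | zero => simp
    | add x y hx hy => simp only [map_add, add_mul, mul_add, hx, hy]
    | single d s => simp [MonoidAlgebra.single_mul_single, hf c d, mul_comm r s]

variable [CharP F 2]

theorem evalAt_mul_mapDomainAlgHom_self [Fintype C] {σ : C →* C} {f : C → F}
    (hf : ∀ c d, f (c * σ d) = f (d * σ c)) (w : MonoidAlgebra F C) :
    evalAt f (w * MonoidAlgebra.mapDomainAlgHom F F σ w) =
      ∑ c, w.coeff c ^ 2 * f (c * σ c) := by
  classical
  have key : ∀ s : Finset C, evalAt f ((∑ c ∈ s, MonoidAlgebra.single c (w.coeff c)) *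
      MonoidAlgebra.mapDomainAlgHom F F σ (∑ c ∈ s, MonoidAlgebra.single c (w.coeff c))) =
      ∑ c ∈ s, w.coeff c ^ 2 * f (c * σ c) := by
    intro s
    induction s using Finset.induction_on with
    | empty => simp
    | insert a s ha ih =>
      rw [Finset.sum_insert ha, Finset.sum_insert ha, ← ih]
      have e := evalAt_mul_mapDomainAlgHom_comm hf (MonoidAlgebra.single a (w.coeff a))
        (∑ c ∈ s, MonoidAlgebra.single c (w.coeff c))
      have e2 : evalAt f (MonoidAlgebra.single a (w.coeff a) * MonoidAlgebra.mapDomainAlgHom F F σ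
          (MonoidAlgebra.single a (w.coeff a))) = w.coeff a ^ 2 * f (a * σ a) := by
        simp [MonoidAlgebra.single_mul_single, sq]
      rw [map_add, add_mul, mul_add, mul_add, map_add, map_add, map_add, e, e2]
      linear_combination CharTwo.add_self_eq_zero (evalAt f
        ((∑ c ∈ s, MonoidAlgebra.single c (w.coeff c)) *
          MonoidAlgebra.mapDomainAlgHom F F σ (MonoidAlgebra.single a (w.coeff a))))
  conv_lhs => rw [eq_sum_single w]
  exact key _

theorem pow_eq_single_augment {n : ℕ} (hC : ∀ c : C, c ^ 2 ^ n = 1) (w : MonoidAlgebra F C) :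
    w ^ 2 ^ n = MonoidAlgebra.single 1 (augment F C w ^ 2 ^ n) := by
  have : CharP (MonoidAlgebra F C) 2 :=
    charP_of_injective_algebraMap (algebraMap F (MonoidAlgebra F C)).injective 2
  induction w using MonoidAlgebra.induction_linear with
  | zero => simp
  | add x y hx hy => rw [map_add, add_pow_char_pow, add_pow_char_pow, hx, hy,
      MonoidAlgebra.single_add]
  | single c r => rw [MonoidAlgebra.single_pow, hC, augment_single]

theorem eq_zero_of_mul_eq_zero_of_augment_ne_zero {n : ℕ} (hC : ∀ c : C, c ^ 2 ^ n = 1)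
    {w y : MonoidAlgebra F C} (hw : augment F C w ≠ 0) (h : w * y = 0) : y = 0 := by
  have h1 : w ^ 2 ^ n * y = 0 := by
    obtain ⟨k, hk⟩ : ∃ k, 2 ^ n = k + 1 := ⟨2 ^ n - 1, by have := Nat.two_pow_pos n; omega⟩
    rw [hk, pow_succ, mul_assoc, h, mul_zero]
  rw [pow_eq_single_augment hC] at h1
  have h2 : MonoidAlgebra.single (1 : C) ((augment F C w ^ 2 ^ n)⁻¹) *
      MonoidAlgebra.single 1 (augment F C w ^ 2 ^ n) = 1 := by
    rw [MonoidAlgebra.single_mul_single, one_mul, inv_mul_cancel₀ (pow_ne_zero _ hw)]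
    rfl
  rw [← one_mul y, ← h2, mul_assoc, h1, mul_zero]

/-- A sum over the elements `c` of a function that takes equal values at `c` and `σ c` vanishes
in characteristic two if the function vanishes on the fixed points of the involution `σ`. -/
theorem sum_eq_zero_of_involution [Fintype C] {σ : C →* C} (hσ : ∀ c, σ (σ c) = c) {f : C → F}
    (hf : ∀ c, f (σ c) = f c) (hfix : ∀ c, σ c = c → f c = 0) : ∑ c, f c = 0 := by
  refine Finset.sum_involution (fun c _ => σ c) (fun c _ => ?_) (fun c _ hc hs => hc (hfix c hs))
    (fun _ _ => Finset.mem_univ _) (fun c _ => hσ c)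
  rw [hf, CharTwo.add_self_eq_zero]

end

namespace IsIndexTwo

variable {F G C : Type*} [Field F] [Group G] [CommGroup C] {ι : C →* G} {σ : C →* C}
  {b : G} {ζ : C}

theorem fst_sq_add (h : IsIndexTwo ι σ b ζ) {v : MonoidAlgebra F G} (hv : v * v = 0) :
    cosetPart F ι 1 v * cosetPart F ι 1 v + MonoidAlgebra.single ζ 1 *
      (cosetPart F ι b v * MonoidAlgebra.mapDomainAlgHom F F σ (cosetPart F ι b v)) = 0 := by
  rw [← h.fst_mul, hv, map_zero]

theorem snd_mul_add (h : IsIndexTwo ι σ b ζ) {v : MonoidAlgebra F G} (hv : v * v = 0) :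
    cosetPart F ι b v * (cosetPart F ι 1 v +
      MonoidAlgebra.mapDomainAlgHom F F σ (cosetPart F ι 1 v)) = 0 := by
  rw [mul_add, mul_comm (cosetPart F ι b v) (cosetPart F ι 1 v), ← h.snd_mul, hv, map_zero]

variable [CharP F 2]

theorem mapDomainAlgHom_fst (h : IsIndexTwo ι σ b ζ) {n : ℕ} (hC : ∀ c : C, c ^ 2 ^ n = 1)
    {v : MonoidAlgebra F G} (hv : v * v = 0) (hw : augment F C (cosetPart F ι b v) ≠ 0) :
    MonoidAlgebra.mapDomainAlgHom F F σ (cosetPart F ι 1 v) = cosetPart F ι 1 v := by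
  have : CharP (MonoidAlgebra F C) 2 :=
    charP_of_injective_algebraMap (algebraMap F (MonoidAlgebra F C)).injective 2
  have := eq_zero_of_mul_eq_zero_of_augment_ne_zero hC hw (h.snd_mul_add hv)
  exact (CharTwo.add_eq_zero.mp this).symm

theorem coeff_fst (h : IsIndexTwo ι σ b ζ) {n : ℕ} (hC : ∀ c : C, c ^ 2 ^ n = 1)
    (hσ : ∀ c, σ (σ c) = c)
    {v : MonoidAlgebra F G} (hv : v * v = 0) (hw : augment F C (cosetPart F ι b v) ≠ 0) (c : C) :
    (cosetPart F ι 1 v).coeff (σ c) = (cosetPart F ι 1 v).coeff c := by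
  conv_lhs => rw [← h.mapDomainAlgHom_fst hC hv hw]
  have hinj : Function.Injective σ := Function.LeftInverse.injective hσ
  simp only [MonoidAlgebra.mapDomainAlgHom_apply, MonoidAlgebra.coeff_mapDomain]
  exact Finsupp.mapDomain_apply hinj _ _

/-- The consequence of `v * v = 0` for a function `q` that is quadratic on `C`. -/
theorem evalAt_sq_eq (h : IsIndexTwo ι σ b ζ) {d q : C → F} (hd : d ∈ additiveMaps F C)
    (hq : ∀ c c', q (c * c') = q c + q c' + d c * d c') (hdσ : ∀ c, d (σ c) = d c)
    (hqσ : ∀ c, q (σ c) = q c + d c) (hdζ : d ζ = 0) (hqζ : q ζ = 0)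
    {v : MonoidAlgebra F G} (hv : v * v = 0) :
    (evalAt d (cosetPart F ι 1 v) + evalAt d (cosetPart F ι b v)) ^ 2 =
      augment F C (cosetPart F ι b v) *
        (evalAt d (cosetPart F ι 1 v) + evalAt d (cosetPart F ι b v)) := by
  have h1 := congrArg (evalAt q) (h.fst_sq_add hv)
  have h2 := congrArg (evalAt q) (h.snd_mul_add hv)
  have e1 : ∀ u : MonoidAlgebra F C, evalAt d (MonoidAlgebra.mapDomainAlgHom F F σ u) =
      evalAt d u := fun u => by rw [evalAt_mapDomainAlgHom, funext hdσ]
  have e2 : ∀ u : MonoidAlgebra F C, evalAt q (MonoidAlgebra.mapDomainAlgHom F F σ u) =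
      evalAt q u + evalAt d u := fun u => by
    rw [evalAt_mapDomainAlgHom, funext hqσ]
    exact LinearMap.congr_fun (evalAt_add q d) u
  simp only [map_add, map_zero, evalAt_mul_of_cup hq, evalAt_mul_of_mem_additiveMaps hd,
    augment_mapDomainAlgHom, e1, e2, evalAt_single, augment_single, hdζ, hqζ] at h1 h2
  have h3 := CharTwo.two_eq_zero (R := F)
  generalize evalAt d (cosetPart F ι 1 v) = x, evalAt d (cosetPart F ι b v) = y,
    evalAt q (cosetPart F ι 1 v) = s, evalAt q (cosetPart F ι b v) = t,
    augment F C (cosetPart F ι 1 v) = α, augment F C (cosetPart F ι b v) = β at h1 h2 ⊢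
  linear_combination h1 + h2 - (x * β + y * β + β * s + β * t + α * s + α * t) * h3

end IsIndexTwo

/-- `G` has a cyclic subgroup of order `2 ^ n` and index two, generated by `ι x`, on which `b` acts
by the exponent `2 ^ l - 1`. -/
structure IsCyclicIndexTwo {G C : Type*} [Group G] [CommGroup C] (ι : C →* G) (x : C) (b : G)
    (n l ε : ℕ) : Prop where
  exists_eq : ∀ c, ∃ i : ℕ, c = x ^ i
  orderOf_eq : orderOf x = 2 ^ n
  index : IsIndexTwo ι (powMonoidHom (2 ^ l - 1)) b (x ^ (2 ^ (n - 1) * ε))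
  two_le : 2 ≤ l
  l_le : l ≤ n
  n_le : n ≤ l + 1

open scoped IsMulCommutative in
theorem IsExceptionalPair.exists_isCyclicIndexTwo.{u} {G : Type u} [Group G] [Finite G] {a b : G}
    {n l ε : ℕ} (h : IsExceptionalPair a b n 1 l ε) :
    ∃ (C : Type u) (_ : CommGroup C) (_ : Fintype C) (ι : C →* G) (x : C), ι x = a ∧
      IsCyclicIndexTwo ι x b n l ε := by
  refine ⟨Subgroup.zpowers a, inferInstance, Fintype.ofFinite _, (Subgroup.zpowers a).subtype,
    ⟨a, Subgroup.mem_zpowers a⟩, rfl, ?_, ?_, ⟨Subtype.val_injective, ?_, ?_, ?_, ?_⟩, h.two_le,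
    h.l_le_n, h.n_le⟩
  · rintro ⟨c, hc⟩
    rw [← mem_powers_iff_mem_zpowers] at hc
    obtain ⟨i, hi⟩ := hc
    exact ⟨i, Subtype.ext hi.symm⟩
  · rw [Subgroup.orderOf_mk]
    exact h.pair.orderOf_eq
  · rintro ⟨c, hc⟩
    obtain ⟨i, rfl⟩ := hc
    have h1 := mul_zpow_of_mul_eq h.pair.mul_eq i
    refine h1.trans ?_
    congr 1
    change _ = (a ^ i) ^ (2 ^ l - 1)
    rw [← zpow_natCast, ← zpow_mul, mul_comm, Nat.cast_sub Nat.one_le_two_pow]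
    push_cast
    rfl
  · have := h.pow_eq
    rw [pow_one, sq] at this
    exact this
  · intro g
    obtain ⟨i, j, -, hj, rfl⟩ := h.pair.exists_eq g
    refine ⟨⟨a ^ i, Subgroup.pow_mem _ (Subgroup.mem_zpowers _) _⟩, ?_⟩
    rcases (show j = 0 ∨ j = 1 by omega) with rfl | rfl
    · exact Or.inl (by simp)
    · exact Or.inr (by simp)
  · rintro ⟨c, hc⟩ rfl
    have := h.pair.pow_mem_zpowers_iff (j := 1)
    rw [pow_one] at this
    have := this.mp hc
    norm_num at this

theorem evalAt_single_mul {F C : Type*} [Field F] [CommGroup C] (f : C → F) (c : C)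
    (u : MonoidAlgebra F C) :
    evalAt f (MonoidAlgebra.single c 1 * u) = evalAt (fun e => f (c * e)) u := by
  induction u using MonoidAlgebra.induction_linear with
  | zero => simp
  | add x y hx hy => simp only [mul_add, map_add, hx, hy]
  | single e r => simp [MonoidAlgebra.single_mul_single]

theorem augment_eq_sum {F C : Type*} [Field F] [CommGroup C] [Fintype C] (u : MonoidAlgebra F C) :
    augment F C u = ∑ c, u.coeff c := by
  conv_lhs => rw [eq_sum_single u, map_sum]
  simp

namespace IsCyclicIndexTwo

variable {F : Type*} {G C : Type*} [Field F] [Group G] [CommGroup C] {ι : C →* G} {x : C} {b : G}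
  {n l ε : ℕ}

theorem pow_eq_one (h : IsCyclicIndexTwo ι x b n l ε) (c : C) : c ^ 2 ^ n = 1 := by
  obtain ⟨i, rfl⟩ := h.exists_eq c
  rw [← h.orderOf_eq, ← pow_mul, mul_comm, pow_mul, pow_orderOf_eq_one, one_pow]

theorem two_pow_sub_one_eq (h : IsCyclicIndexTwo ι x b n l ε) :
    ∃ r, 2 ^ l - 1 = 2 * r + 1 ∧ 2 ^ (l - 1) = r + 1 ∧ 2 ^ (l + 1) = 4 * (r + 1) ∧ r % 2 = 1 := by
  obtain ⟨t, ht⟩ := Nat.exists_eq_add_of_le h.two_le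
  have h0 := Nat.two_pow_pos t
  have h1 : 2 ^ (2 + t - 1) = 2 * 2 ^ t := by rw [← pow_succ']; congr 1; omega
  have h2 : 2 ^ (2 + t) = 4 * 2 ^ t := by rw [pow_add]; norm_num
  subst ht
  refine ⟨2 * 2 ^ t - 1, ?_, ?_, ?_, ?_⟩
  on_goal 3 => rw [pow_succ]
  all_goals omega

theorem powMonoidHom_powMonoidHom (h : IsCyclicIndexTwo ι x b n l ε) (c : C) :
    powMonoidHom (2 ^ l - 1) (powMonoidHom (2 ^ l - 1) c) = c := by
  obtain ⟨r, hr, hr1, hr2, -⟩ := h.two_pow_sub_one_eq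
  obtain ⟨t, ht⟩ := Nat.exists_eq_add_of_le h.n_le
  simp only [powMonoidHom_apply]
  rw [← pow_mul, hr, show (2 * r + 1) * (2 * r + 1) = 4 * (r + 1) * r + 1 by ring, ← hr2, ht,
    pow_succ, pow_add 2, mul_assoc, pow_mul, h.pow_eq_one, one_pow, one_mul]

theorem involution_sq (h : IsCyclicIndexTwo ι x b n l ε) :
    x ^ 2 ^ (n - 1) * x ^ 2 ^ (n - 1) = 1 := by
  have := h.two_le
  have := h.l_le
  rw [← pow_add, ← two_mul, ← pow_succ', show n - 1 + 1 = n by omega, h.pow_eq_one]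

theorem involution_ne_one (h : IsCyclicIndexTwo ι x b n l ε) : x ^ 2 ^ (n - 1) ≠ 1 := by
  have := h.two_le
  have := h.l_le
  rw [Ne, ← orderOf_dvd_iff_pow_eq_one, h.orderOf_eq, Nat.pow_dvd_pow_iff_le_right (by norm_num)]
  omega

theorem powMonoidHom_involution (h : IsCyclicIndexTwo ι x b n l ε) :
    powMonoidHom (2 ^ l - 1) (x ^ 2 ^ (n - 1)) = x ^ 2 ^ (n - 1) := by
  obtain ⟨r, hr, -⟩ := h.two_pow_sub_one_eq
  rw [powMonoidHom_apply, hr, pow_succ, pow_mul, sq, h.involution_sq, one_pow, one_mul]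

variable [CharP F 2]

theorem additiveMap_powMonoidHom (h : IsCyclicIndexTwo ι x b n l ε) {d : C → F}
    (hd : d ∈ additiveMaps F C) (c : C) : d (powMonoidHom (2 ^ l - 1) c) = d c := by
  obtain ⟨r, hr, -⟩ := h.two_pow_sub_one_eq
  rw [powMonoidHom_apply, additiveMaps_apply_pow hd, hr]
  push_cast
  linear_combination (r * d c) * CharTwo.two_eq_zero (R := F)

theorem exists_quadratic (h : IsCyclicIndexTwo ι x b n l ε) {d : C → F}
    (hd : d ∈ additiveMaps F C) (hdx : d x = 1) :
    ∃ q : C → F, ∀ c c', q (c * c') = q c + q c' + d c * d c' := by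
  have hn : 2 ≤ n := h.two_le.trans h.l_le
  have hg : orderOf (⟨1, 1, 0⟩ : HeisenbergGroup F) ∣ orderOf x := by
    rw [h.orderOf_eq, orderOf_dvd_iff_pow_eq_one, HeisenbergGroup.pow_eq, HeisenbergGroup.one_def,
      cast_choose_two_eq_zero F (by omega) (Or.inr (by omega)), Nat.cast_pow, CharP.cast_eq_zero,
      zero_pow (by omega)]
    ext <;> simp
  have hx : ∀ c, c ∈ Subgroup.zpowers x := fun c => by
    obtain ⟨i, rfl⟩ := h.exists_eq c
    exact Subgroup.pow_mem _ (Subgroup.mem_zpowers _) _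
  let η := monoidHomOfForallMemZpowers hx hg
  have hη : ∀ i : ℕ, η (x ^ i) = ⟨i, i, (i.choose 2 : ℕ)⟩ := fun i => by
    rw [map_pow, monoidHomOfForallMemZpowers_apply_gen, HeisenbergGroup.pow_eq]
    ext <;> simp
  refine ⟨fun c => (η c).z, fun c c' => ?_⟩
  obtain ⟨i, rfl⟩ := h.exists_eq c
  obtain ⟨j, rfl⟩ := h.exists_eq c'
  simp only [map_mul, hη, HeisenbergGroup.mul_def, additiveMaps_apply_pow hd, hdx, mul_one]

theorem additiveMap_sq (h : IsCyclicIndexTwo ι x b n l ε) {d : C → F}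
    (hd : d ∈ additiveMaps F C) (hdx : d x = 1) (c : C) : d c ^ 2 = d c := by
  obtain ⟨i, rfl⟩ := h.exists_eq c
  rw [additiveMaps_apply_pow hd, hdx, mul_one]
  have h2 := CharTwo.two_eq_zero (R := F)
  rcases Nat.even_or_odd' i with ⟨t, rfl | rfl⟩ <;> push_cast <;> rw [h2] <;> ring

theorem quadratic_pow_two_mul (h : IsCyclicIndexTwo ι x b n l ε) {d q : C → F}
    (hd : d ∈ additiveMaps F C) (hdx : d x = 1) (hq : ∀ c c', q (c * c') = q c + q c' + d c * d c')
    (c : C) (t : ℕ) : q (c ^ (2 * t)) = t * d c := by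
  have h2 := CharTwo.two_eq_zero (R := F)
  induction t with
  | zero =>
    have := hq 1 1
    rw [additiveMaps_apply_one hd, mul_one] at this
    rw [mul_zero, pow_zero]
    push_cast
    linear_combination -this
  | succ t ih =>
    rw [mul_add, mul_one, pow_add, hq, ih, sq, hq, hd, ← sq (d c), h.additiveMap_sq hd hdx]
    push_cast
    linear_combination (q c + d (c ^ (2 * t)) * d c) * h2

theorem quadratic_powMonoidHom (h : IsCyclicIndexTwo ι x b n l ε) {d q : C → F}
    (hd : d ∈ additiveMaps F C) (hdx : d x = 1) (hq : ∀ c c', q (c * c') = q c + q c' + d c * d c')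
    (c : C) : q (powMonoidHom (2 ^ l - 1) c) = q c + d c := by
  obtain ⟨r, hr, -, -, hr2⟩ := h.two_pow_sub_one_eq
  obtain ⟨s, rfl⟩ : ∃ s, r = 2 * s + 1 := ⟨r / 2, by omega⟩
  rw [powMonoidHom_apply, hr, pow_succ, hq, h.quadratic_pow_two_mul hd hdx hq,
    additiveMaps_apply_pow hd]
  push_cast
  linear_combination (s * d c + (2 * s + 1) * d c * d c) * CharTwo.two_eq_zero (R := F)

/-- The quadratic relation satisfied by the values of additive maps at elements of square zero. -/
theorem evalAt_sq_eq (h : IsCyclicIndexTwo ι x b n l ε) (hn : 3 ≤ n) {y : G → F}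
    (hy : y ∈ additiveMaps F G) (hya : y (ι x) = 1) (hyb : y b = 0) {v : MonoidAlgebra F G}
    (hv : v * v = 0) :
    evalAt y v ^ 2 = augment F C (cosetPart F ι b v) * evalAt y v ∧
      evalAt y v = evalAt (fun c => y (ι c)) (cosetPart F ι 1 v) +
        evalAt (fun c => y (ι c)) (cosetPart F ι b v) := by
  have e := h.index.evalAt_eq y v
  have e' : (fun c => y (ι c * b)) = fun c => y (ι c) := funext fun c => by rw [hy, hyb, add_zero]
  rw [e'] at e
  have hd : (fun c => y (ι c)) ∈ additiveMaps F C := fun c c' => by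
    simp only [map_mul]
    exact hy _ _
  obtain ⟨q, hq⟩ := h.exists_quadratic hd hya
  refine ⟨?_, e⟩
  rw [e]
  refine h.index.evalAt_sq_eq hd hq (h.additiveMap_powMonoidHom hd)
    (h.quadratic_powMonoidHom hd hya hq) ?_ ?_ hv
  · have := additiveMaps_apply_pow hd x (2 ^ (n - 1) * ε)
    rw [this, Nat.cast_mul, Nat.cast_pow, CharP.cast_eq_zero, zero_pow (by omega)]
    ring
  · obtain ⟨n, rfl⟩ := Nat.exists_eq_add_of_le hn
    have := h.quadratic_pow_two_mul hd hya hq x (2 ^ (n + 1) * ε)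
    rw [← mul_assoc, ← pow_succ'] at this
    rw [show 3 + n - 1 = n + 1 + 1 by omega, this, Nat.cast_mul, Nat.cast_pow, CharP.cast_eq_zero,
      zero_pow (by omega)]
    ring

end IsCyclicIndexTwo

namespace IsCyclicIndexTwo

variable {F : Type*} {G C : Type*} [Field F] [CharP F 2] [Group G] [CommGroup C] [Fintype C]
  {ι : C →* G} {x : C} {b : G} {n l ε : ℕ}

theorem evalAt_involution_sq [DecidableEq C] (h : IsCyclicIndexTwo ι x b n l ε)
    (hfix : ∀ c, powMonoidHom (2 ^ l - 1) c = c → c * c ≠ x ^ 2 ^ (n - 1))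
    {v : MonoidAlgebra F G} (hv : v * v = 0) (hw : augment F C (cosetPart F ι b v) ≠ 0) :
    evalAt (fun c => if c = x ^ 2 ^ (n - 1) then 1 else 0)
      (cosetPart F ι 1 v * cosetPart F ι 1 v) = 0 := by
  have : Fact (Nat.Prime 2) := ⟨Nat.prime_two⟩
  rw [← sq, evalAt_pow_char fun g k => by rw [mul_comm]]
  refine sum_eq_zero_of_involution h.powMonoidHom_powMonoidHom (fun c => ?_) fun c hc => ?_
  · have hz : powMonoidHom (2 ^ l - 1) (c ^ 2) = x ^ 2 ^ (n - 1) ↔ c ^ 2 = x ^ 2 ^ (n - 1) := by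
      conv_lhs => rw [← h.powMonoidHom_involution]
      exact (Function.LeftInverse.injective h.powMonoidHom_powMonoidHom).eq_iff
    rw [h.index.coeff_fst h.pow_eq_one h.powMonoidHom_powMonoidHom hv hw,
      ← map_pow (powMonoidHom (2 ^ l - 1))]
    simp only [hz]
  · rw [sq c, if_neg (hfix c hc), mul_zero]

theorem evalAt_involution_mul [DecidableEq C] (h : IsCyclicIndexTwo ι x b n l ε)
    (w : MonoidAlgebra F C) :
    evalAt (fun c => if c = x ^ 2 ^ (n - 1) then 1 else 0)
      (MonoidAlgebra.single (x ^ (2 ^ (n - 1) * ε)) 1 *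
        (w * MonoidAlgebra.mapDomainAlgHom F F (powMonoidHom (2 ^ l - 1)) w)) =
      ∑ c, w.coeff c ^ 2 * if x ^ (2 ^ (n - 1) * ε) * (c * powMonoidHom (2 ^ l - 1) c) =
        x ^ 2 ^ (n - 1) then 1 else 0 := by
  rw [evalAt_single_mul]
  refine evalAt_mul_mapDomainAlgHom_self (fun c c' => ?_) w
  congr 1
  rw [← (Function.LeftInverse.injective h.powMonoidHom_powMonoidHom).eq_iff, map_mul, map_mul,
    h.powMonoidHom_powMonoidHom, h.powMonoidHom_involution, pow_mul x, map_pow,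
    h.powMonoidHom_involution, mul_comm c']

/-- In a generalized quaternion group elements of square zero lie in the kernel of the
augmentation of the coset part. -/
theorem augment_snd_eq_zero (h : IsCyclicIndexTwo ι x b n n 1) {v : MonoidAlgebra F G}
    (hv : v * v = 0) : augment F C (cosetPart F ι b v) = 0 := by
  classical
  by_contra hw
  have e : ∀ c : C, c * powMonoidHom (2 ^ n - 1) c = 1 := fun c => by
    rw [powMonoidHom_apply, ← pow_succ', Nat.sub_add_cancel Nat.one_le_two_pow, h.pow_eq_one]
  have h1 := congrArg (evalAt fun c => if c = x ^ 2 ^ (n - 1) then (1 : F) else 0)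
    (h.index.fst_sq_add hv)
  rw [map_add, h.evalAt_involution_sq (fun c hc => ?_) hv hw, h.evalAt_involution_mul, zero_add,
    map_zero] at h1
  · simp only [e, mul_one, if_true] at h1
    have : Fact (Nat.Prime 2) := ⟨Nat.prime_two⟩
    rw [← sum_pow_char 2, ← augment_eq_sum] at h1
    exact hw (pow_eq_zero_iff two_ne_zero |>.mp h1)
  · have := e c
    rw [hc] at this
    rw [this]
    exact h.involution_ne_one.symm

/-- In a semidihedral group elements of square zero lie in the kernel of the additive map that is
trivial on `b`. -/
theorem evalAt_eq_zero_of_semidihedral (h : IsCyclicIndexTwo ι x b (l + 1) l 0) {y : G → F}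
    (hy : y ∈ additiveMaps F G) (hya : y (ι x) = 1) (hyb : y b = 0) {v : MonoidAlgebra F G}
    (hv : v * v = 0) : evalAt y v = 0 := by
  classical
  obtain ⟨h0, hyv⟩ := h.evalAt_sq_eq (by have := h.two_le; omega) hy hya hyb hv
  by_contra hα
  have hw : augment F C (cosetPart F ι b v) ≠ 0 := fun h1 => by
    rw [h1, zero_mul] at h0
    exact hα (pow_eq_zero_iff two_ne_zero |>.mp h0)
  set d : C → F := fun c => y (ι c) with hdd
  have hd : d ∈ additiveMaps F C := fun c c' => by
    simp only [hdd, map_mul]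
    exact hy _ _
  have e : ∀ c : C, c * powMonoidHom (2 ^ l - 1) c = c ^ 2 ^ l := fun c => by
    rw [powMonoidHom_apply, ← pow_succ', Nat.sub_add_cancel Nat.one_le_two_pow]
  have hne := h.involution_ne_one
  rw [Nat.add_sub_cancel] at hne
  have e2 : ∀ c : C, (if c ^ 2 ^ l = x ^ 2 ^ l then 1 else 0) = d c := fun c => by
    obtain ⟨i, rfl⟩ := h.exists_eq c
    rw [additiveMaps_apply_pow hd, show d x = 1 from hya, mul_one, pow_right_comm]
    have hz : (x ^ 2 ^ l) ^ 2 = 1 := by rw [← pow_mul, ← pow_succ, h.pow_eq_one]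
    rcases Nat.even_or_odd' i with ⟨t, rfl | rfl⟩
    · rw [pow_mul (x ^ 2 ^ l), hz, one_pow, if_neg hne.symm, Nat.cast_mul, CharP.cast_eq_zero,
        zero_mul]
    · rw [pow_succ, pow_mul (x ^ 2 ^ l), hz, one_pow, one_mul, if_pos rfl, Nat.cast_succ,
        Nat.cast_mul, CharP.cast_eq_zero, zero_mul, zero_add]
  have hfix : ∀ c : C, powMonoidHom (2 ^ l - 1) c = c → c * c ≠ x ^ 2 ^ l := fun c hc hz => by
    have h1 := e c
    obtain ⟨t, rfl⟩ := Nat.exists_eq_add_of_le h.two_le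
    have h2 : (x ^ 2 ^ (2 + t)) ^ 2 = 1 := by rw [← pow_mul, ← pow_succ, h.pow_eq_one]
    rw [hc, show 2 + t = t + 1 + 1 by omega, pow_succ', pow_mul, sq c, hz, pow_succ' 2 t,
      pow_mul (x ^ _), h2, one_pow] at h1
    exact hne h1
  have h1 := congrArg (evalAt fun c => if c = x ^ 2 ^ (l + 1 - 1) then (1 : F) else 0)
    (h.index.fst_sq_add hv)
  rw [map_add, h.evalAt_involution_sq hfix hv hw, h.evalAt_involution_mul, zero_add,
    map_zero] at h1
  simp only [e, mul_zero, pow_zero, one_mul, Nat.add_sub_cancel, e2] at h1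
  have hwd : evalAt d (cosetPart F ι b v) = 0 := by
    have : Fact (Nat.Prime 2) := ⟨Nat.prime_two⟩
    rw [evalAt_eq_sum, ← pow_eq_zero_iff two_ne_zero, sum_pow_char 2, ← h1]
    exact Finset.sum_congr rfl fun c _ => by rw [mul_pow, h.additiveMap_sq hd hya]
  have hud : evalAt d (cosetPart F ι 1 v) = 0 := by
    rw [evalAt_eq_sum]
    refine sum_eq_zero_of_involution h.powMonoidHom_powMonoidHom (fun c => ?_) fun c hc => ?_
    · rw [h.index.coeff_fst h.pow_eq_one h.powMonoidHom_powMonoidHom hv hw,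
        h.additiveMap_powMonoidHom hd]
    · have := hfix c hc
      have hce := e c
      rw [hc] at hce
      rw [hce] at this
      rw [← e2, if_neg this, mul_zero]
  exact hα (by rw [hyv, hud, hwd, add_zero])

end IsCyclicIndexTwo

theorem IsCyclicIndexTwo.evalAt_eq_zero_of_quaternion {F G C : Type*} [Field F] [CharP F 2]
    [Group G] [CommGroup C] [Fintype C] {ι : C →* G} {x : C} {b : G} {n : ℕ}
    (h : IsCyclicIndexTwo ι x b n n 1) {y : G → F} (hy : y ∈ additiveMaps F G)
    (hya : y (ι x) = 0) {v : MonoidAlgebra F G} (hv : v * v = 0) : evalAt y v = 0 := by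
  have e : ∀ c, y (ι c) = 0 := fun c => by
    obtain ⟨i, rfl⟩ := h.exists_eq c
    rw [map_pow, additiveMaps_apply_pow hy, hya, mul_zero]
  have h0 := h.augment_snd_eq_zero hv
  rw [augment_eq_sum] at h0
  rw [h.index.evalAt_eq, evalAt_eq_sum, evalAt_eq_sum]
  simp [hy (ι _) b, e, ← Finset.sum_mul, h0]

theorem apply_eq_zero_of_forall_evalAt_eq_zero {F : Type*} [Field F] [CharP F 2] {G : Type*}
    [Group G] {y : G → F} (hy : y ∈ additiveMaps F G)
    (hz : ∀ v : MonoidAlgebra F G, v * v = 0 → evalAt y v = 0) {g : G} (hg : g * g = 1) :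
    y g = 0 := by
  have h2 : ∀ u : MonoidAlgebra F G, u + u = 0 := fun u => by
    rw [← two_smul F, CharTwo.two_eq_zero, zero_smul]
  have h1 : MonoidAlgebra.single g (1 : F) * MonoidAlgebra.single g 1 = 1 := by
    rw [MonoidAlgebra.single_mul_single, hg, one_mul, MonoidAlgebra.one_def]
  have := hz (MonoidAlgebra.single g 1 + 1) (by
    rw [add_mul, mul_add, h1, mul_one, one_mul, add_comm 1, h2])
  rwa [map_add, MonoidAlgebra.one_def, evalAt_single, evalAt_single,
    additiveMaps_apply_one hy, mul_zero, add_zero, one_mul] at this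

namespace IsExceptionalPair

variable {F : Type*} [Field F] [CharP F 2] {G H : Type*} [Group G] [Finite G] [Group H] [Finite H]
  {a b : G} {n l ε : ℕ}

theorem exists_additiveMap (F : Type*) [Field F] [CharP F 2] {G : Type*} [Group G] [Finite G]
    {a b : G} {n l ε : ℕ} (h : IsExceptionalPair a b n 1 l ε)
    (α β : F) : ∃ y ∈ additiveMaps F G, y a = α ∧ y b = β := by
  have : Fact (Nat.Prime 2) := ⟨Nat.prime_two⟩
  refine exists_additiveMap_of_card (p := 2) (s := 1) (t := 1) h.pair.closure_eq ?_
    (h.pow_mem_commutator b) h.card_abelianization_eq one_ne_zero one_ne_zero α β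
  rw [h.commutator_eq]
  exact Subgroup.mem_zpowers _

theorem mul_self_eq_one {G : Type*} [Group G] {a b : G} {n l : ℕ}
    (h : IsExceptionalPair a b n 1 l 0) : b * b = 1 := by
  have := h.pow_eq
  rwa [mul_zero, pow_zero, pow_one, sq] at this

theorem eq_zero_of_dihedral {G : Type*} [Group G] {a b : G} {n : ℕ}
    (h : IsExceptionalPair a b n 1 n 0) {y : G → F}
    (hy : y ∈ additiveMaps F G) (hz : ∀ v : MonoidAlgebra F G, v * v = 0 → evalAt y v = 0) :
    y = 0 := by
  have hb := apply_eq_zero_of_forall_evalAt_eq_zero hy hz h.mul_self_eq_one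
  have hab : y (a * b) = 0 := by
    refine apply_eq_zero_of_forall_evalAt_eq_zero hy hz ?_
    rw [mul_assoc, ← mul_assoc b, h.pair.mul_eq, mul_assoc (a ^ _), h.mul_self_eq_one, mul_one,
      ← zpow_one_add, add_sub_cancel]
    exact_mod_cast h.pair.pow_left
  rw [hy, hb, add_zero] at hab
  exact eq_of_mem_additiveMaps h.pair.closure_eq hy (Submodule.zero_mem _) hab hb

theorem exists_ne_zero_of_ne_dihedral (F : Type*) [Field F] [CharP F 2] {G : Type*} [Group G]
    [Finite G] {a b : G} {n l ε : ℕ} (h : IsExceptionalPair a b n 1 l ε) (hl : ¬ (l = n ∧ ε = 0)) :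
    ∃ y ∈ additiveMaps F G, y ≠ 0 ∧ ∀ v : MonoidAlgebra F G, v * v = 0 → evalAt y v = 0 := by
  obtain ⟨C, _, _, ι, x, rfl, hC⟩ := h.exists_isCyclicIndexTwo
  have h1 := h.eps_le
  have h2 := h.n_le
  have h3 := h.l_le_n
  have h4 := h.n_ne_add
  rcases (show ε = 0 ∨ ε = 1 by omega) with rfl | rfl
  · obtain rfl : n = l + 1 := by omega
    obtain ⟨y, hy, hya, hyb⟩ := h.exists_additiveMap F 1 0
    exact ⟨y, hy, fun e => by simp [e] at hya,
      fun v hv => hC.evalAt_eq_zero_of_semidihedral hy hya hyb hv⟩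
  · obtain rfl : n = l := by omega
    obtain ⟨y, hy, hya, hyb⟩ := h.exists_additiveMap F 0 1
    exact ⟨y, hy, fun e => by simp [e] at hyb, fun v hv =>
      hC.evalAt_eq_zero_of_quaternion hy hya hv⟩

theorem evalAt_eq_zero_of_quaternion (h : IsExceptionalPair a b n 1 n 1) (hn : 3 ≤ n) {y : G → F}
    (hy : y ∈ additiveMaps F G) {v : MonoidAlgebra F G} (hv : v * v = 0) : evalAt y v = 0 := by
  obtain ⟨C, _, _, ι, x, rfl, hC⟩ := h.exists_isCyclicIndexTwo
  have h0 := hC.augment_snd_eq_zero hv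
  obtain ⟨y', hy', hya', hyb'⟩ := h.exists_additiveMap F 1 0
  have h1 : evalAt y' v = 0 := by
    have := (hC.evalAt_sq_eq hn hy' hya' hyb' hv).1
    rw [h0, zero_mul] at this
    exact pow_eq_zero_iff two_ne_zero |>.mp this
  obtain ⟨z, hz, hza, hzb⟩ := h.exists_additiveMap F 0 1
  have h2 := hC.evalAt_eq_zero_of_quaternion hz hza hv
  have : y = y (ι x) • y' + y b • z :=
    eq_of_mem_additiveMaps h.pair.closure_eq hy
      (Submodule.add_mem _ (Submodule.smul_mem _ _ hy') (Submodule.smul_mem _ _ hz))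
      (by simp [hya', hza]) (by simp [hyb', hzb])
  rw [this, evalAt_add, evalAt_smul, evalAt_smul]
  simp [h1, h2]

theorem dihedral_of_algEquiv (h : IsExceptionalPair a b n 1 n 0) {a' b' : H} {n' l' ε' : ℕ}
    (h' : IsExceptionalPair a' b' n' 1 l' ε') (φ : MonoidAlgebra F G ≃ₐ[F] MonoidAlgebra F H) :
    l' = n' ∧ ε' = 0 := by
  have : Fact (Nat.Prime 2) := ⟨Nat.prime_two⟩
  by_contra hl
  obtain ⟨y, hy, hne, hz⟩ := h'.exists_ne_zero_of_ne_dihedral F hl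
  have h0 := h.eq_zero_of_dihedral (pullEval_mem_additiveMaps h.pair.isPGroup φ hy) fun v hv => by
    rw [evalAt_pullEval]
    exact hz _ (by rw [← map_mul, hv, map_zero])
  rw [← pullEval_symm_pullEval φ y, h0] at hne
  exact hne (funext fun g => by simp [pullEval, evalAt_zero])

theorem ne_zero_of_quaternion_algEquiv (h : IsExceptionalPair a b n 1 n 1) (hn : 3 ≤ n)
    {a' b' : H} {n' l' ε' : ℕ} (h' : IsExceptionalPair a' b' n' 1 l' ε')
    (φ : MonoidAlgebra F G ≃ₐ[F] MonoidAlgebra F H) : ε' ≠ 0 := by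
  have : Fact (Nat.Prime 2) := ⟨Nat.prime_two⟩
  rintro rfl
  obtain ⟨y, hy, -, hyb⟩ := h'.exists_additiveMap F 0 1
  have hb := apply_eq_zero_of_forall_evalAt_eq_zero hy (fun v hv => ?_) h'.mul_self_eq_one
  · exact one_ne_zero (hyb.symm.trans hb)
  · have := h.evalAt_eq_zero_of_quaternion hn
      (pullEval_mem_additiveMaps h.pair.isPGroup φ hy) (v := φ.symm v)
      (by rw [← map_mul, hv, map_zero])
    rw [evalAt_pullEval] at this
    simpa using this

theorem nonempty_mulEquiv_of_algEquiv {m : ℕ} (h : IsExceptionalPair a b n m l ε)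
    {a' b' : H} {n' m' l' ε' : ℕ} (h' : IsExceptionalPair a' b' n' m' l' ε')
    (φ : MonoidAlgebra F G ≃ₐ[F] MonoidAlgebra F H) : Nonempty (G ≃* H) := by
  obtain ⟨rfl, rfl, hlε⟩ := h.eq_of_algEquiv h' φ
  suffices l = l' ∧ ε = ε' by
    obtain ⟨rfl, rfl⟩ := this
    exact h.pair.nonempty_mulEquiv h'.pair
  by_cases hm : 2 ≤ m
  · exact hlε hm
  obtain rfl : m = 1 := by have := h.one_le; omega
  have h1 := h.eps_le
  have h2 := h.n_le
  have h3 := h.l_le_n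
  have h4 := h.n_ne_add
  have h5 := h.two_le
  have h1' := h'.eps_le
  have h2' := h'.n_le
  have h3' := h'.l_le_n
  have h4' := h'.n_ne_add
  have h5' := h'.two_le
  by_cases hd : l = n ∧ ε = 0
  · obtain ⟨rfl, rfl⟩ := hd
    obtain ⟨rfl, rfl⟩ := h.dihedral_of_algEquiv h' φ
    exact ⟨rfl, rfl⟩
  by_cases hd' : l' = n ∧ ε' = 0
  · obtain ⟨rfl, rfl⟩ := hd'
    exact absurd (h'.dihedral_of_algEquiv h φ.symm) hd
  by_cases hq : ε = 1
  · obtain rfl := hq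
    obtain rfl : l = n := by omega
    by_cases hn : 3 ≤ l
    · have := h.ne_zero_of_quaternion_algEquiv hn h' φ
      omega
    · omega
  by_cases hq' : ε' = 1
  · obtain rfl := hq'
    obtain rfl : l' = n := by omega
    have := h'.ne_zero_of_quaternion_algEquiv (by omega) h φ.symm
    omega
  omega

end IsExceptionalPair

/-- The Modular Isomorphism Problem has a positive answer for finite metacyclic `p`-groups
over any field of characteristic `p`. -/
theorem mip_metacyclic (p : ℕ) [Fact p.Prime]
    (F : Type*) [Field F] [CharP F p]
    (G H : Type*) [Group G] [Finite G] [Group H] [Finite H]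
    (hG : IsPGroup p G) (hGmc : IsMetacyclic G)
    (hiso : Nonempty (MonoidAlgebra F G ≃ₐ[F] MonoidAlgebra F H)) :
    Nonempty (G ≃* H) := by
  obtain ⟨φ⟩ := hiso
  have hH : IsPGroup p H := by
    obtain ⟨n, hn⟩ := IsPGroup.iff_card.mp hG
    exact IsPGroup.of_card ((Nat.card_eq_of_monoidAlgebra_linearEquiv
        φ.toLinearEquiv).symm.trans hn)
  rcases hGmc.exists_isOrdinaryPair_or hG with
    ⟨a, b, n, m, r, s, h⟩ | ⟨rfl, a, b, n, m, S, k, h, hn, hk⟩ <;>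
  rcases (hGmc.of_algEquiv hG hH φ).exists_isOrdinaryPair_or hH with
    ⟨a', b', n', m', r', s', h'⟩ | ⟨hp, a', b', n', m', S', k', h', hn', hk'⟩
  · exact h.nonempty_mulEquiv_of_algEquiv h' φ
  · subst hp
    obtain ⟨_, _, _, _, _, _, h'⟩ := h'.exists_isExceptionalPair hn' hk'
    exact (h'.not_nonempty_algEquiv h φ.symm).elim
  · obtain ⟨_, _, _, _, _, _, h⟩ := h.exists_isExceptionalPair hn hk
    exact (h.not_nonempty_algEquiv h' φ).elim
  · obtain ⟨_, _, _, _, _, _, h⟩ := h.exists_isExceptionalPair hn hk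
    obtain ⟨_, _, _, _, _, _, h'⟩ := h'.exists_isExceptionalPair hn' hk'
    exact h.nonempty_mulEquiv_of_algEquiv h' φ
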